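/- Let n ≥ 3, 0 < α < 1, ζ > 1, ζ' > 0 and τ ∈ (0, π/4); set a = cot τ and b = √(a² − 1). Let f : ℝⁿ → ℝ be α-Hölder continuous on every compact set, with finite limit f(∞) = lim_{|x|→∞} f(x), satisfying limsup_{|x|→∞} ( |x|^ζ |f(x) − f(∞)| + |x|^{α+ζ'} [f]_{C^α(B̄_{|x|/2}(x))} ) < ∞. Let u ∈ C²(ℝⁿ) satisfy (√(a²+1)/(2b)) Σᵢ ln((λᵢ(D²u(x))+a−b)/(λᵢ(D²u(x))+a+b)) = f(x) for all x ∈ ℝⁿ, with u(x) ≤ C(1+|x|²) for all x for some constant C and D²u(x) − (−a+b)I positive definite for every x. Then there exist ε > 0, C' > 0 and a symmetric n×n matrix A with A − (−a+b)I positive definite and (√(a²+1)/(2b)) Σᵢ ln((λᵢ(A)+a−b)/(λᵢ(A)+a+b)) = f(∞), such that sup_{ℝⁿ}|D²u| + [D²u]_{C^α(ℝⁿ)} ≤ C' and |D²u(x) − A| ≤ C' |x|^{−ε} for all |x| ≥ 1. -/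

import Mathlib

open Filter

/-- The Hessian matrix `(∂ᵢ∂ⱼ u(x))` of a function on Euclidean space. -/
noncomputable def hess {n : ℕ} (u : EuclideanSpace ℝ (Fin n) → ℝ)
    (x : EuclideanSpace ℝ (Fin n)) : Matrix (Fin n) (Fin n) ℝ :=
  Matrix.of fun i j =>
    iteratedFDeriv ℝ 2 u x ![EuclideanSpace.single i 1, EuclideanSpace.single j 1]

namespace MAx
open MeasureTheory Metric Set
open scoped Topology
open scoped RealInnerProductSpace
set_option maxHeartbeats 1000000
set_option linter.all false
noncomputable section
local notation "pp" => (by positivity)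
local notation "nm" => (by norm_num)
local notation "mll" => mul_le_mul_of_nonneg_left
local notation "mlr" => mul_le_mul_of_nonneg_right
abbrev E (n : ℕ) := EuclideanSpace ℝ (Fin n)
abbrev L (n : ℕ) := E n →L[ℝ] E n
variable {n : ℕ}
scoped instance : NormedAddCommGroup (E n) := inferInstance
scoped instance : NormedSpace ℝ (E n) := inferInstance
scoped instance : Module ℝ (E n) := inferInstance
scoped instance : AddCommGroup (E n) := inferInstance
scoped instance : AddCommMonoid (E n) := inferInstance
scoped instance : TopologicalSpace (E n) := inferInstance
scoped instance : SeminormedAddCommGroup (E n) := inferInstance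
scoped instance : SMul ℝ (E n) := inferInstance
scoped instance : ContinuousSMul ℝ (E n) := inferInstance
scoped instance : Norm (E n) := inferInstance
scoped instance : NormedAddCommGroup (L n) := inferInstance
scoped instance : NormedSpace ℝ (L n) := inferInstance
scoped instance : NormedRing (L n) := inferInstance
scoped instance : Ring (L n) := inferInstance
scoped instance : Module ℝ (L n) := inferInstance
scoped instance : AddCommGroup (L n) := inferInstance
scoped instance : AddCommMonoid (L n) := inferInstance
scoped instance : AddMonoid (L n) := inferInstance
scoped instance : TopologicalSpace (L n) := inferInstance
scoped instance : SeminormedAddCommGroup (L n) := inferInstance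
scoped instance : SMul ℝ (L n) := inferInstance
scoped instance : ContinuousSMul ℝ (L n) := inferInstance
scoped instance : Norm (L n) := inferInstance
scoped instance : Mul (L n) := inferInstance
scoped instance : Add (L n) := inferInstance
scoped instance : Sub (L n) := inferInstance
scoped instance : Neg (L n) := inferInstance
scoped instance : One (L n) := inferInstance
scoped instance : Zero (L n) := inferInstance
scoped instance : Semiring (L n) := inferInstance
scoped instance : NormSMulClass ℝ (L n) := inferInstance
scoped instance : FunLike (L n) (E n) (E n) := inferInstance
scoped instance : MeasurableSpace (E n) := inferInstance
scoped instance : MeasureSpace (E n) := inferInstance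
scoped instance : ContinuousAdd (L n) := inferInstance
scoped instance : MulAction ℝ (L n) := inferInstance
scoped instance : T2Space (E n) := inferInstance
scoped instance : AddMonoidHomClass (L n →L[ℝ] ℝ) (L n) ℝ := inferInstance
scoped instance : MulActionHomClass (L n →L[ℝ] ℝ) ℝ (L n) ℝ := inferInstance
scoped instance : Zero (E n) := inferInstance
scoped instance : AddRightStrictMono ℝ := inferInstance
local notation "Bz" => closedBall (0 : E n)
variable {l m l' m' k lam s R r a ν t d σ θ b i B μ C F e η e' β κ D ρ ε g0 α ζ Γ : ℝ} {X Y M N A : L n} {c z x h y : E n} {U H : E n → L n} {K Ω Ω' : Set (E n)} {Q p : E n → E n} {f w φ V g W v : E n → ℝ} {f' : ℝ → ℝ}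
theorem mcz {x : E n} : x ∈ Bz r ↔ ‖x‖ ≤ r := mem_closedBall_zero_iff
theorem mcb {x : E n} : MeasurableSet (closedBall x r) := isClosed_closedBall.measurableSet
theorem cbs {x : E n} {s : ℝ} (h : r ≤ s) : closedBall x r ⊆ closedBall x s := closedBall_subset_closedBall h
theorem icb (x : E n) (r : ℝ) : IsCompact (closedBall x r) := isCompact_closedBall x r
theorem isl (x y : E n) (r : ℝ) : ⟪r • x, y⟫ = r * ⟪x, y⟫ := real_inner_smul_left x y r
theorem rsq (x : E n) : ⟪x, x⟫ = ‖x‖ ^ 2 := real_inner_self_eq_norm_sq x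
theorem rnn (h : 0 ≤ r) : ‖r‖ = r := Real.norm_of_nonneg h
def tr : L n →L[ℝ] ℝ :=
  LinearMap.toContinuousLinearMap
    ((LinearMap.trace ℝ (E n)) ∘ₗ (ContinuousLinearMap.coeLM ℝ : L n →ₗ[ℝ] (E n →ₗ[ℝ] E n)))
theorem tr_def (X : L n) : tr X = LinearMap.trace ℝ (E n) (X : E n →ₗ[ℝ] E n) := rfl
theorem tr_comm (X Y : L n) : tr (X * Y) = tr (Y * X) := by
  simp only [tr_def]
  exact LinearMap.trace_mul_comm ℝ (X : E n →ₗ[ℝ] E n) (Y : E n →ₗ[ℝ] E n)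
theorem tr_sum {ι : Type*} [Fintype ι] (b : OrthonormalBasis ι ℝ (E n)) (X : L n) :
    tr X = ∑ i, ⟪b i, X (b i)⟫ := by
  classical
  rw [tr_def, LinearMap.trace_eq_sum_inner _ b]; rfl
theorem tr_one : tr (1 : L n) = n := by
  rw [tr_sum (EuclideanSpace.basisFun (Fin n) ℝ)]; simp
def ro (p q : E n) : L n := (innerSL ℝ q).smulRight p
theorem ro_apply (p q x : E n) : ro p q x = ⟪q, x⟫ • p := rfl
theorem tr_ro (X : L n) (p q : E n) : tr (X * ro p q) = ⟪X p, q⟫ := by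
  rw [tr_sum (EuclideanSpace.basisFun (Fin n) ℝ)]
  have : ∀ i, ⟪(EuclideanSpace.basisFun (Fin n) ℝ) i, (X * ro p q) ((EuclideanSpace.basisFun (Fin n) ℝ) i)⟫
     = ⟪X p, (EuclideanSpace.basisFun (Fin n) ℝ) i⟫ * ⟪(EuclideanSpace.basisFun (Fin n) ℝ) i, q⟫ := by
    intro i
    rw [mul_apply_eq_comp, ro_apply, map_smul, inner_smul_right, real_inner_comm q,
      real_inner_comm (X p)]; ring
  simp_rw [this]
  exact OrthonormalBasis.sum_inner_mul_inner _ _ _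
structure Ell (l m : ℝ) (X : L n) : Prop where
  sym : ∀ x y, ⟪X x, y⟫ = ⟪x, X y⟫
  lo : ∀ x, l * ‖x‖ ^ 2 ≤ ⟪X x, x⟫
  hi : ∀ x, ⟪X x, x⟫ ≤ m * ‖x‖ ^ 2
theorem Ell.mono (h : Ell l m X) (hl : l' ≤ l) (hm : m ≤ m') : Ell l' m' X :=
  ⟨h.sym, fun x => (mlr hl (sq_nonneg _)).trans (h.lo x),
    fun x => (h.hi x).trans (mlr hm (sq_nonneg _))⟩
theorem norm_le_of_quad (hm : 0 ≤ m) (hs : ∀ x y, ⟪X x, y⟫ = ⟪x, X y⟫)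
    (h : ∀ x, |⟪X x, x⟫| ≤ m * ‖x‖ ^ 2) : ‖X‖ ≤ m := by
  refine ContinuousLinearMap.opNorm_le_bound _ hm fun x => ?_
  by_cases h0 : X x = 0
  · rw [h0, norm_zero]; positivity
  have hx : 0 < ‖X x‖ := norm_pos_iff.2 h0
  set y := (‖x‖ / ‖X x‖) • X x with hy
  have hyn : ‖y‖ = ‖x‖ := by
    rw [hy, norm_smul, rnn pp]; field_simp
  have hxy : ⟪X x, y⟫ = ‖x‖ * ‖X x‖ := by
    rw [hy, inner_smul_right, rsq]; field_simp
  have h1 := (abs_le.1 (h (x + y))).2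
  have h2 := (abs_le.1 (h (x - y))).1
  have h3 := parallelogram_law_with_norm ℝ x y
  have h4 : ⟪X y, x⟫ = ⟪X x, y⟫ := by rw [hs, real_inner_comm]
  simp only [map_add, map_sub, inner_add_left, inner_add_right, inner_sub_left, inner_sub_right] at h1 h2
  rw [h4] at h1 h2
  have h5 : 4 * (‖x‖ * ‖X x‖) ≤ m * (4 * ‖x‖ ^ 2) := by
    rw [← hxy]
    have : ‖x + y‖ ^ 2 + ‖x - y‖ ^ 2 = 4 * ‖x‖ ^ 2 := by rw [hyn] at h3; linarith
    rw [← this]; linarith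
  rcases (norm_nonneg x).eq_or_lt with h6 | h6
  · have : x = 0 := norm_eq_zero.1 h6.symm
    exact absurd (by rw [this, map_zero]) h0
  · exact le_of_mul_le_mul_left (by linarith) h6
theorem Ell.norm_le (h : Ell l m X) (hl : 0 ≤ l) (hm : 0 ≤ m) : ‖X‖ ≤ m :=
  norm_le_of_quad hm h.sym fun x => abs_le.2 ⟨by
    have := h.lo x; nlinarith [sq_nonneg ‖x‖, mul_nonneg hl (sq_nonneg ‖x‖), mul_nonneg hm (sq_nonneg ‖x‖)], h.hi x⟩
def dg (b : OrthonormalBasis (Fin n) ℝ (E n)) (c : Fin n → ℝ) : L n :=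
  ∑ i, c i • ro (b i) (b i)
theorem dg_b (b : OrthonormalBasis (Fin n) ℝ (E n)) (c : Fin n → ℝ) (i : Fin n) :
    dg b c (b i) = c i • b i := by
  simp only [dg, sum_apply, smul_apply, ro_apply]
  rw [Finset.sum_eq_single i]
  · simp
  · intro j _ hj; simp [b.inner_eq_zero hj]
  · simp
theorem ext_b (b : OrthonormalBasis (Fin n) ℝ (E n)) (h : ∀ i, X (b i) = Y (b i)) : X = Y := by
  have : (X : E n →ₗ[ℝ] E n) = Y := b.toBasis.ext (by simpa using h)
  ext1 x; exact congrArg (fun f : E n →ₗ[ℝ] E n => f x) this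
theorem dg_mul (b : OrthonormalBasis (Fin n) ℝ (E n)) (c d : Fin n → ℝ) :
    dg b c * dg b d = dg b (fun i => c i * d i) :=
  ext_b b fun i => by simp [dg_b, smul_smul, mul_comm]
theorem dg_one (b : OrthonormalBasis (Fin n) ℝ (E n)) : dg b (fun _ => 1) = 1 :=
  ext_b b fun i => by simp [dg_b]
theorem dg_sub_one (b : OrthonormalBasis (Fin n) ℝ (E n)) (c : Fin n → ℝ) :
    dg b c - 1 = dg b (fun i => c i - 1) :=
  ext_b b fun i => by simp [dg_b, sub_smul]
theorem dg_tr (b : OrthonormalBasis (Fin n) ℝ (E n)) (c : Fin n → ℝ) : tr (dg b c) = ∑ i, c i := by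
  rw [tr_sum b]; simp [dg_b, inner_smul_right]
theorem dg_det (b : OrthonormalBasis (Fin n) ℝ (E n)) (c : Fin n → ℝ) : (dg b c).det = ∏ i, c i := by
  have : LinearMap.toMatrix b.toBasis b.toBasis (dg b c : E n →ₗ[ℝ] E n) = Matrix.diagonal c := by
    ext i j
    rw [LinearMap.toMatrix_apply]
    simp [dg_b, Matrix.diagonal_apply, b.repr_self]
    split_ifs with h <;> simp [h]
  rw [ContinuousLinearMap.det, ← LinearMap.det_toMatrix b.toBasis, this, Matrix.det_diagonal]
theorem dg_inner (b : OrthonormalBasis (Fin n) ℝ (E n)) (c : Fin n → ℝ) (x y : E n) :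
    ⟪dg b c x, y⟫ = ∑ i, c i * (⟪b i, x⟫ * ⟪b i, y⟫) := by
  simp only [dg, sum_apply, smul_apply, ro_apply, sum_inner, isl]
theorem dg_sym (b : OrthonormalBasis (Fin n) ℝ (E n)) (c : Fin n → ℝ) (x y : E n) :
    ⟪dg b c x, y⟫ = ⟪x, dg b c y⟫ := by
  rw [real_inner_comm (dg b c y) x, dg_inner, dg_inner]
  exact Finset.sum_congr rfl fun i _ => by ring
theorem sum_sq (b : OrthonormalBasis (Fin n) ℝ (E n)) (x : E n) : ∑ i, ⟪b i, x⟫ ^ 2 = ‖x‖ ^ 2 := by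
  simpa using b.sum_sq_norm_inner_right x
theorem dg_ell (b : OrthonormalBasis (Fin n) ℝ (E n)) (c : Fin n → ℝ) 
    (hl : ∀ i, l ≤ c i) (hm : ∀ i, c i ≤ m) : Ell l m (dg b c) := by
  refine ⟨dg_sym b c, fun x => ?_, fun x => ?_⟩
  · rw [dg_inner, ← sum_sq b, Finset.mul_sum]
    exact Finset.sum_le_sum fun i _ => by
      rw [← sq]; exact mlr (hl i) (sq_nonneg _)
  · rw [dg_inner, ← sum_sq b, Finset.mul_sum]
    exact Finset.sum_le_sum fun i _ => by
      rw [← sq]; exact mlr (hm i) (sq_nonneg _)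
theorem exists_dg (hs : ∀ x y, ⟪X x, y⟫ = ⟪x, X y⟫) :
    ∃ b c, X = dg b c := by
  have h : (X : E n →ₗ[ℝ] E n).IsSymmetric := fun x y => hs x y
  refine ⟨h.eigenvectorBasis (finrank_euclideanSpace_fin), h.eigenvalues finrank_euclideanSpace_fin, ?_⟩
  refine ext_b (h.eigenvectorBasis (finrank_euclideanSpace_fin)) fun i => ?_
  rw [dg_b]; exact h.apply_eigenvectorBasis _ i
theorem dg_val (b : OrthonormalBasis (Fin n) ℝ (E n)) (c : Fin n → ℝ) (i : Fin n) :
    c i = ⟪dg b c (b i), b i⟫ := by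
  simp [dg_b, isl]
theorem Ell.exists_dg (h : Ell l m X) :
    ∃ b c, X = dg b c ∧ (∀ i, l ≤ c i) ∧ ∀ i, c i ≤ m := by
  obtain ⟨b, c, rfl⟩ := MAx.exists_dg h.sym
  exact ⟨b, c, rfl, fun i => by have := h.lo (b i); rw [← dg_val] at this; simpa using this,
    fun i => by have := h.hi (b i); rw [← dg_val] at this; simpa using this⟩
abbrev inv (X : L n) : L n := Ring.inverse X
def ldet (X : L n) : ℝ := Real.log X.det
theorem inv_eq (h : X * Y = 1) (h' : Y * X = 1) : inv X = Y :=
  Ring.inverse_unit ⟨X, Y, h, h'⟩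
theorem dg_mul_inv (b : OrthonormalBasis (Fin n) ℝ (E n)) {c : Fin n → ℝ} (hc : ∀ i, c i ≠ 0) :
    dg b c * dg b (fun i => (c i)⁻¹) = 1 := by
  rw [dg_mul, ← dg_one b]; congr 1; ext i; exact mul_inv_cancel₀ (hc i)
theorem dg_inv (b : OrthonormalBasis (Fin n) ℝ (E n)) {c : Fin n → ℝ} (hc : ∀ i, c i ≠ 0) :
    inv (dg b c) = dg b (fun i => (c i)⁻¹) :=
  inv_eq (dg_mul_inv b hc) (by rw [dg_mul, ← dg_one b]; congr 1; ext i; exact inv_mul_cancel₀ (hc i))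
theorem Ell.isUnit (h : Ell l m X) (hl : 0 < l) : IsUnit X := by
  obtain ⟨b, c, rfl, h1, h2⟩ := h.exists_dg
  have hc : ∀ i, c i ≠ 0 := fun i => (hl.trans_le (h1 i)).ne'
  exact ⟨⟨_, dg b (fun i => (c i)⁻¹), dg_mul_inv b hc,
    by rw [dg_mul, ← dg_one b]; congr 1; ext i; exact inv_mul_cancel₀ (hc i)⟩, rfl⟩
theorem Ell.mul_inv (h : Ell l m X) (hl : 0 < l) : X * inv X = 1 :=
  Ring.mul_inverse_cancel _ (h.isUnit hl)
theorem Ell.inv_mul (h : Ell l m X) (hl : 0 < l) : inv X * X = 1 :=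
  Ring.inverse_mul_cancel _ (h.isUnit hl)
theorem Ell.inv (h : Ell l m X) (hl : 0 < l) : Ell m⁻¹ l⁻¹ (inv X) := by
  obtain ⟨b, c, rfl, h1, h2⟩ := h.exists_dg
  rw [dg_inv b fun i => (hl.trans_le (h1 i)).ne']
  exact dg_ell b _ (fun i => inv_anti₀ (hl.trans_le (h1 i)) (h2 i)) fun i => inv_anti₀ hl (h1 i)
theorem Ell.det_bd (h : Ell l m X) (hl : 0 < l) : l ^ n ≤ X.det ∧ X.det ≤ m ^ n := by
  obtain ⟨b, c, rfl, h1, h2⟩ := h.exists_dg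
  rw [dg_det]
  constructor
  · calc l ^ n = ∏ _i : Fin n, l := by simp
      _ ≤ _ := Finset.prod_le_prod (fun _ _ => hl.le) fun i _ => h1 i
  · calc _ ≤ ∏ _i : Fin n, m := Finset.prod_le_prod (fun i _ => (hl.le.trans (h1 i))) fun i _ => h2 i
      _ = _ := by simp
theorem Ell.det_pos (h : Ell l m X) (hl : 0 < l) : 0 < X.det :=
  (pow_pos hl n).trans_le (h.det_bd hl).1
theorem Ell.smul (h : Ell l m X) (hk : 0 ≤ k) : Ell (k * l) (k * m) (k • X) := by
  refine ⟨fun x y => by simp [isl, inner_smul_right, h.sym], fun x => ?_, fun x => ?_⟩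
  · simp only [smul_apply, isl]
    have := mll (h.lo x) hk; simp; linarith
  · simp only [smul_apply, isl]
    have := mll (h.hi x) hk; simp; linarith
def Psd (X : L n) : Prop := (∀ x y, ⟪X x, y⟫ = ⟪x, X y⟫) ∧ ∀ x, 0 ≤ ⟪X x, x⟫
theorem tr_mul_psd {U : L n} (h : Ell l m U) (hX : Psd X) :
    l * tr X ≤ tr (U * X) := by
  obtain ⟨b, c, rfl⟩ := exists_dg hX.1
  have hc : ∀ i, 0 ≤ c i := fun i => by rw [dg_val b c i]; exact hX.2 _
  rw [dg_tr, tr_sum b, Finset.mul_sum]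
  refine Finset.sum_le_sum fun i _ => ?_
  rw [mul_apply_eq_comp, dg_b, map_smul, inner_smul_right, real_inner_comm]
  have := h.lo (b i)
  simp at this
  nlinarith [hc i, mll this (hc i)]
theorem log_ineq {z K : ℝ} (hz : 0 < z) (hK : z ≤ K) : (z - 1) ^ 2 / (2 * (K + 1)) ≤ z - 1 - Real.log z := by
  have h1 : Real.log z ≤ 2 * (Real.sqrt z - 1) := by
    have := Real.log_le_sub_one_of_pos (Real.sqrt_pos.2 hz)
    rw [Real.log_sqrt hz.le] at this; linarith
  have hs := Real.sq_sqrt hz.le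
  have hs0 := Real.sqrt_nonneg z
  have h2 : (z - 1) ^ 2 / (2 * (K + 1)) ≤ (Real.sqrt z - 1) ^ 2 := by
    rw [div_le_iff₀ (by linarith)]
    have : (z - 1) ^ 2 = (Real.sqrt z - 1) ^ 2 * (Real.sqrt z + 1) ^ 2 := by
      nth_rw 1 [← hs]; ring
    rw [this]
    apply mll _ (sq_nonneg _)
    nlinarith [sq_nonneg (Real.sqrt z - 1)]
  nlinarith
theorem dg_norm_sq (b : OrthonormalBasis (Fin n) ℝ (E n)) (c : Fin n → ℝ) : ‖dg b c‖ ^ 2 ≤ ∑ i, c i ^ 2 := by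
  have h0 : 0 ≤ ∑ i, c i ^ 2 := Finset.sum_nonneg fun i _ => sq_nonneg _
  have hc : ∀ i, |c i| ≤ Real.sqrt (∑ i, c i ^ 2) := fun i => by
    apply Real.abs_le_sqrt
    exact Finset.single_le_sum (f := fun i => c i ^ 2) (fun i _ => sq_nonneg _) (Finset.mem_univ i)
  have : ‖dg b c‖ ≤ Real.sqrt (∑ i, c i ^ 2) := by
    have he := dg_ell b c (fun i => (abs_le.1 (hc i)).1) (fun i => (abs_le.1 (hc i)).2)
    exact norm_le_of_quad (Real.sqrt_nonneg _) he.sym fun x => abs_le.2 ⟨by have := he.lo x; linarith, he.hi x⟩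
  calc _ ≤ Real.sqrt (∑ i, c i ^ 2) ^ 2 := by gcongr
    _ = _ := Real.sq_sqrt h0
theorem Ell.exists_root (h : Ell l m Y) (hl : 0 < l) :
    ∃ T S : L n, T * S = 1 ∧ S * T = 1 ∧ (∀ x y, ⟪T x, y⟫ = ⟪x, T y⟫) ∧ T * T = MAx.inv Y ∧
      S * S = Y ∧ Ell (Real.sqrt l) (Real.sqrt m) S ∧ T.det ^ 2 * Y.det = 1 := by
  obtain ⟨b, c, rfl, h1, h2⟩ := h.exists_dg
  have hc : ∀ i, 0 < c i := fun i => hl.trans_le (h1 i)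
  have hsq : ∀ i, Real.sqrt (c i) ≠ 0 := fun i => (Real.sqrt_pos.2 (hc i)).ne'
  refine ⟨dg b (fun i => (Real.sqrt (c i))⁻¹), dg b (fun i => Real.sqrt (c i)), ?_, dg_mul_inv b hsq,
    dg_sym b _, ?_, ?_, dg_ell b _ (fun i => Real.sqrt_le_sqrt (h1 i)) (fun i => Real.sqrt_le_sqrt (h2 i)), ?_⟩
  · rw [dg_mul, ← dg_one b]; congr 1; ext i; exact inv_mul_cancel₀ (hsq i)
  · rw [dg_inv b fun i => (hc i).ne', dg_mul]; congr 1; ext i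
    rw [← _root_.mul_inv, Real.mul_self_sqrt (hc i).le]
  · rw [dg_mul]; congr 1; ext i; exact Real.mul_self_sqrt (hc i).le
  · rw [dg_det, dg_det, ← Finset.prod_pow, ← Finset.prod_mul_distrib]
    apply Finset.prod_eq_one; intro i _
    rw [inv_pow, Real.sq_sqrt (hc i).le]; exact inv_mul_cancel₀ (hc i).ne'
theorem det_mul (X Y : L n) : (X * Y).det = X.det * Y.det := by
  simp only [ContinuousLinearMap.det]
  exact LinearMap.det_comp (X : E n →ₗ[ℝ] E n) (Y : E n →ₗ[ℝ] E n)
theorem F2 (hl : 0 < l) (hX : Ell l m X) (hY : Ell l m Y) (hm : 0 < m):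
    ldet X - ldet Y + (1 / (2 * (m / l + 1) * m ^ 2)) * ‖X - Y‖ ^ 2 ≤ tr (inv Y * (X - Y)) := by
  obtain ⟨T, S, hTS, hST, hT, hTT, hSS, hS, hdet⟩ := hY.exists_root hl
  have hZs : ∀ x y, ⟪(T * X * T) x, y⟫ = ⟪x, (T * X * T) y⟫ := fun x y => by
    simp only [mul_apply_eq_comp]; rw [hT, hX.sym, hT]
  obtain ⟨b, z, hz⟩ := exists_dg hZs
  have hzv : ∀ i, z i = ⟪X (T (b i)), T (b i)⟫ := fun i => by
    rw [dg_val b z i, ← hz]; simp only [mul_apply_eq_comp]; rw [hT]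
  have hY' := hY.inv hl
  have hTb : ∀ i, m⁻¹ ≤ ‖T (b i)‖ ^ 2 ∧ ‖T (b i)‖ ^ 2 ≤ l⁻¹ := fun i => by
    have e : ‖T (b i)‖ ^ 2 = ⟪inv Y (b i), b i⟫ := by
      rw [← hTT, mul_apply_eq_comp, hT, rsq]
    rw [e]
    have h1 := hY'.lo (b i); have h2 := hY'.hi (b i)
    simp at h1 h2; exact ⟨h1, h2⟩
  have hz0 : ∀ i, 0 < z i := fun i => by
    rw [hzv]; exact lt_of_lt_of_le (mul_pos hl ((inv_pos.2 hm).trans_le (hTb i).1)) (hX.lo _)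
  have hz1 : ∀ i, z i ≤ m / l := fun i => by
    rw [hzv, div_eq_mul_inv]; exact (hX.hi _).trans (mll (hTb i).2 hm.le)
  have hdX := hX.det_pos hl
  have hdY := hY.det_pos hl
  have e1 : ldet X - ldet Y = ∑ i, Real.log (z i) := by
    have : (T * X * T).det = X.det / Y.det := by
      rw [det_mul, det_mul, eq_div_iff hdY.ne']; linear_combination X.det * hdet
    rw [ldet, ldet, ← Real.log_div hdX.ne' hdY.ne', ← this, hz, dg_det,
      Real.log_prod (fun i _ => (hz0 i).ne')]
  have e2 : tr (inv Y * (X - Y)) = ∑ i, (z i - 1) := by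
    rw [mul_sub, hY.inv_mul hl, ← dg_tr b, ← dg_sub_one, ← hz, map_sub, map_sub, ← hTT, mul_assoc, tr_comm]
  have e3 : ‖X - Y‖ ^ 2 ≤ m ^ 2 * ∑ i, (z i - 1) ^ 2 := by
    have : X - Y = S * (T * X * T - 1) * S := by
      rw [mul_sub, sub_mul, mul_one, hSS]
      calc X - Y = (S * T) * X * (T * S) - Y := by rw [hST, hTS]; simp
        _ = _ := by noncomm_ring
    have hSn := hS.norm_le (Real.sqrt_nonneg _) (Real.sqrt_nonneg _)
    have h3 : ‖X - Y‖ ≤ m * ‖T * X * T - 1‖ := by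
      rw [this]
      calc _ ≤ ‖S‖ * ‖T * X * T - 1‖ * ‖S‖ := (norm_mul_le _ _).trans (by gcongr; exact norm_mul_le _ _)
        _ ≤ Real.sqrt m * ‖T * X * T - 1‖ * Real.sqrt m := by gcongr
        _ = _ := by rw [mul_right_comm, Real.mul_self_sqrt hm.le]
    have h4 : ‖T * X * T - 1‖ ^ 2 ≤ ∑ i, (z i - 1) ^ 2 := by
      rw [hz, dg_sub_one]; exact dg_norm_sq b _
    calc _ ≤ (m * ‖T * X * T - 1‖) ^ 2 := by gcongr
      _ = m ^ 2 * ‖T * X * T - 1‖ ^ 2 := by ring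
      _ ≤ _ := by gcongr
  rw [e1, e2]
  have e4 : ∑ i, (z i - 1) ^ 2 / (2 * (m / l + 1)) ≤ ∑ i, (z i - 1 - Real.log (z i)) :=
    Finset.sum_le_sum fun i _ => log_ineq (hz0 i) (hz1 i)
  rw [Finset.sum_sub_distrib, ← Finset.sum_div] at e4
  have : 1 / (2 * (m / l + 1) * m ^ 2) * ‖X - Y‖ ^ 2 ≤ (∑ i, (z i - 1) ^ 2) / (2 * (m / l + 1)) := by
    calc _ ≤ 1 / (2 * (m / l + 1) * m ^ 2) * (m ^ 2 * ∑ i, (z i - 1) ^ 2) := by gcongr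
      _ = _ := by field_simp
  linarith
theorem F2' (hl : 0 < l) (hX : Ell l m X) (hY : Ell l m Y) (hm : 0 < m):
    ldet X - ldet Y ≤ tr (inv Y * (X - Y)) := by
  have := F2 hl hX hY hm
  have h2 : 0 ≤ (1 / (2 * (m / l + 1) * m ^ 2)) * ‖X - Y‖ ^ 2 := pp
  linarith
def gr (p : E n) : E n →L[ℝ] ℝ := innerSL ℝ p
theorem gr_apply (p y : E n) : gr p y = ⟪p, y⟫ := rfl
theorem hfd {F : Type*} [NormedAddCommGroup F] [NormedSpace ℝ F] {f : E n → F} {f' g' : E n →L[ℝ] F} 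
    (h : HasFDerivAt f f' x) (e : ∀ y, f' y = g' y) : HasFDerivAt f g' x :=
  h.congr_fderiv (ContinuousLinearMap.ext e)
theorem mul_smulL (c : ℝ) (X Y : L n) : X * (c • Y) = c • (X * Y) := by ext1 y; simp
theorem smul_mulL (c : ℝ) (X Y : L n) : (c • X) * Y = c • (X * Y) := by ext1 y; simp
theorem ro_cont {P : E n → E n} (hP : ContinuousOn P Ω) (hQ : ContinuousOn Q Ω) :
    ContinuousOn (fun x => ro (P x) (Q x)) Ω := by
  rw [continuousOn_clm_apply]; intro y
  simp only [ro_apply]; fun_prop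
structure C1 (Ω : Set (E n)) (w : E n → ℝ) (P : E n → E n) : Prop where
  d1 : ∀ x ∈ Ω, HasFDerivAt w (gr (P x)) x
  c : ContinuousOn P Ω
structure C2 (Ω : Set (E n)) (w : E n → ℝ) (P : E n → E n) (G : E n → L n) : Prop where
  d1 : ∀ x ∈ Ω, HasFDerivAt w (gr (P x)) x
  d2 : ∀ x ∈ Ω, HasFDerivAt P (G x) x
  c : ContinuousOn G Ω
theorem C2.c1 {w P G} (h : C2 Ω w P G) : C1 Ω w P :=
  ⟨h.d1, fun x hx => (h.d2 x hx).continuousAt.continuousWithinAt⟩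
theorem C1.cw {w P} (h : C1 Ω w P) : ContinuousOn w Ω :=
  fun x hx => (h.d1 x hx).continuousAt.continuousWithinAt
theorem C2.mono {w P G} (h : C2 Ω w P G) (hs : Ω' ⊆ Ω) : C2 Ω' w P G :=
  ⟨fun x hx => h.d1 x (hs hx), fun x hx => h.d2 x (hs hx), h.c.mono hs⟩
theorem C1.mono {w P} (h : C1 Ω w P) (hs : Ω' ⊆ Ω) : C1 Ω' w P :=
  ⟨fun x hx => h.d1 x (hs hx), h.c.mono hs⟩
theorem C1.mul {w P w' P'} (h : C1 Ω w P) (h' : C1 Ω w' P') :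
    C1 Ω (fun x => w x * w' x) (fun x => w x • P' x + w' x • P x) := by
  refine ⟨fun x hx => ?_, (h.cw.smul h'.c).add (h'.cw.smul h.c)⟩
  exact hfd ((h.d1 x hx).mul (h'.d1 x hx)) fun y => by simp [gr_apply, inner_add_left, isl]
theorem C1.comp {w P} (h : C1 Ω w P) {f : ℝ → ℝ} (hf : ∀ x ∈ Ω, HasDerivAt f (f' (w x)) (w x))
    (hc : ContinuousOn (fun x => f' (w x)) Ω) : C1 Ω (fun x => f (w x)) (fun x => f' (w x) • P x) := by
  refine ⟨fun x hx => ?_, hc.smul h.c⟩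
  exact hfd ((hf x hx).comp_hasFDerivAt x (h.d1 x hx)) fun y => by simp [gr_apply, isl]
theorem C2.comp {w P G} (h : C2 Ω w P G) {f f'' : ℝ → ℝ}
    (hf : ∀ x ∈ Ω, HasDerivAt f (f' (w x)) (w x)) (hf' : ∀ x ∈ Ω, HasDerivAt f' (f'' (w x)) (w x))
    (hc : ContinuousOn (fun x => f'' (w x)) Ω) :
    C2 Ω (fun x => f (w x)) (fun x => f' (w x) • P x)
      (fun x => f' (w x) • G x + f'' (w x) • ro (P x) (P x)) := by
  have h1 := h.c1
  refine ⟨fun x hx => ?_, fun x hx => ?_, ?_⟩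
  · exact hfd ((hf x hx).comp_hasFDerivAt x (h.d1 x hx)) fun y => by simp [gr_apply, isl]
  · exact hfd (((hf' x hx).comp_hasFDerivAt x (h.d1 x hx)).smul (h.d2 x hx)) fun y => by
      simp [ro_apply, smul_smul, gr_apply]
  · have h2 : ContinuousOn (fun x => ro (P x) (P x)) Ω := by
      exact ro_cont h1.c h1.c
    have h3 : ContinuousOn (fun x => f' (w x)) Ω := fun x hx =>
      ((hf' x hx).continuousAt.comp (h.d1 x hx).continuousAt).continuousWithinAt
    exact (h3.smul h.c).add (hc.smul h2)
theorem C2.add {w P G w' P' G'} (h : C2 Ω w P G) (h' : C2 Ω w' P' G') :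
    C2 Ω (fun x => w x + w' x) (fun x => P x + P' x) (fun x => G x + G' x) :=
  ⟨fun x hx => hfd ((h.d1 x hx).add (h'.d1 x hx)) fun y => by simp [gr_apply, inner_add_left],
   fun x hx => (h.d2 x hx).add (h'.d2 x hx), h.c.add h'.c⟩
theorem C2.smul {w P G} (h : C2 Ω w P G) (k : ℝ) :
    C2 Ω (fun x => k * w x) (fun x => k • P x) (fun x => k • G x) :=
  ⟨fun x hx => hfd ((h.d1 x hx).const_mul k) fun y => by simp [gr_apply, isl],
   fun x hx => (h.d2 x hx).const_smul k, h.c.const_smul k⟩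
theorem C2.sub {w P G w' P' G'} (h : C2 Ω w P G) (h' : C2 Ω w' P' G') :
    C2 Ω (fun x => w x - w' x) (fun x => P x - P' x) (fun x => G x - G' x) :=
  ⟨fun x hx => hfd ((h.d1 x hx).sub (h'.d1 x hx)) fun y => by simp [gr_apply, inner_sub_left],
   fun x hx => (h.d2 x hx).sub (h'.d2 x hx), h.c.sub h'.c⟩
theorem C2.aff {P G} (h : C2 univ w P G) (z : E n) (r : ℝ) :
    C2 univ (fun x => w (z + r • x)) (fun x => r • P (z + r • x)) (fun x => r ^ 2 • G (z + r • x)) := by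
  have hd : ∀ x : E n, HasFDerivAt (fun x : E n => z + r • x) (r • (1 : L n)) x := fun x =>
    ((hasFDerivAt_id x).const_smul r).const_add z
  refine ⟨fun x _ => ?_, fun x _ => ?_, ?_⟩
  · exact hfd ((h.d1 (z + r • x) trivial).comp x (hd x)) fun y => by
      simp [gr_apply, isl]
  · exact hfd (((h.d2 (z + r • x) trivial).comp x (hd x)).const_smul r) fun y => by
      simp [smul_smul, sq]
  · have hc : Continuous fun x : E n => z + r • x := by fun_prop
    have := (continuousOn_univ.1 h.c).comp hc
    exact (this.const_smul (r ^ 2)).continuousOn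
def qd (c : ℝ) (p : E n) (M : L n) (x : E n) : ℝ := c + ⟪p, x⟫ + (1 / 2) * ⟪M x, x⟫
theorem qd_C2 (Ω : Set (E n)) (c : ℝ) (p : E n) (hM : ∀ x y, ⟪M x, y⟫ = ⟪x, M y⟫) :
    C2 Ω (qd c p M) (fun x => p + M x) (fun _ => M) := by
  refine ⟨fun x hx => ?_, fun x hx => M.hasFDerivAt.const_add p, continuousOn_const⟩
  have h1 : HasFDerivAt (fun x : E n => ⟪p, x⟫) (gr p) x := (gr p).hasFDerivAt
  have h2 := (M.hasFDerivAt (x := x)).inner ℝ (hasFDerivAt_id x)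
  refine hfd ((h1.const_add c).add (h2.const_mul (1 / 2))) fun y => ?_
  simp [inner_add_left, fderivInnerCLM_apply, gr_apply]
  rw [hM y x, real_inner_comm (M x) y]; ring
theorem zcont {F : Type*} [TopologicalSpace F] [Zero F] (hΩ : IsOpen Ω) (hK : IsClosed K)
    (hKΩ : K ⊆ Ω) {f : E n → F} (h : ContinuousOn f Ω) (h0 : ∀ x, x ∉ K → f x = 0) : Continuous f := by
  rw [continuous_iff_continuousAt]
  intro x
  by_cases hx : x ∈ Ω
  · exact h.continuousAt (hΩ.mem_nhds hx)
  · have : f =ᶠ[𝓝 x] fun _ => 0 := by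
      filter_upwards [hK.isOpen_compl.mem_nhds (fun h => hx (hKΩ h))] with y hy using h0 y hy
    exact continuousAt_const.congr this.symm
theorem zint (hΩ : IsOpen Ω) (hK : IsCompact K)
    (hKΩ : K ⊆ Ω) (h : ContinuousOn f Ω) (h0 : ∀ x, x ∉ K → f x = 0) : Integrable f :=
  (zcont hΩ hK.isClosed hKΩ h h0).integrable_of_hasCompactSupport (HasCompactSupport.intro hK h0)
structure DF (l m : ℝ) (U : E n → L n) : Prop where
  ell : ∀ x, Ell l m (U x)
  cont : Continuous U
  div : ∀ ψ D, (∀ x, HasFDerivAt ψ (D x) x) → Continuous D → HasCompactSupport ψ →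
    ∫ x, tr (U x * D x) = 0
theorem DF.smul (h : DF l m U) (hk : 0 ≤ k) : DF (k * l) (k * m) (fun x => k • U x) :=
  ⟨fun x => (h.ell x).smul hk, h.cont.const_smul k, fun ψ D h1 h2 h3 => by
    simp_rw [smul_mulL, map_smul, smul_eq_mul]
    rw [integral_const_mul, h.div ψ D h1 h2 h3, mul_zero]⟩
theorem DF.mono (h : DF l m U) (hl : l' ≤ l) (hm : m ≤ m') : DF l' m' U :=
  ⟨fun x => (h.ell x).mono hl hm, h.cont, h.div⟩
theorem field (hK : IsCompact K) (hKΩ : K ⊆ Ω) (hΩ : IsOpen Ω)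
    {G : E n → L n}
    (hφ : C1 Ω φ p) (hQ : ∀ x ∈ Ω, HasFDerivAt Q (G x) x) (hG : ContinuousOn G Ω)
    (h0 : ∀ x ∉ K, φ x • Q x = 0) (h1 : ∀ x ∉ K, φ x • G x + ro (Q x) (p x) = 0)
    (hU : DF l m U) :
    ∫ x, (φ x * tr (U x * G x) + ⟪U x (Q x), p x⟫) = 0 := by
  have hQc : ContinuousOn Q Ω := fun x hx => (hQ x hx).continuousAt.continuousWithinAt
  have := hU.div (fun x => φ x • Q x) (fun x => φ x • G x + ro (Q x) (p x)) ?_ ?_ ?_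
  · rw [← this]; congr 1; ext x
    rw [mul_add, map_add, tr_ro, mul_smulL, map_smul, smul_eq_mul]
  · intro x
    by_cases hx : x ∈ Ω
    · exact hfd ((hφ.d1 x hx).smul (hQ x hx)) fun y => by simp [ro_apply, gr_apply]
    · rw [h1 x fun h => hx (hKΩ h)]
      refine (hasFDerivAt_const (0 : E n) x).congr_of_eventuallyEq ?_
      filter_upwards [hK.isClosed.isOpen_compl.mem_nhds (fun h => hx (hKΩ h))] with y hy using h0 y hy
  · refine zcont hΩ hK.isClosed hKΩ ?_ h1
    have h2 : ContinuousOn (fun x => ro (Q x) (p x)) Ω := by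
      exact ro_cont hQc hφ.c
    exact (hφ.cw.smul hG).add h2
  · exact HasCompactSupport.intro hK h0
theorem tr_cont {V : E n → L n} (hU : ContinuousOn U Ω) (hV : ContinuousOn V Ω) :
    ContinuousOn (fun x => tr (U x * V x)) Ω := tr.continuous.comp_continuousOn (hU.mul hV)
theorem IBP (hK : IsCompact K) (hKΩ : K ⊆ Ω) (hΩ : IsOpen Ω)
    {s P G}
    (hφ : C1 Ω φ p) (h0 : ∀ x ∉ K, φ x = 0) (h1 : ∀ x ∉ K, p x = 0) (hs : C2 Ω s P G)
    (hU : DF l m U) :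
    ∫ x, φ x * tr (U x * G x) = - ∫ x, ⟪U x (p x), P x⟫ := by
  have := field hK hKΩ hΩ hφ hs.d2 hs.c (fun x hx => by simp [h0 x hx])
    (fun x hx => by ext1 y; simp [h0 x hx, h1 x hx, ro_apply]) hU
  have e : ∀ x, ⟪U x (P x), p x⟫ = ⟪U x (p x), P x⟫ := fun x => by
    rw [(hU.ell x).sym, real_inner_comm]
  simp_rw [e] at this
  rw [integral_add] at this
  · linarith
  · exact zint hΩ hK hKΩ (hφ.cw.mul (tr_cont hU.cont.continuousOn hs.c)) fun x hx => by simp [h0 x hx]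
  · exact zint hΩ hK hKΩ ((hU.cont.continuousOn.clm_apply hφ.c).inner hs.c1.c) fun x hx => by simp [h1 x hx]
theorem IBP2 (hK : IsCompact K) (hKΩ : K ⊆ Ω) (hΩ : IsOpen Ω)
    {Φ : E n → L n} {s P G}
    (hφ : C2 Ω φ p Φ) (h0 : ∀ x ∉ K, φ x = 0) (h1 : ∀ x ∉ K, p x = 0) (h2 : ∀ x ∉ K, Φ x = 0) (hs : C2 Ω s P G)
    (hU : DF l m U) :
    ∫ x, φ x * tr (U x * G x) = ∫ x, s x * tr (U x * Φ x) := by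
  rw [IBP hK hKΩ hΩ hφ.c1 h0 h1 hs hU]
  have := field hK hKΩ hΩ hs.c1 hφ.d2 hφ.c (fun x hx => by simp [h1 x hx])
    (fun x hx => by ext1 y; simp [h2 x hx, h1 x hx, ro_apply]) hU
  rw [integral_add] at this
  · linarith
  · exact zint hΩ hK hKΩ (hs.c1.cw.mul (tr_cont hU.cont.continuousOn hφ.c)) fun x hx => by simp [h2 x hx]
  · exact zint hΩ hK hKΩ ((hU.cont.continuousOn.clm_apply hφ.c1.c).inner hs.c1.c) fun x hx => by simp [h1 x hx]
theorem DF_const (hN : Ell l m N) : DF l m (fun _ => N) := by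
  refine ⟨fun _ => hN, continuous_const, fun ψ D h1 h2 h3 => ?_⟩
  have hD : HasCompactSupport D := by
    have : D = fderiv ℝ ψ := funext fun x => (h1 x).fderiv.symm
    rw [this]; exact h3.fderiv ℝ
  have hDi : Integrable D := h2.integrable_of_hasCompactSupport hD
  have hψ : Continuous ψ := continuous_iff_continuousAt.2 fun x => (h1 x).continuousAt
  have key : ∫ x, D x = 0 := by
    ext1 v
    rw [ContinuousLinearMap.integral_apply hDi]
    have := integral_bilinear_hasFDerivAt_right_eq_neg_left_of_integrable (μ := (volume : Measure (E n)))
      (f := fun _ : E n => (1 : ℝ)) (f' := fun _ => 0) (g := ψ) (g' := D) (v := v)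
      (B := ContinuousLinearMap.lsmul ℝ ℝ) (by simp) (by simpa using (hDi.apply_continuousLinearMap v))
      (by simpa using hψ.integrable_of_hasCompactSupport h3) (fun x _ => hasFDerivAt_const _ _) (fun x _ => h1 x)
    simpa using this
  have : ∀ x, tr (N * D x) = (tr.comp (ContinuousLinearMap.compL ℝ (E n) (E n) (E n) N)) (D x) := fun x => rfl
  simp_rw [this]
  rw [ContinuousLinearMap.integral_comp_comm _ hDi, key, map_zero]
def cof (X : L n) : L n := X.det • inv X
structure Sol (lam : ℝ) (v : E n → ℝ) (P : E n → E n) (H : E n → L n) : Prop where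
  c2 : C2 univ v P H
  ell : ∀ x, Ell lam 1 (H x)
theorem det_diff : Differentiable ℝ fun X : L n => X.det := by
  have : (fun X : L n => X.det) = fun X : L n => ∑ σ : Equiv.Perm (Fin n), ((Equiv.Perm.sign σ : ℤ) : ℝ) *
      ∏ i, (X (EuclideanSpace.basisFun (Fin n) ℝ i)) (σ i) := by
    ext X
    rw [ContinuousLinearMap.det, ← LinearMap.det_toMatrix (EuclideanSpace.basisFun (Fin n) ℝ).toBasis,
      Matrix.det_apply']
    simp [LinearMap.toMatrix_apply]
  rw [this]
  refine Differentiable.fun_sum fun σ _ => (Differentiable.const_mul ?_ _)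
  intro Y
  refine (HasFDerivAt.finsetProd (𝕜 := ℝ) (u := Finset.univ) (g := fun i (X : L n) => (X (EuclideanSpace.basisFun (Fin n) ℝ i)) (σ i))
    (g' := fun i => fderiv ℝ (fun (X : L n) => (X (EuclideanSpace.basisFun (Fin n) ℝ i)) (σ i)) Y) (x := Y) fun i _ => DifferentiableAt.hasFDerivAt ?_).differentiableAt
  have h1 : Differentiable ℝ fun X : L n => X (EuclideanSpace.basisFun (Fin n) ℝ i) :=
    (ContinuousLinearMap.apply ℝ (E n) (EuclideanSpace.basisFun (Fin n) ℝ i)).differentiable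
  exact ((EuclideanSpace.proj (𝕜 := ℝ) (σ i)).differentiable.comp h1) Y
theorem det_hasFDerivAt : HasFDerivAt (fun X : L n => X.det) (tr : L n →L[ℝ] ℝ) 1 := by
  have h := (det_diff (n := n) 1).hasFDerivAt
  refine h.congr_fderiv (ContinuousLinearMap.ext fun X => ?_)
  have h1 : HasDerivAt (fun t : ℝ => (1 + t • X : L n).det) (fderiv ℝ (fun X : L n => X.det) 1 X) 0 := by
    have h2 : HasDerivAt (fun t : ℝ => (1 + t • X : L n)) X 0 := by
      simpa using ((hasDerivAt_id (0:ℝ)).smul_const X).const_add (1 : L n)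
    have h3 : HasFDerivAt (fun X : L n => X.det) (fderiv ℝ (fun X : L n => X.det) 1) (1 + (0:ℝ) • X) := by
      have e0 : (1 : L n) + (0:ℝ) • X = 1 := by ext; simp
      rw [e0]; exact h
    exact h3.comp_hasDerivAt (0:ℝ) h2
  set b := (EuclideanSpace.basisFun (Fin n) ℝ).toBasis
  set M := LinearMap.toMatrix b b (X : E n →ₗ[ℝ] E n) with hM
  have h4 : (fun t : ℝ => (1 + t • X : L n).det) = fun t => 1 + Matrix.trace M * t +
      (Matrix.det (1 + (Polynomial.X : Polynomial ℝ) • M.map Polynomial.C)).divX.divX.eval t * t ^ 2 := by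
    ext t
    rw [← Matrix.det_one_add_smul, ContinuousLinearMap.det, ← LinearMap.det_toMatrix b]
    congr 1
    have : ((1 + t • X : L n) : E n →ₗ[ℝ] E n) = LinearMap.id + t • (X : E n →ₗ[ℝ] E n) := by ext; simp
    rw [this, map_add, map_smul, LinearMap.toMatrix_id]
  rw [h4] at h1
  have h5 : HasDerivAt (fun t => 1 + Matrix.trace M * t +
      (Matrix.det (1 + (Polynomial.X : Polynomial ℝ) • M.map Polynomial.C)).divX.divX.eval t * t ^ 2)
      (Matrix.trace M) 0 := by
    have := (((hasDerivAt_id (0:ℝ)).const_mul (Matrix.trace M)).const_add 1).add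
      (((Matrix.det (1 + (Polynomial.X : Polynomial ℝ) • M.map Polynomial.C)).divX.divX.hasDerivAt 0).mul
        (hasDerivAt_pow 2 (0:ℝ)))
    refine HasDerivAt.congr_deriv this ?_
    simp
  rw [h1.unique h5, tr_def, LinearMap.trace_eq_matrix_trace ℝ b]
theorem bij_of_near {f : E n → E n} {f' : E n → L n} (hf : ∀ x, HasFDerivAt f (f' x) x) {c : ℝ}
    (hc0 : 0 ≤ c) (hc : c < 1) (h : ∀ x, ‖f' x - 1‖ ≤ c) : Function.Bijective f := by
  have ha : ApproximatesLinearOn f ((ContinuousLinearEquiv.refl ℝ (E n) : E n ≃L[ℝ] E n) : E n →L[ℝ] E n) univ ⟨c, hc0⟩ := by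
    intro x _ y _
    exact Convex.norm_image_sub_le_of_norm_hasFDerivWithin_le' (fun z _ => (hf z).hasFDerivWithinAt)
      (fun z _ => h z) convex_univ (mem_univ y) (mem_univ x)
  rcases subsingleton_or_nontrivial (E n) with hs | hs
  · exact ⟨fun x y _ => Subsingleton.elim _ _, fun y => ⟨y, Subsingleton.elim _ _⟩⟩
  have hN : Subsingleton (E n) ∨ (⟨c, hc0⟩ : NNReal) <
      ‖((ContinuousLinearEquiv.refl ℝ (E n)).symm : E n →L[ℝ] E n)‖₊⁻¹ := by
    right
    have : ‖((ContinuousLinearEquiv.refl ℝ (E n)).symm : E n →L[ℝ] E n)‖₊ = 1 := by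
      ext; exact ContinuousLinearMap.norm_id
    rw [this, inv_one]; exact hc
  exact ⟨injOn_univ.1 (ha.injOn hN), ha.surjective hN⟩
theorem inv_contAt (h : Ell l m X) (hl : 0 < l) : ContinuousAt (inv (n := n)) X := by
  obtain ⟨u, rfl⟩ := h.isUnit hl
  exact NormedRing.inverse_continuousAt u
theorem inv_cont (hl : 0 < l) (h : ∀ x, Ell l m (H x)) (hc : Continuous H) :
    Continuous fun x => inv (H x) :=
  continuous_iff_continuousAt.2 fun x => (inv_contAt (h x) hl).comp hc.continuousAt
theorem Ell.cof (h : Ell l 1 X) (hl : 0 < l) : Ell (l ^ n) l⁻¹ (cof X) := by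
  have h1 := (h.inv hl).smul (h.det_pos hl).le
  have h2 := h.det_bd hl
  have : 0 < l⁻¹ := inv_pos.2 hl
  refine h1.mono (by simpa using h2.1) ?_
  have h3 := h2.2
  rw [one_pow] at h3
  nlinarith
theorem Sol.cont {v P} (h : Sol lam v P H) : Continuous H := continuousOn_univ.1 h.c2.c
theorem Sol.df {v P} (hl : 0 < lam) (hl1 : lam ≤ 1) (h : Sol lam v P H) :
    DF (lam ^ n) lam⁻¹ (fun x => cof (H x)) := by
  have hdc : Continuous fun x => (H x).det := ContinuousLinearMap.continuous_det.comp h.cont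
  have hic := inv_cont hl h.ell h.cont
  have hcc : Continuous fun x => cof (H x) := hdc.smul hic
  refine ⟨fun x => (h.ell x).cof hl, hcc, fun ψ D hψ hD hsupp => ?_⟩
  set K := tsupport ψ with hKdef
  have hK : IsCompact K := hsupp
  have hψ0 : ∀ x ∉ K, ψ x = 0 := fun x hx => image_eq_zero_of_notMem_tsupport hx
  have hDe : D = fderiv ℝ ψ := funext fun x => (hψ x).fderiv.symm
  have hD0 : ∀ x ∉ K, D x = 0 := fun x hx => by
    rw [hDe]; exact image_eq_zero_of_notMem_tsupport fun h => hx (tsupport_fderiv_subset ℝ h)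
  have hDs : HasCompactSupport D := HasCompactSupport.intro hK hD0
  obtain ⟨B, hB⟩ := hDs.exists_bound_of_continuous hD
  have hB0 : 0 ≤ B := (norm_nonneg _).trans (hB 0)
  have hH1 : ∀ x, ‖H x - 1‖ ≤ 1 - lam := fun x => by
    have hx := h.ell x
    refine norm_le_of_quad (by linarith) (fun y z => ?_) (fun y => ?_)
    · simp [inner_sub_left, inner_sub_right, hx.sym]
    · simp only [sub_apply, one_apply_eq_self, inner_sub_left, rsq]
      have h1 := hx.lo y; have h2 := hx.hi y
      rw [abs_le]; constructor <;> nlinarith [sq_nonneg ‖y‖]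
  have hbij : ∀ t : ℝ, 0 ≤ t → t * B < lam → Function.Bijective (fun x => P x + t • ψ x) := fun t ht htB => by
    refine bij_of_near (f' := fun x => H x + t • D x) (c := 1 - lam + t * B)
      (fun x => (h.c2.d2 x trivial).add ((hψ x).const_smul t)) (by nlinarith) (by linarith) fun x => ?_
    calc ‖H x + t • D x - 1‖ = ‖(H x - 1) + t • D x‖ := by congr 1; abel
      _ ≤ ‖H x - 1‖ + t * ‖D x‖ := by
        refine (norm_add_le _ _).trans ?_
        rw [norm_smul, rnn ht]
      _ ≤ _ := by gcongr; exact hH1 x; exact hB x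
  have hbij0 := hbij 0 le_rfl (by simpa using hl)
  simp only [zero_smul, add_zero] at hbij0
  have himg : ∀ t : ℝ, 0 ≤ t → t * B < lam → (fun x => P x + t • ψ x) '' K = P '' K := fun t ht htB => by
    have e1 : (fun x => P x + t • ψ x) '' Kᶜ = P '' Kᶜ :=
      image_congr fun x hx => by simp [hψ0 x hx]
    rw [image_compl_eq (hbij t ht htB), image_compl_eq hbij0] at e1
    exact compl_injective e1
  have hKm : MeasurableSet K := hK.isClosed.measurableSet
  have hint : ∀ t : ℝ, 0 ≤ t → t * B < lam → ∫ x in K, |(H x + t • D x).det| = ∫ x in K, |(H x).det| :=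
    fun t ht htB => by
      have e1 := integral_image_eq_integral_abs_det_fderiv_smul volume hKm
        (fun x _ => ((h.c2.d2 x trivial).add ((hψ x).const_smul t)).hasFDerivWithinAt)
        (hbij t ht htB).1.injOn (fun _ => (1:ℝ))
      have e2 := integral_image_eq_integral_abs_det_fderiv_smul volume hKm
        (fun x _ => (h.c2.d2 x trivial).hasFDerivWithinAt) hbij0.1.injOn (fun _ => (1:ℝ))
      have e3 := himg t ht htB
      simp only [smul_eq_mul, mul_one] at e1 e2
      rw [← e2, ← e1]
      congr 2
  set I := ∫ x, tr (cof (H x) * D x) with hI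
  have hIK : I = ∫ x in K, tr (cof (H x) * D x) := by
    rw [hI, setIntegral_eq_integral_of_forall_compl_eq_zero]
    intro x hx; simp [hD0 x hx]
  have hvK : volume K < ⊤ := hK.measure_lt_top
  have key : ∀ ε > 0, |I| ≤ ε * (lam⁻¹ * B * volume.real K) := by
    intro ε hε
    have hlo := (det_hasFDerivAt (n := n)).isLittleO.def hε
    have hpos : ∀ᶠ X in 𝓝 (1 : L n), 0 < X.det := by
      refine (ContinuousLinearMap.continuous_det (𝕜 := ℝ) (E := E n)).continuousAt.eventually_const_lt ?_
      simp [ContinuousLinearMap.det]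
    obtain ⟨δ, hδ, hδ'⟩ := Metric.eventually_nhds_iff.1 (hlo.and hpos)
    obtain ⟨t, ht0, ht1, ht2⟩ : ∃ t : ℝ, 0 < t ∧ t * B < lam ∧ t * (lam⁻¹ * B) < δ := by
      refine ⟨min (lam / (B + 1)) (δ / (lam⁻¹ * B + 1)) / 2, pp, ?_, ?_⟩
      · have : min (lam / (B + 1)) (δ / (lam⁻¹ * B + 1)) ≤ lam / (B + 1) := min_le_left _ _
        have h3 : lam / (B + 1) * B ≤ lam := by
          rw [div_mul_eq_mul_div, div_le_iff₀ (by linarith)]; nlinarith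
        nlinarith
      · have : min (lam / (B + 1)) (δ / (lam⁻¹ * B + 1)) ≤ δ / (lam⁻¹ * B + 1) := min_le_right _ _
        have h4 : 0 ≤ lam⁻¹ * B := pp
        have h3 : δ / (lam⁻¹ * B + 1) * (lam⁻¹ * B) ≤ δ := by
          rw [div_mul_eq_mul_div, div_le_iff₀ (by linarith)]; nlinarith
        nlinarith
    have hYn : ∀ x, ‖t • (inv (H x) * D x)‖ ≤ t * (lam⁻¹ * B) := fun x => by
      rw [norm_smul, rnn ht0.le]
      have := ((h.ell x).inv hl).norm_le (by simp) pp
      gcongr; refine (norm_mul_le _ _).trans ?_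
      gcongr; exact hB x
    have hpt : ∀ x, 0 < (H x + t • D x).det ∧
        |(H x + t • D x).det - (H x).det - t * tr (cof (H x) * D x)| ≤ ε * (t * (lam⁻¹ * B)) := fun x => by
      have hf : H x + t • D x = H x * (1 + t • (inv (H x) * D x)) := by
        rw [mul_add, mul_one, mul_smulL, ← mul_assoc, (h.ell x).mul_inv hl, one_mul]
      have hd := @hδ' (1 + t • (inv (H x) * D x)) (by
        rw [dist_eq_norm]; simpa using (hYn x).trans_lt ht2)
      have hdet := (h.ell x).det_pos hl
      have hdet1 := ((h.ell x).det_bd hl).2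
      rw [one_pow] at hdet1
      rw [hf, det_mul]
      refine ⟨mul_pos hdet hd.2, ?_⟩
      have h1 := hd.1
      simp only [add_sub_cancel_left, map_smul, smul_eq_mul] at h1
      have h1' : ContinuousLinearMap.det (1 : L n) = 1 := by simp [ContinuousLinearMap.det]
      rw [h1', Real.norm_eq_abs] at h1
      have e : (H x).det * (1 + t • (inv (H x) * D x)).det - (H x).det - t * tr (cof (H x) * D x)
        = (H x).det * ((1 + t • (inv (H x) * D x)).det - 1 - t * tr (inv (H x) * D x)) := by
        rw [cof, smul_mulL, map_smul, smul_eq_mul]; ring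
      rw [e, abs_mul, abs_of_pos hdet]
      calc _ ≤ 1 * (ε * (t * (lam⁻¹ * B))) := by
            gcongr; exact h1.trans (by gcongr; exact hYn x)
        _ = _ := one_mul _
    have hcont2 : Continuous fun x => (H x + t • D x).det :=
      ContinuousLinearMap.continuous_det.comp (h.cont.add (hD.const_smul t))
    have i1 : IntegrableOn (fun x => (H x + t • D x).det) K := hcont2.continuousOn.integrableOn_compact hK
    have i2 : IntegrableOn (fun x => (H x).det) K := hdc.continuousOn.integrableOn_compact hK
    have i3 : IntegrableOn (fun x => t * tr (cof (H x) * D x)) K :=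
      ((tr_cont hcc.continuousOn hD.continuousOn).integrableOn_compact hK).const_mul t
    have e1 : ∫ x in K, ((H x + t • D x).det - (H x).det - t * tr (cof (H x) * D x)) = - (t * I) := by
      have i12 : IntegrableOn (fun x => (H x + t • D x).det - (H x).det) K := i1.sub i2
      rw [integral_sub i12 i3, integral_sub i1 i2, integral_const_mul, ← hIK]
      have := hint t ht0.le ht1
      have a1 : ∫ x in K, |(H x + t • D x).det| = ∫ x in K, (H x + t • D x).det := by
        congr 1; ext x; exact abs_of_pos (hpt x).1
      have a2 : ∫ x in K, |(H x).det| = ∫ x in K, (H x).det := by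
        congr 1; ext x; exact abs_of_pos ((h.ell x).det_pos hl)
      rw [a1, a2] at this
      rw [this]; ring
    have e2 := norm_setIntegral_le_of_norm_le_const (μ := volume) hvK (C := ε * (t * (lam⁻¹ * B)))
      (f := fun x => (H x + t • D x).det - (H x).det - t * tr (cof (H x) * D x))
      (fun x _ => (hpt x).2)
    rw [e1, norm_neg, norm_mul, rnn ht0.le, Real.norm_eq_abs] at e2
    have : t * |I| ≤ t * (ε * (lam⁻¹ * B * volume.real K)) := by linarith
    exact le_of_mul_le_mul_left this ht0
  have hlim : |I| ≤ 0 := by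
    have h0 : 0 ≤ lam⁻¹ * B * volume.real K := pp
    refine le_of_forall_pos_le_add fun δ hδ => ?_
    have := key (δ / (lam⁻¹ * B * volume.real K + 1)) pp
    refine this.trans ?_
    rw [div_mul_eq_mul_div, div_le_iff₀ (by linarith)]; nlinarith
  exact abs_nonpos_iff.1 hlim
theorem mul_negL (X Y : L n) : X * (-Y) = -(X * Y) := by ext1 y; simp
theorem mul_subL (X Y Z : L n) : X * (Y - Z) = X * Y - X * Z := by ext1 y; simp
theorem sub_mulL (X Y Z : L n) : (Y - Z) * X = Y * X - Z * X := by ext1 y; simp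
theorem det_negL (X : L n) : |(-X).det| = |X.det| := by
  have e : ((-X : L n) : E n →ₗ[ℝ] E n) = (-1:ℝ) • (X : E n →ₗ[ℝ] E n) := by ext y; simp
  simp only [ContinuousLinearMap.det]
  rw [e, LinearMap.det_smul, abs_mul]; simp
theorem Ell.tr_le (h : Ell l m X) : tr X ≤ n * m := by
  obtain ⟨b, c, rfl, h1, h2⟩ := h.exists_dg
  rw [dg_tr]
  calc _ ≤ ∑ _i : Fin n, m := Finset.sum_le_sum fun i _ => h2 i
    _ = _ := by simp
theorem psd_det_le (h : Psd X) : 0 ≤ tr X ∧ |X.det| ≤ tr X ^ n := by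
  obtain ⟨b, c, rfl⟩ := exists_dg h.1
  have hc : ∀ i, 0 ≤ c i := fun i => by rw [dg_val b c i]; exact h.2 _
  rw [dg_tr, dg_det, abs_of_nonneg (Finset.prod_nonneg fun i _ => hc i)]
  refine ⟨Finset.sum_nonneg fun i _ => hc i, ?_⟩
  calc ∏ i, c i ≤ ∏ _i : Fin n, ∑ j, c j := Finset.prod_le_prod (fun i _ => hc i) fun i _ =>
        Finset.single_le_sum (f := c) (fun j _ => hc j) (Finset.mem_univ i)
    _ = _ := by simp
theorem C2.sym (hΩ : IsOpen Ω) {w P G} (h : C2 Ω w P G) {x} (hx : x ∈ Ω) (y z : E n) :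
    ⟪G x y, z⟫ = ⟪y, G x z⟫ := by
  have h1 : ∀ᶠ y in 𝓝 x, HasFDerivAt w (gr (P y)) y := by
    filter_upwards [hΩ.mem_nhds hx] with y hy using h.d1 y hy
  have h2 : HasFDerivAt (fun y => gr (P y)) ((innerSL ℝ : E n →L[ℝ] E n →L[ℝ] ℝ) ∘L G x) x :=
    (innerSL ℝ : E n →L[ℝ] E n →L[ℝ] ℝ).hasFDerivAt.comp x (h.d2 x hx)
  have := second_derivative_symmetric_of_eventually h1 h2 y z
  have h3 : ⟪G x y, z⟫ = ⟪G x z, y⟫ := this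
  rw [h3, real_inner_comm]
theorem C2.mul {w P G w' P' G'} (h : C2 Ω w P G) (h' : C2 Ω w' P' G') :
    C2 Ω (fun x => w x * w' x) (fun x => w x • P' x + w' x • P x)
      (fun x => w x • G' x + w' x • G x + (ro (P' x) (P x) + ro (P x) (P' x))) := by
  refine ⟨(h.c1.mul h'.c1).d1, fun x hx => ?_, ?_⟩
  · exact hfd (((h.d1 x hx).smul (h'.d2 x hx)).add ((h'.d1 x hx).smul (h.d2 x hx))) fun y => by
      simp [ro_apply, gr_apply]; abel
  · exact ((h.c1.cw.smul h'.c).add (h'.c1.cw.smul h.c)).add ((ro_cont h'.c1.c h.c1.c).add (ro_cont h.c1.c h'.c1.c))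
theorem C2.max_psd (hΩ : IsOpen Ω) {w P G} (h : C2 Ω w P G) {x} (hx : x ∈ Ω)
    (hm : IsLocalMax w x) : P x = 0 ∧ ∀ z, ⟪G x z, z⟫ ≤ 0 := by
  have hP : P x = 0 := by
    have := hm.hasFDerivAt_eq_zero (h.d1 x hx)
    have h2 : gr (P x) (P x) = 0 := by rw [this]; rfl
    exact inner_self_eq_zero.1 (gr_apply (P x) (P x) ▸ h2)
  refine ⟨hP, fun z => ?_⟩
  by_contra hcon
  push Not at hcon
  have hl : ∀ t : ℝ, HasDerivAt (fun t : ℝ => x + t • z) z t := fun t => by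
    refine HasDerivAt.congr_deriv (((hasDerivAt_id t).smul_const z).const_add x) (one_smul _ _)
  have e0 : x + (0:ℝ) • z = x := by simp
  have hcont : Tendsto (fun t : ℝ => x + t • z) (𝓝 0) (𝓝 x) := by
    have := (hl 0).continuousAt.tendsto; rwa [e0] at this
  have hev : ∀ᶠ t in 𝓝 (0:ℝ), x + t • z ∈ Ω := hcont (hΩ.mem_nhds hx)
  have hd : ∀ᶠ t in 𝓝 (0:ℝ), HasDerivAt (fun t : ℝ => w (x + t • z)) ⟪P (x + t • z), z⟫ t := by
    filter_upwards [hev] with t ht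
    exact (h.d1 _ ht).comp_hasDerivAt t (hl t)
  have hd' : deriv (fun t : ℝ => w (x + t • z)) =ᶠ[𝓝 0] fun t => ⟪P (x + t • z), z⟫ := by
    filter_upwards [hd] with t ht using ht.deriv
  have hP2 : HasDerivAt (fun t : ℝ => ⟪P (x + t • z), z⟫) ⟪G x z, z⟫ 0 := by
    have h1 : HasDerivAt (fun t : ℝ => P (x + t • z)) (G x z) 0 := by
      have h2 : HasFDerivAt P (G x) (x + (0:ℝ) • z) := by rw [e0]; exact h.d2 x hx
      exact h2.comp_hasDerivAt (0:ℝ) (hl 0)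
    have := h1.inner ℝ (hasDerivAt_const (0:ℝ) z)
    simpa using this
  have hdd : deriv (deriv fun t : ℝ => w (x + t • z)) 0 = ⟪G x z, z⟫ := by
    rw [hd'.deriv_eq]; exact hP2.deriv
  have hmin : IsLocalMin (fun t : ℝ => w (x + t • z)) 0 := by
    refine isLocalMin_of_deriv_deriv_pos (by rw [hdd]; exact hcon) ?_ ?_
    · rw [hd'.eq_of_nhds, e0, hP, inner_zero_left]
    · exact hd.self_of_nhds.continuousAt
  have hmax : ∀ᶠ t in 𝓝 (0:ℝ), w (x + t • z) ≤ w x := hcont hm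
  have hconst : (fun t : ℝ => w (x + t • z)) =ᶠ[𝓝 0] fun _ => w x := by
    filter_upwards [hmin, hmax] with t h1 h2
    have h3 : w (x + (0:ℝ) • z) ≤ w (x + t • z) := h1
    rw [e0] at h3; exact le_antisymm h2 h3
  have h0 : deriv (fun t : ℝ => w (x + t • z)) =ᶠ[𝓝 0] fun _ => 0 := by
    have := hconst.deriv
    filter_upwards [this] with t ht; rw [ht, deriv_const]
  rw [h0.deriv_eq, deriv_const] at hdd
  linarith
def tq (x : E n) : ℝ := 1 - ‖x‖ ^ 2
theorem tq_C2 (Ω : Set (E n)) : C2 Ω tq (fun x => (-2:ℝ) • x) (fun _ => (-2:ℝ) • (1 : L n)) := by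
  have h := qd_C2 Ω 1 (0 : E n) (M := (-2:ℝ) • (1 : L n)) (fun x y => by simp [isl, inner_smul_right])
  have e : (qd 1 0 ((-2:ℝ) • (1 : L n)) : E n → ℝ) = tq := by
    ext x; simp [qd, tq, isl]; ring
  have e2 : (fun x : E n => (0 : E n) + ((-2:ℝ) • (1 : L n)) x) = fun x => (-2:ℝ) • x := by ext x; simp
  rw [e, e2] at h; exact h
theorem tqN_C2 (Ω : Set (E n)) (N : ℕ) : C2 Ω (fun x => tq x ^ (N+2)) (fun x => (((N+2:ℕ):ℝ) * tq x ^ (N+1)) • (-2:ℝ) • x)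
    (fun x => (((N+2:ℕ):ℝ) * tq x ^ (N+1)) • ((-2:ℝ) • (1 : L n)) +
      (((N+2:ℕ):ℝ) * (((N+1:ℕ):ℝ) * tq x ^ N)) • ro ((-2:ℝ) • x) ((-2:ℝ) • x)) := by
  refine (tq_C2 Ω).comp (f := fun t => t ^ (N+2)) (f' := fun t => ((N+2:ℕ):ℝ) * t ^ (N+1))
    (f'' := fun t => ((N+2:ℕ):ℝ) * (((N+1:ℕ):ℝ) * t ^ N)) ?_ ?_ ?_
  · intro x _; exact hasDerivAt_pow (N+2) _
  · intro x _; exact (hasDerivAt_pow (N+1) _).const_mul _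
  · have := (tq_C2 (n := n) Ω).c1.cw; fun_prop
theorem inner_le_mn {U : L n} (hU : ‖U‖ ≤ m) (x y : E n) : |⟪U x, y⟫| ≤ m * (‖x‖ * ‖y‖) := by
  calc _ ≤ ‖U x‖ * ‖y‖ := abs_real_inner_le_norm _ _
    _ ≤ (m * ‖x‖) * ‖y‖ := by gcongr; exact U.le_of_opNorm_le hU x
    _ = _ := by ring
theorem abp_pt (hl : 0 < l) (hm : 0 ≤ m) {N : ℕ} {P : E n} {G U : L n} (hU : Ell l m U)
    (hG : 0 ≤ tr (U * G)) (hx : 0 < tq x) (hs : 0 < s)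
    (hP : tq x * ‖tq x ^ (N+2) • P + s • (((N+2:ℕ):ℝ) * tq x ^ (N+1)) • (-2:ℝ) • x‖ ≤ 2 * (tq x ^ (N+2) * s))
    (hps : Psd (-(tq x ^ (N+2) • G + s • ((((N+2:ℕ):ℝ) * tq x ^ (N+1)) • ((-2:ℝ) • (1 : L n)) +
      (((N+2:ℕ):ℝ) * (((N+1:ℕ):ℝ) * tq x ^ N)) • ro ((-2:ℝ) • x) ((-2:ℝ) • x)) +
      (ro P ((((N+2:ℕ):ℝ) * tq x ^ (N+1)) • (-2:ℝ) • x) + ro ((((N+2:ℕ):ℝ) * tq x ^ (N+1)) • (-2:ℝ) • x) P)))) :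
    |(tq x ^ (N+2) • G + s • ((((N+2:ℕ):ℝ) * tq x ^ (N+1)) • ((-2:ℝ) • (1 : L n)) +
      (((N+2:ℕ):ℝ) * (((N+1:ℕ):ℝ) * tq x ^ N)) • ro ((-2:ℝ) • x) ((-2:ℝ) • x)) +
      (ro P ((((N+2:ℕ):ℝ) * tq x ^ (N+1)) • (-2:ℝ) • x) + ro ((((N+2:ℕ):ℝ) * tq x ^ (N+1)) • (-2:ℝ) • x) P)).det|
      ≤ (((2 * m * n * (N+2) + 8 * m * (N+2) * (N+3)) / l) * (s * tq x ^ N)) ^ n := by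
  set t := tq x with ht
  set Z := t ^ (N+2) • G + s • ((((N+2:ℕ):ℝ) * t ^ (N+1)) • ((-2:ℝ) • (1 : L n)) +
      (((N+2:ℕ):ℝ) * (((N+1:ℕ):ℝ) * t ^ N)) • ro ((-2:ℝ) • x) ((-2:ℝ) • x)) +
      (ro P ((((N+2:ℕ):ℝ) * t ^ (N+1)) • (-2:ℝ) • x) + ro ((((N+2:ℕ):ℝ) * t ^ (N+1)) • (-2:ℝ) • x) P) with hZ
  have h1 := psd_det_le hps
  have h2 := tr_mul_psd hU hps
  rw [← det_negL]
  refine h1.2.trans (pow_le_pow_left₀ h1.1 ?_ n)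
  have hx1 : ‖x‖ ≤ 1 := by
    have : ‖x‖ ^ 2 ≤ 1 := by rw [tq] at ht; linarith
    exact (sq_le_one_iff₀ (norm_nonneg x)).1 this
  have htle : t ≤ 1 := by rw [ht, tq]; linarith [sq_nonneg ‖x‖]
  have e : tr (U * -Z) = - (t ^ (N+2) * tr (U * G) + s * ((((N+2:ℕ):ℝ) * t ^ (N+1)) * (-2 * tr U) +
      (((N+2:ℕ):ℝ) * (((N+1:ℕ):ℝ) * t ^ N)) * (4 * ⟪U x, x⟫)) +
      2 * ((((N+2:ℕ):ℝ) * t ^ (N+1)) * (-2 * ⟪U P, x⟫))) := by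
    rw [mul_negL, map_neg, hZ]
    simp only [mul_add, map_add, mul_smulL, map_smul, smul_eq_mul, tr_ro, inner_smul_right, isl, mul_one]
    have : ⟪U x, P⟫ = ⟪U P, x⟫ := by rw [hU.sym, real_inner_comm]
    rw [this]; simp; ring
  rw [e] at h2
  have hUn := hU.norm_le hl.le hm
  have h4 : |⟪U P, x⟫| ≤ m * ‖P‖ := (inner_le_mn hUn P x).trans (by
    gcongr; exact mul_le_of_le_one_right (norm_nonneg _) hx1)
  have h5 : t * ‖P‖ ≤ (2 + 2 * (N+2)) * s := by
    have hp : 0 < t ^ (N+2) := pp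
    have a1 : ‖t ^ (N+2) • P‖ ≤ ‖t ^ (N+2) • P + s • (((N+2:ℕ):ℝ) * t ^ (N+1)) • (-2:ℝ) • x‖ + ‖s • (((N+2:ℕ):ℝ) * t ^ (N+1)) • (-2:ℝ) • x‖ := by
      have := norm_sub_le (t ^ (N+2) • P + s • (((N+2:ℕ):ℝ) * t ^ (N+1)) • (-2:ℝ) • x) (s • (((N+2:ℕ):ℝ) * t ^ (N+1)) • (-2:ℝ) • x)
      rwa [add_sub_cancel_right] at this
    have a2 : ‖s • (((N+2:ℕ):ℝ) * t ^ (N+1)) • (-2:ℝ) • x‖ ≤ s * (((N+2) * t ^ (N+1)) * 2) := by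
      simp only [norm_smul, norm_mul, norm_pow, Real.norm_eq_abs, abs_of_pos hs, abs_of_pos hx]
      simp only [Nat.abs_cast, abs_neg, abs_two]
      push_cast
      calc _ ≤ s * ((N+2) * t ^ (N+1) * (2 * 1)) := by gcongr
        _ = _ := by ring
    rw [norm_smul, rnn hp.le] at a1
    have a3 := mll (a1.trans (add_le_add le_rfl a2)) hx.le
    have a4 : t ^ (N+2) * (t * ‖P‖) ≤ t ^ (N+2) * ((2 + 2 * (N+2)) * s) := by
      calc _ = t * (t ^ (N+2) * ‖P‖) := by ring
        _ ≤ _ := a3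
        _ ≤ 2 * (t ^ (N+2) * s) + t * (s * (((N+2) * t ^ (N+1)) * 2)) := by rw [mul_add]; gcongr
        _ = _ := by ring
    exact le_of_mul_le_mul_left a4 hp
  have h6 := hU.tr_le
  have h7 : 0 ≤ ⟪U x, x⟫ := le_trans pp (hU.lo x)
  have hN : (0:ℝ) ≤ N := Nat.cast_nonneg N
  have h8 : 0 ≤ t ^ (N+2) * tr (U * G) := pp
  have h9 : 0 ≤ s * (((N+2:ℕ):ℝ) * (((N+1:ℕ):ℝ) * t ^ N) * (4 * ⟪U x, x⟫)) := pp
  have h10 : s * ((((N+2:ℕ):ℝ) * t ^ (N+1)) * (2 * tr U)) ≤ 2 * m * n * (N+2) * (s * t ^ N) := by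
    calc _ ≤ s * ((((N+2:ℕ):ℝ) * t ^ (N+1)) * (2 * (n * m))) := by gcongr
      _ ≤ s * ((((N+2:ℕ):ℝ) * t ^ N) * (2 * (n * m))) := by
        gcongr ?_ * (?_ * ?_ * ?_)
        exact pow_le_pow_of_le_one hx.le htle (Nat.le_succ N)
      _ = _ := by push_cast; ring
  have h11 : 2 * ((((N+2:ℕ):ℝ) * t ^ (N+1)) * (2 * ⟪U P, x⟫)) ≤ 8 * m * (N+2) * (N+3) * (s * t ^ N) := by
    calc _ ≤ 2 * ((((N+2:ℕ):ℝ) * t ^ (N+1)) * (2 * (m * ‖P‖))) := by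
          gcongr; exact (le_abs_self _).trans h4
      _ = 4 * m * (N+2) * t ^ N * (t * ‖P‖) := by push_cast; ring
      _ ≤ 4 * m * (N+2) * t ^ N * ((2 + 2 * (N+2)) * s) := by gcongr
      _ = _ := by ring
  rw [div_mul_eq_mul_div, le_div_iff₀ hl]
  linarith
theorem LMP (hn : 1 ≤ n) (hl : 0 < l) (hm : 0 ≤ m) : ∃ C : ℝ, 0 < C ∧ ∀ (Ω : Set (E n)) (_ : IsOpen Ω)
    (_ : closedBall 0 1 ⊆ Ω) (s : E n → ℝ) (P : E n → E n) (G : E n → L n) (_ : C2 Ω s P G) (U : E n → L n)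
    (_ : ∀ x ∈ Bz 1, Ell l m (U x)) (_ : ∀ x ∈ Bz 1, 0 ≤ tr (U x * G x)),
    ∀ x ∈ Bz (1/2), s x ≤ C * ∫ y in Bz 1, max (s y) 0 := by
  obtain ⟨N, hN⟩ : ∃ N, 2 * n = N + 2 := ⟨2 * n - 2, by omega⟩
  set K : ℝ := ((2 * m * n * (N+2) + 8 * m * (N+2) * (N+3)) / l) with hK
  have hK0 : 0 ≤ K := pp
  set ω : ℝ := (volume (ball (0 : E n) 1)).toReal with hω
  have hωp : 0 < ω := ENNReal.toReal_pos (measure_ball_pos _ _ one_pos).ne' measure_ball_lt_top.ne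
  refine ⟨(4/3) ^ (N+2) * (4 ^ n * (K ^ n + 1) / ω), pp, ?_⟩
  intro Ω hΩ hB s P G h U hU hG
  set I := ∫ y in Bz 1, max (s y) 0 with hI
  have hsc : ContinuousOn (fun y => max (s y) 0) (closedBall 0 1) :=
    (h.c1.cw.mono hB).sup continuousOn_const
  have hIi : IntegrableOn (fun y => max (s y) 0) (Bz 1) :=
    hsc.integrableOn_compact (icb _ _)
  have hI0 : 0 ≤ I := integral_nonneg fun y => le_max_right _ _
  set V : E n → ℝ := fun x => tq x ^ (N+2) * s x with hV
  have hVC := (tqN_C2 Ω N).mul h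
  set PV : E n → E n := fun x => tq x ^ (N+2) • P x + s x • (((N+2:ℕ):ℝ) * tq x ^ (N+1)) • (-2:ℝ) • x with hPV
  set GV : E n → L n := fun x => tq x ^ (N+2) • G x + s x • ((((N+2:ℕ):ℝ) * tq x ^ (N+1)) • ((-2:ℝ) • (1 : L n)) +
      (((N+2:ℕ):ℝ) * (((N+1:ℕ):ℝ) * tq x ^ N)) • ro ((-2:ℝ) • x) ((-2:ℝ) • x)) +
      (ro (P x) ((((N+2:ℕ):ℝ) * tq x ^ (N+1)) • (-2:ℝ) • x) + ro ((((N+2:ℕ):ℝ) * tq x ^ (N+1)) • (-2:ℝ) • x) (P x)) with hGV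
  change C2 Ω V PV GV at hVC
  have hVc : ContinuousOn V (closedBall 0 1) := hVC.c1.cw.mono hB
  obtain ⟨x0, hx0, hmax⟩ := (icb (0 : E n) 1).exists_isMaxOn ⟨0, by simp⟩ hVc
  set m0 := V x0 with hm0
  have tq_nn : ∀ x ∈ Bz 1, 0 ≤ tq x := fun x hx => by
    rw [mcz] at hx; rw [tq]; nlinarith only [hx, norm_nonneg x]
  suffices hm0I : m0 ≤ 4 ^ n * (K ^ n + 1) / ω * I by
    intro x hx
    by_cases hs : s x ≤ 0
    · exact hs.trans pp
    push Not at hs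
    have hx1 : x ∈ Bz 1 := cbs nm hx
    have h1 : V x ≤ m0 := hmax hx1
    have h2 : (3/4 : ℝ) ≤ tq x := by
      rw [mcz] at hx; rw [tq]; nlinarith only [hx, norm_nonneg x]
    have h3 : (3/4 : ℝ) ^ (N+2) * s x ≤ V x := by
      rw [hV]; dsimp only; gcongr
    have h4 : s x = (4/3 : ℝ) ^ (N+2) * ((3/4 : ℝ) ^ (N+2) * s x) := by
      rw [← mul_assoc, ← mul_pow]; norm_num
    rw [h4, mul_assoc]
    exact mll ((h3.trans h1).trans hm0I) pp
  by_cases hm0p : m0 ≤ 0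
  · exact hm0p.trans pp
  push Not at hm0p
  set Γ : Set (E n) := {x ∈ Bz 1 | m0 / 2 ≤ V x} ∩
    ({x ∈ Bz 1 | tq x * ‖PV x‖ - 2 * V x ≤ 0} ∩ ⋂ z : E n, {x ∈ Bz 1 | ⟪GV x z, z⟫ ≤ 0}) with hΓ
  have hPc : ContinuousOn PV (closedBall 0 1) := hVC.c1.c.mono hB
  have hGc : ContinuousOn GV (closedBall 0 1) := hVC.c.mono hB
  have htc : ContinuousOn (tq : E n → ℝ) (closedBall 0 1) := (tq_C2 _).c1.cw
  have hΓc : IsClosed Γ := by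
    refine IsClosed.inter ?_ (IsClosed.inter ?_ (isClosed_iInter fun z => ?_))
    · exact hVc.preimage_isClosed_of_isClosed isClosed_closedBall isClosed_Ici
    · exact ContinuousOn.preimage_isClosed_of_isClosed (f := fun x => tq x * ‖PV x‖ - 2 * V x)
        ((htc.mul hPc.norm).sub (hVc.const_mul 2 |>.congr fun x _ => rfl)) isClosed_closedBall isClosed_Iic
    · refine ContinuousOn.preimage_isClosed_of_isClosed (f := fun x => ⟪GV x z, z⟫) ?_ isClosed_closedBall isClosed_Iic
      exact (hGc.clm_apply continuousOn_const).inner continuousOn_const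
  have hΓB : Γ ⊆ closedBall 0 1 := fun x hx => hx.1.1
  have hcover : ball (0 : E n) (m0 / 4) ⊆ PV '' Γ := by
    intro p hp
    rw [mem_ball_zero_iff] at hp
    have hlin := qd_C2 Ω 0 p (M := (0 : L n)) (fun x y => by simp)
    have hW := hVC.sub hlin
    obtain ⟨x, hx, hxm⟩ := (icb (0 : E n) 1).exists_isMaxOn ⟨0, by simp⟩ (hW.c1.cw.mono hB)
    have hq : ∀ y : E n, qd 0 p (0 : L n) y = ⟪p, y⟫ := fun y => by simp [qd]
    have hc : ∀ y ∈ Bz 1, V y ≤ V x + ⟪p, y - x⟫ := fun y hy => by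
      have := hxm hy
      simp only [mem_ofPred_eq, hq] at this
      rw [inner_sub_right]; linarith
    have hnx : ‖x‖ ≤ 1 := by simpa using hx
    have hpi : ∀ y : E n, ‖y‖ ≤ 1 → |⟪p, y⟫| ≤ ‖p‖ := fun y hy =>
      (abs_real_inner_le_norm p y).trans (mul_le_of_le_one_right (norm_nonneg _) hy)
    have hVx : m0 / 2 ≤ V x := by
      have h1 := hc x0 hx0
      rw [inner_sub_right] at h1
      have h2 := abs_le.1 (hpi x0 (by simpa using hx0))
      have h3 := abs_le.1 (hpi x hnx)
      linarith [h2.1, h2.2, h3.1, h3.2]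
    have hnx1 : ‖x‖ < 1 := by
      rcases hnx.lt_or_eq with h1 | h1
      · exact h1
      · have : V x = 0 := by simp [hV, tq, h1]
        linarith
    have hloc : IsLocalMax (fun x => V x - qd 0 p (0 : L n) x) x := by
      filter_upwards [isOpen_ball.mem_nhds (show x ∈ ball (0 : E n) 1 by simpa using hnx1)] with y hy
      exact hxm (ball_subset_closedBall hy)
    have hP := hW.max_psd hΩ (hB hx) hloc
    have hpe : PV x = p := by
      have := hP.1; simp only [zero_apply, add_zero] at this
      exact sub_eq_zero.1 this
    refine ⟨x, ⟨⟨hx, hVx⟩, ⟨hx, ?_⟩, mem_iInter.2 fun z => ⟨hx, ?_⟩⟩, hpe⟩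
    · rw [hpe]
      by_cases hp0 : ‖p‖ = 0
      · rw [hp0]; linarith
      have hp0' : 0 < ‖p‖ := lt_of_le_of_ne (norm_nonneg _) (Ne.symm hp0)
      obtain ⟨r, hr, hr1⟩ : ∃ r ∈ Icc (0:ℝ) 2, ‖x - (r / ‖p‖) • p‖ = 1 := by
        have hcg : ContinuousOn (fun r : ℝ => ‖x - (r / ‖p‖) • p‖) (Icc 0 2) := by fun_prop
        have := intermediate_value_Icc (nm : (0:ℝ) ≤ 2) hcg
        refine this ⟨by simpa using hnx, ?_⟩
        have h2 := norm_sub_norm_le ((2 / ‖p‖) • p) x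
        rw [norm_smul, norm_div, norm_norm, div_mul_cancel₀ _ hp0, norm_sub_rev] at h2
        simp at h2; simp; linarith
      have hr2 : 1 - ‖x‖ ≤ r := by
        have := norm_sub_le x ((r / ‖p‖) • p)
        rw [norm_smul, norm_div, norm_norm, div_mul_cancel₀ _ hp0, rnn hr.1] at this
        linarith
      have hc2 := hc _ (show x - (r / ‖p‖) • p ∈ Bz 1 by
        rw [mcz]; exact hr1.le)
      have e0 : V (x - (r / ‖p‖) • p) = 0 := by simp [hV, tq, hr1]
      have e : ⟪p, x - (r / ‖p‖) • p - x⟫ = - r * ‖p‖ := by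
        rw [sub_sub_cancel_left, inner_neg_right, inner_smul_right, rsq]
        field_simp
      rw [e0, e] at hc2
      have : tq x ≤ 2 * (1 - ‖x‖) := by rw [tq]; linarith [sq_nonneg (1 - ‖x‖)]
      nlinarith only [this, hr2, hc2, hp0']
    · have := hP.2 z
      simpa using this
  have hmeas : volume (ball (0 : E n) (m0/4)) ≤ ∫⁻ x in Γ, ENNReal.ofReal |(GV x).det| :=
    (measure_mono hcover).trans (addHaar_image_le_lintegral_abs_det_fderiv volume hΓc.measurableSet
      fun x hx => (hVC.d2 x (hB (hΓB hx))).hasFDerivWithinAt)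
  have hpt : ∀ x ∈ Γ, |(GV x).det| ≤ K ^ n * m0 ^ (n-1) * max (s x) 0 := by
    intro x hx
    have hxB := hΓB hx
    have hVx := hx.1.2
    have htp : 0 < tq x := lt_of_le_of_ne (tq_nn x hxB) fun h0 => by
      have : V x = 0 := by simp [hV, ← h0]
      linarith
    have hsp : 0 < s x := by
      by_contra hc
      have : V x ≤ 0 := mul_nonpos_of_nonneg_of_nonpos pp (not_lt.1 hc)
      linarith
    have h1 := abp_pt hl hm (N := N) (hU x hxB) (hG x hxB) htp hsp (P := P x)
      (by have := hx.2.1.2; simp only [hPV, hV] at this; linarith)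
      ⟨fun y z => by
        have := hVC.sym hΩ (hB hxB) y z
        simp only [neg_apply, inner_neg_left, inner_neg_right]; rw [neg_inj]; exact this, fun z => by
        have := (mem_iInter.1 hx.2.2 z).2
        simp only [neg_apply, inner_neg_left]; exact neg_nonneg.2 this⟩
    refine h1.trans ?_
    rw [← hK, mul_pow, mul_assoc (K ^ n), max_eq_left hsp.le]
    refine mll ?_ pp
    have e : (s x * tq x ^ N) ^ n = V x ^ (n-1) * s x := by
      obtain ⟨k, rfl⟩ : ∃ k, n = k + 1 := ⟨n - 1, by omega⟩
      have : N = 2 * k := by omega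
      subst this
      simp only [hV, Nat.add_sub_cancel]
      ring
    rw [e]
    gcongr
    exact hmax hxB
  have hfin : m0 ^ n / 4 ^ n * ω ≤ K ^ n * m0 ^ (n-1) * I := by
    have h1 : volume (ball (0 : E n) (m0/4)) ≤ ENNReal.ofReal (K ^ n * m0 ^ (n-1) * I) := by
      refine hmeas.trans ?_
      calc _ ≤ ∫⁻ x in Γ, ENNReal.ofReal (K ^ n * m0 ^ (n-1) * max (s x) 0) :=
            setLIntegral_mono' hΓc.measurableSet fun x hx => ENNReal.ofReal_le_ofReal (hpt x hx)
        _ ≤ ∫⁻ x in closedBall 0 1, ENNReal.ofReal (K ^ n * m0 ^ (n-1) * max (s x) 0) :=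
            lintegral_mono_set hΓB
        _ = ENNReal.ofReal (K ^ n * m0 ^ (n-1) * I) := by
            rw [hI, ← integral_const_mul, ← ofReal_integral_eq_lintegral_ofReal (hIi.const_mul _)]
            exact Eventually.of_forall fun x => mul_nonneg pp (le_max_right _ _)
    rw [Measure.addHaar_ball_of_pos _ _ pp, finrank_euclideanSpace_fin] at h1
    have h2 := ENNReal.toReal_mono ENNReal.ofReal_ne_top h1
    rw [ENNReal.toReal_mul, ENNReal.toReal_ofReal pp, ENNReal.toReal_ofReal pp, div_pow] at h2
    exact h2
  obtain ⟨k, rfl⟩ : ∃ k, n = k + 1 := ⟨n - 1, by omega⟩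
  simp only [Nat.add_sub_cancel] at hfin
  have hmk : 0 < m0 ^ k := pp
  have h3 : m0 ^ k * m0 ≤ m0 ^ k * (4 ^ (k+1) * K ^ (k+1) / ω * I) := by
    have : m0 ^ k * m0 = 4 ^ (k+1) / ω * (m0 ^ (k+1) / 4 ^ (k+1) * ω) := by field_simp; ring
    rw [this]
    calc _ ≤ 4 ^ (k+1) / ω * (K ^ (k+1) * m0 ^ k * I) := by gcongr
      _ = _ := by ring
  refine (le_of_mul_le_mul_left h3 hmk).trans ?_
  gcongr; linarith
theorem mx_deriv (k : ℕ) (t : ℝ) : HasDerivAt (fun t : ℝ => max t 0 ^ (k+2)) (((k+2:ℕ):ℝ) * max t 0 ^ (k+1)) t := by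
  rcases lt_trichotomy t 0 with h | h | h
  · have : (fun t : ℝ => max t 0 ^ (k+2)) =ᶠ[𝓝 t] fun _ => 0 := by
      filter_upwards [Iio_mem_nhds h] with s hs
      rw [max_eq_right (le_of_lt hs)]; simp
    refine ((hasDerivAt_const t (0:ℝ)).congr_of_eventuallyEq this).congr_deriv ?_
    rw [max_eq_right h.le]; simp
  · subst h
    rw [hasDerivAt_iff_tendsto_slope]
    have e : ∀ s : ℝ, s ≠ 0 → slope (fun t : ℝ => max t 0 ^ (k+2)) 0 s = max s 0 ^ (k+1) := by
      intro s hs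
      rw [slope_def_field]
      rcases lt_or_ge s 0 with h | h
      · simp [max_eq_right h.le]
      · simp [max_eq_left h]; field_simp; ring
    have hc : Continuous fun s : ℝ => max s 0 ^ (k+1) := by fun_prop
    have h2 : Tendsto (fun s : ℝ => max s 0 ^ (k+1)) (𝓝[≠] 0) (𝓝 (((k+2:ℕ):ℝ) * max 0 0 ^ (k+1))) := by
      have := (hc.tendsto 0).mono_left (nhdsWithin_le_nhds (s := {0}ᶜ))
      simpa using this
    refine h2.congr' ?_
    filter_upwards [self_mem_nhdsWithin] with s hs using (e s hs).symm
  · have : (fun t : ℝ => max t 0 ^ (k+2)) =ᶠ[𝓝 t] fun t => t ^ (k+2) := by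
      filter_upwards [Ioi_mem_nhds h] with s hs
      rw [max_eq_left (le_of_lt hs)]
    refine ((hasDerivAt_pow (k+2) t).congr_of_eventuallyEq this).congr_deriv ?_
    rw [max_eq_left h.le]; rfl
def cm (R : ℝ) (x : E n) : ℝ := max (R ^ 2 - ‖x‖ ^ 2) 0
def ct (R : ℝ) (x : E n) : ℝ := cm R x ^ 3
def ctP (R : ℝ) (x : E n) : E n := (3 * cm R x ^ 2) • (-2:ℝ) • x
def ctG (R : ℝ) (x : E n) : L n :=
  (3 * cm R x ^ 2) • ((-2:ℝ) • (1 : L n)) + (3 * (2 * cm R x)) • ro ((-2:ℝ) • x) ((-2:ℝ) • x)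
theorem ct_C2 (R : ℝ) (Ω : Set (E n)) : C2 Ω (ct R) (ctP R) (ctG R) := by
  have h := qd_C2 Ω (R ^ 2) (0 : E n) (M := (-2:ℝ) • (1 : L n)) (fun x y => by simp [isl, inner_smul_right])
  have e : (qd (R ^ 2) 0 ((-2:ℝ) • (1 : L n)) : E n → ℝ) = fun x => R ^ 2 - ‖x‖ ^ 2 := by
    ext x; simp [qd, isl]; ring
  have e2 : (fun x : E n => (0 : E n) + ((-2:ℝ) • (1 : L n)) x) = fun x => (-2:ℝ) • x := by ext x; simp
  rw [e, e2] at h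
  have := h.comp (f := fun t => max t 0 ^ 3) (f' := fun t => 3 * max t 0 ^ 2) (f'' := fun t => 3 * (2 * max t 0))
    (fun x _ => by have := mx_deriv 1 (R ^ 2 - ‖x‖ ^ 2); simpa using this)
    (fun x _ => by have := (mx_deriv 0 (R ^ 2 - ‖x‖ ^ 2)).const_mul 3; simpa using this)
    (by have := h.c1.cw; fun_prop)
  exact this
theorem cm_nn (R : ℝ) (x : E n) : 0 ≤ cm R x := le_max_right _ _
theorem ct_nn (R : ℝ) (x : E n) : 0 ≤ ct R x := pow_nonneg (cm_nn R x) 3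
theorem cm_zero (hR : 0 ≤ R) (hx : x ∉ Bz R) : cm R x = 0 := by
  rw [mcz, not_le] at hx
  exact max_eq_right (by nlinarith [norm_nonneg x])
theorem ct_zero (hR : 0 ≤ R) (hx : x ∉ Bz R) :
    ct R x = 0 ∧ ctP R x = 0 ∧ ctG R x = 0 := by
  refine ⟨by simp [ct, cm_zero hR hx], by simp [ctP, cm_zero hR hx], ?_⟩
  ext y; simp [ctG, cm_zero hR hx]
theorem ct_lo (hr : 0 ≤ r) (hR : r ≤ R) (hx : x ∈ Bz r) :
    (R ^ 2 - r ^ 2) ^ 3 ≤ ct R x := by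
  rw [mcz] at hx
  refine pow_le_pow_left₀ (by nlinarith) (le_trans ?_ (le_max_left _ _)) 3
  nlinarith [norm_nonneg x]
theorem ro_norm (p q : E n) : ‖ro p q‖ ≤ ‖p‖ * ‖q‖ := by
  rw [ro, ContinuousLinearMap.norm_smulRight_apply, innerSL_apply_norm, mul_comm]
theorem ct_bd (hR : 0 ≤ R) (hR2 : R ≤ 2) (x : E n) : ct R x ≤ 64 ∧ ‖ctP R x‖ ≤ 192 ∧ ‖ctG R x‖ ≤ 480 := by
  by_cases hx : x ∈ Bz R
  · rw [mcz] at hx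
    have h2 : ‖x‖ ≤ 2 := hx.trans hR2
    have hc : cm R x ≤ 4 := max_le (by nlinarith [sq_nonneg ‖x‖]) nm
    have h0 := cm_nn R x
    refine ⟨(pow_le_pow_left₀ h0 hc 3).trans nm, ?_, ?_⟩
    · rw [ctP, norm_smul, norm_smul, rnn pp]
      calc 3 * cm R x ^ 2 * (‖(-2:ℝ)‖ * ‖x‖) ≤ 3 * 4 ^ 2 * (2 * 2) := by gcongr; simp
        _ = _ := nm
    · rw [ctG]
      refine (norm_add_le _ _).trans ?_
      rw [norm_smul, norm_smul, norm_smul, rnn pp, rnn (show 0 ≤ 3 * (2 * cm R x) from pp)]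
      have h1 : ‖(1 : L n)‖ ≤ 1 := ContinuousLinearMap.norm_id_le
      have h3 : ‖ro ((-2:ℝ) • x) ((-2:ℝ) • x)‖ ≤ 4 * 4 := by
        refine (ro_norm _ _).trans ?_
        rw [norm_smul]; gcongr <;> · simp; linarith
      calc _ ≤ (3:ℝ) * 4 ^ 2 * (2 * 1) + 3 * (2 * 4) * (4 * 4) := by gcongr; simp
        _ = _ := nm
  · obtain ⟨h1, h2, h3⟩ := ct_zero hR hx
    rw [h1, h2, h3]; norm_num
theorem lint_aff {h : E n → ENNReal} (hh : Measurable h) (ha : 1/2 ≤ a) (b : E n) :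
    ∫⁻ x, h (a • x + b) ≤ 2 ^ n * ∫⁻ x, h x := by
  have ha0 : 0 < a := by linarith
  have h1 : ∫⁻ x, h (a • x + b) = ∫⁻ z, h (z + b) ∂(Measure.map (a • ·) volume) := by
    rw [lintegral_map (by fun_prop) (by fun_prop)]
  rw [h1, Measure.map_addHaar_smul _ ha0.ne', lintegral_smul_measure, lintegral_add_right_eq_self, finrank_euclideanSpace_fin,
    smul_eq_mul]
  gcongr
  rw [abs_of_pos pp, ← inv_pow]
  calc ENNReal.ofReal (a⁻¹ ^ n) ≤ ENNReal.ofReal (2 ^ n) := by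
        apply ENNReal.ofReal_le_ofReal; gcongr
        rw [inv_le_comm₀ ha0 nm]; linarith
    _ = 2 ^ n := by rw [ENNReal.ofReal_pow nm]; norm_num
theorem poinc (hB : closedBall 0 1 ⊆ Ω) {s : E n → ℝ} {P} (hs : C1 Ω s P)
    {Z : Set (E n)} (hZ : Z ⊆ closedBall 0 1) (hsZ : ∀ y ∈ Z, s y ≤ 0) :
    volume Z * ∫⁻ x in Bz 1, ENNReal.ofReal (s x) ≤
      2 * (2 * 2 ^ n) * volume (Bz 1) * ∫⁻ x in Bz 1, ‖P x‖ₑ := by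
  classical
  set B := Bz 1 with hBd
  have hconv : Convex ℝ B := convex_closedBall _ _
  set h : E n → ENNReal := fun x => ‖B.piecewise P 0 x‖ₑ with hh
  have hPm : Measurable (B.piecewise P 0) :=
    ContinuousOn.measurable_piecewise (hs.c.mono hB) continuousOn_const mcb
  have hhm : Measurable h := hPm.enorm
  have hhi : ∫⁻ x, h x = ∫⁻ x in B, ‖P x‖ₑ := by
    rw [← lintegral_indicator mcb]
    congr 1; ext x
    by_cases hx : x ∈ B
    · rw [indicator_of_mem hx]; simp [h, hx]
    · rw [indicator_of_notMem hx]; simp [h, hx]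
  set T : E n → E n → ENNReal := fun x y => ∫⁻ t in Icc (0:ℝ) (1/2), 2 * h ((1 - t) • x + t • y) with hT
  have hTm : Measurable (fun q : E n × E n => T q.1 q.2) := by
    have : Measurable fun q : (E n × E n) × ℝ => 2 * h ((1 - q.2) • q.1.1 + q.2 • q.1.2) := by
      refine Measurable.const_mul (hhm.comp ?_) 2
      fun_prop
    exact this.lintegral_prod_right'
  have key : ∀ x ∈ B, ∀ y ∈ B, ENNReal.ofReal |s x - s ((1/2:ℝ) • x + (1/2:ℝ) • y)| ≤ T x y := by
    intro x hx y hy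
    have hin : ∀ t ∈ Icc (0:ℝ) (1/2), (1 - t) • x + t • y ∈ B := fun t ht =>
      hconv hx hy (by linarith [ht.2]) ht.1 (by ring)
    have hl : ∀ t : ℝ, HasDerivAt (fun t : ℝ => (1 - t) • x + t • y) (y - x) t := fun t => by
      have := (((hasDerivAt_id t).const_sub 1).smul_const x).add ((hasDerivAt_id t).smul_const y)
      refine HasDerivAt.congr_deriv this ?_
      simp; abel
    have hd : ∀ t ∈ uIcc (0:ℝ) (1/2), HasDerivAt (fun t : ℝ => s ((1 - t) • x + t • y)) ⟪P ((1 - t) • x + t • y), y - x⟫ t := by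
      intro t ht
      rw [uIcc_of_le nm] at ht
      exact (hs.d1 _ (hB (hin t ht))).comp_hasDerivAt t (hl t)
    have hcl : ContinuousOn (fun t : ℝ => (1 - t) • x + t • y) (Icc 0 (1/2)) := by fun_prop
    have hci : ContinuousOn (fun t : ℝ => ⟪P ((1 - t) • x + t • y), y - x⟫) (Icc 0 (1/2)) :=
      ((hs.c.mono hB).comp hcl hin).inner continuousOn_const
    have hi := intervalIntegral.integral_eq_sub_of_hasDerivAt hd
      (ContinuousOn.intervalIntegrable (by rwa [uIcc_of_le nm]))
    have e1 : (1 - (1/2:ℝ)) • x + (1/2:ℝ) • y = (1/2:ℝ) • x + (1/2:ℝ) • y := nm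
    rw [e1, sub_zero, one_smul, zero_smul, add_zero, intervalIntegral.integral_of_le nm, ← integral_Icc_eq_integral_Ioc] at hi
    rw [abs_sub_comm, ← hi, ← Real.norm_eq_abs, ofReal_norm]
    refine (enorm_integral_le_lintegral_enorm _).trans ?_
    refine setLIntegral_mono' measurableSet_Icc fun t ht => ?_
    have e2 : h ((1 - t) • x + t • y) = ‖P ((1 - t) • x + t • y)‖ₑ := by simp [h, hin t ht]
    rw [e2, ← ofReal_norm, ← ofReal_norm]
    have e3 : ∀ r : ℝ, 2 * ENNReal.ofReal r = ENNReal.ofReal (2*r) := fun r => by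
      rw [ENNReal.ofReal_mul nm]; simp
    rw [e3]
    apply ENNReal.ofReal_le_ofReal
    rw [mcz] at hx hy
    calc _ ≤ ‖P ((1 - t) • x + t • y)‖ * ‖y - x‖ := norm_inner_le_norm _ _
      _ ≤ ‖P ((1 - t) • x + t • y)‖ * 2 := by
        gcongr; exact (norm_sub_le _ _).trans (by linarith)
      _ = _ := mul_comm _ _
  have hTint : ∀ y, ∫⁻ x in B, T x y ≤ 2 * 2 ^ n * ∫⁻ x, h x := by
    intro y
    calc ∫⁻ x in B, T x y ≤ ∫⁻ x, T x y := setLIntegral_le_lintegral _ _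
      _ = ∫⁻ t in Icc (0:ℝ) (1/2), ∫⁻ x, 2 * h ((1 - t) • x + t • y) := by
        rw [hT]
        refine lintegral_lintegral_swap ?_
        have : Measurable fun q : E n × ℝ => 2 * h ((1 - q.2) • q.1 + q.2 • y) :=
          Measurable.const_mul (hhm.comp (by fun_prop)) 2
        exact this.aemeasurable
      _ ≤ ∫⁻ t in Icc (0:ℝ) (1/2), 2 * 2 ^ n * ∫⁻ x, h x := by
        refine setLIntegral_mono' measurableSet_Icc fun t ht => ?_
        rw [lintegral_const_mul _ (show Measurable fun x => h ((1-t)•x+t•y) from hhm.comp (by fun_prop)), mul_assoc]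
        gcongr
        exact lint_aff hhm (by linarith [ht.2]) _
      _ ≤ _ := by
        rw [setLIntegral_const]
        refine mul_le_of_le_one_right' ?_
        rw [Real.volume_Icc]; rw [ENNReal.ofReal_le_one]; norm_num
  have hpt : ∀ x ∈ B, ∀ y ∈ Z, ENNReal.ofReal (s x) ≤ T x y + T y x := by
    intro x hx y hy
    refine le_trans ?_ (add_le_add (key x hx y (hZ hy)) (key y (hZ hy) x hx))
    rw [← ENNReal.ofReal_add (abs_nonneg _) (abs_nonneg _), add_comm ((1/2:ℝ) • y)]
    apply ENNReal.ofReal_le_ofReal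
    have h1 := le_abs_self (s x - s ((1/2:ℝ) • x + (1/2:ℝ) • y))
    have h2 := neg_abs_le (s y - s ((1/2:ℝ) • x + (1/2:ℝ) • y))
    linarith [hsZ y hy]
  have hm1 : ∀ x, Measurable fun y => T x y := fun x => Measurable.of_uncurry_left (f := T) hTm
  have hm2 : ∀ x, Measurable fun y => T y x := fun x => Measurable.of_uncurry_right (f := T) hTm
  have hm3 : Measurable fun x => ∫⁻ y in B, T x y := hTm.lintegral_prod_right'
  have hb : ∫⁻ x in B, ∫⁻ y in B, T y x ≤ 2 * 2 ^ n * (∫⁻ x, h x) * volume B := by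
    exact (lintegral_mono fun x => hTint x).trans (setLIntegral_const B _).le
  calc volume Z * ∫⁻ x in B, ENNReal.ofReal (s x) ≤ ∫⁻ x in B, (∫⁻ y in B, (T x y + T y x)) := by
        rw [mul_comm]
        refine (lintegral_mul_const_le _ _).trans ?_
        refine setLIntegral_mono' mcb fun x hx => ?_
        refine (setLIntegral_const Z (ENNReal.ofReal (s x))).ge.trans ?_
        refine le_trans ?_ (lintegral_mono_set hZ)
        exact setLIntegral_mono ((hm1 x).add (hm2 x)) fun y hy => hpt x hx y hy
    _ = (∫⁻ x in B, ∫⁻ y in B, T x y) + ∫⁻ x in B, ∫⁻ y in B, T y x := by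
        rw [← lintegral_add_left hm3]
        refine lintegral_congr fun x => ?_
        rw [lintegral_add_left (hm1 x)]
    _ ≤ 2 * 2 ^ n * (∫⁻ x, h x) * volume B + 2 * 2 ^ n * (∫⁻ x, h x) * volume B := by
        refine add_le_add ?_ hb
        rw [lintegral_lintegral_swap hTm.aemeasurable]; exact hb
    _ = _ := by rw [hhi]; ring
theorem cB_int (h : ContinuousOn f (closedBall c r)) : IntegrableOn f (closedBall c r) :=
  h.integrableOn_compact (icb _ _)
theorem WH (hn : 1 ≤ n) (hl : 0 < l) (hm : 0 ≤ m) (hν : 0 < ν) : ∃ c : ℝ, 0 < c ∧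
    ∀ (Ω : Set (E n)) (_ : IsOpen Ω) (_ : closedBall 0 2 ⊆ Ω) (w : E n → ℝ) (P : E n → E n) (G : E n → L n)
    (_ : C2 Ω w P G) (_ : ∀ x ∈ Ω, 0 < w x) (U : E n → L n) (_ : DF l m U)
    (_ : ∀ x ∈ Bz 2, tr (U x * G x) ≤ 0) (Z : Set (E n)) (_ : Z ⊆ closedBall 0 1)
    (_ : ∀ y ∈ Z, 1 ≤ w y) (_ : ENNReal.ofReal ν ≤ volume Z), c ≤ w 0 := by
  obtain ⟨CL, hCL, hL⟩ := LMP (n := n) hn hl hm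
  set C := 2 * m ^ 2 / l * 192 ^ 2 with hC
  set K := Bz 2 with hK
  set B := Bz 1 with hB
  have hBK : B ⊆ K := cbs nm
  set C1' := (1 + 2 / l * C) * volume.real K with hC1
  set C2' := 2 * (2 * 2 ^ n) * volume.real B * C1' with hC2
  refine ⟨Real.exp (-(CL * (C2' / ν))), Real.exp_pos _, ?_⟩
  intro Ω hΩ hKΩ w P G hw hpos U hU htr Z hZ hZ1 hνZ
  have hne : ∀ x ∈ Ω, w x ≠ 0 := fun x hx => (hpos x hx).ne'
  have hcw := hw.c1.cw
  have hs := hw.comp (f := fun t => -Real.log t) (f' := fun t => -t⁻¹) (f'' := fun t => (t ^ 2)⁻¹)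
    (fun x hx => (Real.hasDerivAt_log (hne x hx)).neg)
    (fun x hx => by
      have := (hasDerivAt_inv (hne x hx)).neg
      refine HasDerivAt.congr_deriv this ?_; simp)
    ((hcw.pow 2).inv₀ fun x hx => pow_ne_zero 2 (hne x hx))
  set s := fun x => -Real.log (w x)
  set Q := fun x => (-(w x)⁻¹) • P x with hQ
  set S := fun x => (-(w x)⁻¹) • G x + (w x ^ 2)⁻¹ • ro (P x) (P x) with hS
  have hη := ct_C2 2 Ω (n := n)
  have hφ := hη.c1.mul hη.c1
  have hz : ∀ x ∉ K, ct 2 x = 0 ∧ ctP 2 x = 0 ∧ ctG 2 x = 0 := fun x hx => ct_zero nm hx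
  have ibp := IBP (icb (0 : E n) 2) hKΩ hΩ hφ (fun x hx => by simp [(hz x hx).1])
    (fun x hx => by simp [(hz x hx).1]) hs hU
  have htS : ∀ x ∈ K, l * ‖Q x‖ ^ 2 ≤ tr (U x * S x) := by
    intro x hx
    have hp := hpos x (hKΩ hx)
    have e : tr (U x * S x) = -(w x)⁻¹ * tr (U x * G x) + (w x ^ 2)⁻¹ * ⟪U x (P x), P x⟫ := by
      simp only [hS]
      rw [mul_add, mul_smulL, mul_smulL, map_add, map_smul, map_smul, tr_ro]; simp
    have e2 : ‖Q x‖ ^ 2 = (w x ^ 2)⁻¹ * ‖P x‖ ^ 2 := by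
      simp only [hQ]; rw [norm_smul, mul_pow, Real.norm_eq_abs, sq_abs]; simp
    rw [e, e2]
    have h1 := mll ((hU.ell x).lo (P x)) (show 0 ≤ (w x ^ 2)⁻¹ from pp)
    have h2 := mul_nonneg_of_nonpos_of_nonpos (neg_nonpos.2 (inv_pos.2 hp).le) (htr x hx)
    linarith
  set j := fun x => ct 2 x * ct 2 x * tr (U x * S x) + ⟪U x (ct 2 x • ctP 2 x + ct 2 x • ctP 2 x), Q x⟫ with hj
  have i1 : Integrable fun x => ct 2 x * ct 2 x * tr (U x * S x) :=
    zint hΩ (icb (0 : E n) 2) hKΩ ((hη.c1.cw.mul hη.c1.cw).mul (tr_cont hU.cont.continuousOn hs.c))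
      (fun x hx => by simp [(hz x hx).1])
  have i2 : Integrable fun x => ⟪U x (ct 2 x • ctP 2 x + ct 2 x • ctP 2 x), Q x⟫ :=
    zint hΩ (icb (0 : E n) 2) hKΩ
      (((hU.cont.continuousOn).clm_apply hφ.c).inner hs.c1.c)
      (fun x hx => by simp [(hz x hx).1])
  have hj0 : ∫ x, j x = 0 := by rw [hj, integral_add i1 i2, ibp]; simp
  have hji : Integrable j := i1.add i2
  have hpt : ∀ x, B.indicator (fun x => ‖Q x‖) x ≤ K.indicator (fun _ => 1 + 2 / l * C) x + 2 / l * j x := by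
    intro x
    by_cases hx : x ∈ K
    · rw [indicator_of_mem hx]
      have h1 := inner_le_mn ((hU.ell x).norm_le hl.le hm) (ct 2 x • ctP 2 x + ct 2 x • ctP 2 x) (Q x)
      have h2 : ‖ct 2 x • ctP 2 x + ct 2 x • ctP 2 x‖ ≤ 2 * ct 2 x * 192 := by
        rw [← two_smul ℝ, norm_smul, norm_smul, rnn (ct_nn 2 x)]
        have := (ct_bd (R := 2) nm le_rfl x).2.1
        have := ct_nn 2 x
        simp only [Real.norm_ofNat, mul_assoc]; gcongr
      have h3 := htS x hx
      have h4 := ct_nn 2 x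
      have h5 := neg_abs_le ⟪U x (ct 2 x • ctP 2 x + ct 2 x • ctP 2 x), Q x⟫
      have h6 : m * (‖ct 2 x • ctP 2 x + ct 2 x • ctP 2 x‖ * ‖Q x‖) ≤ m * (2 * ct 2 x * 192 * ‖Q x‖) := by gcongr
      have h7 : ct 2 x * ct 2 x * (l * ‖Q x‖ ^ 2) ≤ ct 2 x * ct 2 x * tr (U x * S x) := by gcongr
      have h8 : l / 2 * (ct 2 x * ‖Q x‖) ^ 2 - C ≤ j x := by
        have h9 : m * (2 * ct 2 x * 192 * ‖Q x‖) ≤ l / 2 * (ct 2 x * ‖Q x‖) ^ 2 + C := by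
          have := sq_nonneg (l * (ct 2 x * ‖Q x‖) - 2 * m * 192)
          have e : l / 2 * (ct 2 x * ‖Q x‖) ^ 2 + C - m * (2 * ct 2 x * 192 * ‖Q x‖) = (l * (ct 2 x * ‖Q x‖) - 2 * m * 192) ^ 2 / (2 * l) := by
            rw [hC]; field_simp; ring
          have : 0 ≤ (l * (ct 2 x * ‖Q x‖) - 2 * m * 192) ^ 2 / (2 * l) := pp
          linarith
        simp only [hj]
        linarith
      have h10 : B.indicator (fun x => ‖Q x‖) x ≤ 1 + (ct 2 x * ‖Q x‖) ^ 2 := by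
        by_cases hx' : x ∈ B
        · rw [indicator_of_mem hx']
          have := ct_lo (R := 2) (r := 1) nm nm hx'
          have h11 : 1 * ‖Q x‖ ≤ ct 2 x * ‖Q x‖ := by gcongr; norm_num at this; linarith
          nlinarith only [h11, sq_nonneg (ct 2 x * ‖Q x‖ - 1)]
        · rw [indicator_of_notMem hx']; positivity
      have h12 := mll h8 (show 0 ≤ 2 / l from pp)
      have e : 2 / l * (l / 2 * (ct 2 x * ‖Q x‖) ^ 2 - C) = (ct 2 x * ‖Q x‖) ^ 2 - 2 / l * C := by field_simp
      linarith
    · rw [indicator_of_notMem hx, indicator_of_notMem (fun h => hx (hBK h))]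
      simp [hj, (hz x hx).1]
  have hQi : IntegrableOn (fun x => ‖Q x‖) B := cB_int ((hs.c1.c.mono (hBK.trans hKΩ)).norm)
  have hint : ∫ x in B, ‖Q x‖ ≤ C1' := by
    rw [← integral_indicator mcb]
    have hKi : Integrable (K.indicator (fun _ : E n => 1 + 2 / l * C)) :=
      (integrable_indicator_iff mcb).2 (cB_int continuousOn_const)
    refine (integral_mono ((integrable_indicator_iff mcb).2 hQi) (hKi.add (hji.const_mul _)) hpt).trans ?_
    simp only [Pi.add_apply]
    rw [integral_add hKi (hji.const_mul _), integral_const_mul, hj0, integral_indicator mcb]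
    simp [hC1, hK, mul_comm]
  have hsc : ContinuousOn s B := hs.c1.cw.mono (hBK.trans hKΩ)
  have hp := poinc (hBK.trans hKΩ) hs.c1 hZ (fun y hy => neg_nonpos.2 (Real.log_nonneg (hZ1 y hy)))
  have hI : ν * ∫ x in B, max (s x) 0 ≤ C2' := by
    have e1 : ∫⁻ x in B, ENNReal.ofReal (s x) = ENNReal.ofReal (∫ x in B, max (s x) 0) := by
      rw [ofReal_integral_eq_lintegral_ofReal (f := fun x => max (s x) 0) (cB_int (hsc.sup continuousOn_const)) (ae_of_all _ fun x => le_max_right _ _)]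
      refine lintegral_congr fun x => ?_
      rcases le_total (s x) 0 with h | h
      · rw [max_eq_right h, ENNReal.ofReal_of_nonpos h]; simp
      · rw [max_eq_left h]
    have e2 : ∫⁻ x in B, ‖Q x‖ₑ = ENNReal.ofReal (∫ x in B, ‖Q x‖) := by
      rw [ofReal_integral_eq_lintegral_ofReal hQi (ae_of_all _ fun x => norm_nonneg _)]
      simp_rw [ofReal_norm]
    have e3 : volume B = ENNReal.ofReal (volume.real B) := by
      rw [ofReal_measureReal (icb _ _).measure_lt_top.ne]
    have e4 : (2 * (2 * 2 ^ n) : ENNReal) = ENNReal.ofReal (2 * (2 * 2 ^ n)) := by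
      rw [ENNReal.ofReal_mul nm, ENNReal.ofReal_mul nm, ENNReal.ofReal_pow nm]; simp
    have hq0 : 0 ≤ ∫ x in B, ‖Q x‖ := integral_nonneg fun x => norm_nonneg _
    change _ * (∫⁻ x in B, ENNReal.ofReal (s x)) ≤ 2 * (2 * 2 ^ n) * volume B * (∫⁻ x in B, ‖Q x‖ₑ) at hp
    have hp2 := (mul_le_mul_left hνZ _).trans hp
    rw [e1, e2, e3, e4, ← ENNReal.ofReal_mul hν.le, ← ENNReal.ofReal_mul pp, ← ENNReal.ofReal_mul pp,
      ENNReal.ofReal_le_ofReal_iff pp] at hp2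
    refine hp2.trans ?_
    rw [hC2]; gcongr
  have hfin := hL Ω hΩ (hBK.trans hKΩ) s Q S hs U (fun x _ => hU.ell x) (fun x hx => le_trans pp (htS x (hBK hx))) 0 (by simp)
  have h1 : -Real.log (w 0) ≤ CL * (C2' / ν) := hfin.trans (by
    gcongr; rw [le_div_iff₀ hν, mul_comm]; exact hI)
  have h0 := hpos 0 (hKΩ (by simp [hK]))
  rw [← Real.le_log_iff_exp_le h0]; linarith
theorem swapK {X Y : Type*} [TopologicalSpace X] [MeasureSpace X] [TopologicalSpace Y] [MeasureSpace Y]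
    [OpensMeasurableSpace (X × Y)] [SFinite (volume : Measure X)] [SFinite (volume : Measure Y)]
    [IsFiniteMeasureOnCompacts ((volume : Measure X).prod (volume : Measure Y))] [T2Space (X × Y)]
    {f : X → Y → ℝ} (hf : Continuous fun q : X × Y => f q.1 q.2) {K : Set X} {K' : Set Y} (hK : IsCompact K) (hK' : IsCompact K') :
    ∫ x in K, ∫ y in K', f x y = ∫ y in K', ∫ x in K, f x y := by
  refine integral_integral_swap ?_
  rw [Measure.prod_restrict]
  exact hf.continuousOn.integrableOn_compact (hK.prod hK')
theorem qd_int (hK : IsCompact K) {a : E n → ℝ} {M : E n → L n} (ha : Continuous a)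
    (hp : Continuous p) (hM : Continuous M) (x : E n) :
    ∫ y in K, qd (a y) (p y) (M y) x = qd (∫ y in K, a y) (∫ y in K, p y) (∫ y in K, M y) x := by
  have ia := ha.continuousOn.integrableOn_compact hK (μ := volume)
  have ip := hp.continuousOn.integrableOn_compact hK (μ := volume)
  have iM := hM.continuousOn.integrableOn_compact hK (μ := volume)
  have e1 : ⟪∫ y in K, p y, x⟫ = ∫ y in K, ⟪p y, x⟫ := by
    have := (innerSL ℝ x).integral_comp_comm ip
    simp only [innerSL_apply_apply] at this
    rw [real_inner_comm, ← this]; simp_rw [real_inner_comm]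
  have e2 : ⟪(∫ y in K, M y) x, x⟫ = ∫ y in K, ⟪M y x, x⟫ := by
    have := ((innerSL ℝ x).comp (ContinuousLinearMap.apply ℝ (E n) x)).integral_comp_comm iM
    simp only [ContinuousLinearMap.comp_apply, innerSL_apply_apply, ContinuousLinearMap.apply_apply] at this
    rw [real_inner_comm, ← this]; simp_rw [real_inner_comm]
  simp only [qd]
  have h1 : Continuous fun y => ⟪p y, x⟫ := by fun_prop
  have h2 : Continuous fun y => (1/2:ℝ) * ⟪M y x, x⟫ := by fun_prop
  rw [integral_add (f := fun y => a y + ⟪p y, x⟫) (((ha.add h1).continuousOn).integrableOn_compact hK) (h2.continuousOn.integrableOn_compact hK),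
    integral_add ia (h1.continuousOn.integrableOn_compact hK), integral_const_mul, e1, e2]
theorem sym_int (hK : IsCompact K) {M : E n → L n} (hM : Continuous M)
    (hs : ∀ y u v, ⟪M y u, v⟫ = ⟪u, M y v⟫) (u v : E n) : ⟪(∫ y in K, M y) u, v⟫ = ⟪u, (∫ y in K, M y) v⟫ := by
  have iM := hM.continuousOn.integrableOn_compact hK (μ := volume)
  have e : ∀ u v, ⟪u, (∫ y in K, M y) v⟫ = ∫ y in K, ⟪u, M y v⟫ := fun u v => by
    have := ((innerSL ℝ u).comp (ContinuousLinearMap.apply ℝ (E n) v)).integral_comp_comm iM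
    simp only [ContinuousLinearMap.comp_apply, innerSL_apply_apply, ContinuousLinearMap.apply_apply] at this
    exact this.symm
  rw [real_inner_comm, e, e]
  exact integral_congr_ae (ae_of_all _ fun y => by simp only [← hs]; rw [real_inner_comm, hs])
theorem tay4 (ht : t ≤ 1) (hd : |d| ≤ 6) :
    |max (t + d) 0 ^ 4 - (max t 0 ^ 4 + 4 * max t 0 ^ 3 * d + 6 * max t 0 ^ 2 * d ^ 2)| ≤ 70 * |d| ^ 3 := by
  have h3 : |d| ^ 4 ≤ 6 * |d| ^ 3 := by
    have := mlr hd (show 0 ≤ |d| ^ 3 from pp); nlinarith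
  have h4 : d ^ 4 = |d| ^ 4 := by rw [show d ^ 4 = (d ^ 2) ^ 2 by ring, ← sq_abs d]; ring
  have hp : 0 ≤ |d| ^ 3 := pp
  rcases le_total t 0 with h | h
  · rw [max_eq_right h]
    have h1 : max (t + d) 0 ≤ |d| := max_le (by linarith [le_abs_self d]) (abs_nonneg _)
    have h2 := pow_le_pow_left₀ (le_max_right (t + d) 0) h1 4
    have h5 : 0 ≤ max (t + d) 0 ^ 4 := pp
    rw [abs_le]; constructor <;> norm_num <;> linarith
  · rw [max_eq_left h]
    rcases le_total 0 (t + d) with h' | h'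
    · rw [max_eq_left h', show (t + d) ^ 4 - (t ^ 4 + 4 * t ^ 3 * d + 6 * t ^ 2 * d ^ 2) = 4 * t * d ^ 3 + d ^ 4 by ring]
      refine (abs_add_le _ _).trans ?_
      rw [h4, abs_pow, abs_abs, abs_mul, abs_mul, abs_of_nonneg h, abs_pow]
      norm_num
      nlinarith [mlr ht hp]
    · rw [max_eq_right h']
      have h1 : t ≤ |d| := by linarith [neg_abs_le d]
      have a1 : t ^ 4 ≤ |d| ^ 4 := pow_le_pow_left₀ h h1 4
      have a2 : |4 * t ^ 3 * d| ≤ 4 * |d| ^ 4 := by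
        rw [abs_mul, abs_mul, abs_pow, abs_of_nonneg h]; norm_num
        have := mlr (pow_le_pow_left₀ h h1 3) (abs_nonneg d); nlinarith
      have a3 : 6 * t ^ 2 * d ^ 2 ≤ 6 * |d| ^ 4 := by
        rw [← sq_abs d]
        have := mlr (pow_le_pow_left₀ h h1 2) (sq_nonneg |d|); nlinarith
      have a4 := abs_le.1 a2
      have a5 : 0 ≤ t ^ 4 := pp
      have a6 : 0 ≤ 6 * t ^ 2 * d ^ 2 := pp
      rw [abs_le]; constructor <;> norm_num <;> linarith
def kq (σ : ℝ) (M : L n) (z : E n) : ℝ := max (σ ^ 2 - ⟪M z, z⟫) 0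
theorem kq_C1 (σ : ℝ) (hM : ∀ x y, ⟪M x, y⟫ = ⟪x, M y⟫) :
    C1 univ (fun z => kq σ M z ^ 5) (fun z => (-(10 * kq σ M z ^ 4)) • M z) := by
  have h := qd_C2 univ (σ ^ 2) (0 : E n) (M := (-2:ℝ) • M) (fun x y => by simp [isl, inner_smul_right, hM])
  have e : (qd (σ ^ 2) 0 ((-2:ℝ) • M) : E n → ℝ) = fun x => σ ^ 2 - ⟪M x, x⟫ := by
    ext x; simp [qd, isl]; ring
  rw [e] at h
  have := h.c1.comp (f := fun t => max t 0 ^ 5) (f' := fun t => 5 * max t 0 ^ 4)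
    (fun x _ => by have := mx_deriv 3 (σ ^ 2 - ⟪M x, x⟫); simpa using this)
    (by have := h.c1.cw; fun_prop)
  have ee : (fun z => (-(10 * kq σ M z ^ 4)) • M z) = fun z => (5 * max (σ ^ 2 - ⟪M z, z⟫) 0 ^ 4) • (0 + ((-2:ℝ) • M) z) := by
    funext z
    rw [zero_add, smul_apply, smul_smul, kq]; ring_nf
  rw [ee]; exact this
theorem kq_cont (σ : ℝ) (M : L n) : Continuous (kq σ M) := by unfold kq; fun_prop
theorem kq_nn (σ : ℝ) (M : L n) (z : E n) : 0 ≤ kq σ M z := le_max_right _ _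
theorem kq_zero (hσ : 16 * σ ^ 2 ≤ l) (hl : 0 < l) (hM : Ell l m M) (hz : z ∉ Bz (1/4)) :
    kq σ M z = 0 := by
  rw [mcz, not_le] at hz
  refine max_eq_right ?_
  have h1 := hM.lo z
  have h2 : (1/4:ℝ) ^ 2 ≤ ‖z‖ ^ 2 := pow_le_pow_left₀ nm hz.le 2
  nlinarith
theorem rep (hσ : 16 * σ ^ 2 ≤ l) (hl : 0 < l) (hM : Ell l m M) {ω P G}
    (hω : C2 univ ω P G) (x : E n) :
    (∫ z in Bz 1, 10 * kq σ M z ^ 4) * ω x = (∫ z in Bz 1, 10 * kq σ M z ^ 4 * ω (x - z))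
      - ∫ t in Icc (0:ℝ) 1, ∫ z in Bz 1, t * (kq σ M z ^ 5 * tr (inv M * G (x - t • z))) := by
  set B := Bz 1 with hB
  have hBc : IsCompact B := icb _ _
  have h14 : Bz (1/4) ⊆ B := cbs nm
  have hP : Continuous P := continuousOn_univ.1 hω.c1.c
  have hw : Continuous ω := continuousOn_univ.1 hω.c1.cw
  have hG : Continuous G := continuousOn_univ.1 hω.c
  have hk := kq_cont σ M
  have hz : ∀ z ∉ Bz (1/4), kq σ M z = 0 := fun z h => kq_zero hσ hl hM h
  have ftc : ∀ z, ω (x - z) - ω x = ∫ t in Icc (0:ℝ) 1, ⟪P (x - t • z), -z⟫ := by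
    intro z
    have hd : ∀ t ∈ uIcc (0:ℝ) 1, HasDerivAt (fun t : ℝ => ω (x - t • z)) ⟪P (x - t • z), -z⟫ t := fun t _ => by
      have hl : HasDerivAt (fun t : ℝ => x - t • z) (-z) t := by
        simpa using ((hasDerivAt_id t).smul_const z).const_sub x
      exact (hω.d1 _ trivial).comp_hasDerivAt t hl
    have := intervalIntegral.integral_eq_sub_of_hasDerivAt hd (Continuous.intervalIntegrable (by fun_prop) _ _)
    rw [intervalIntegral.integral_of_le nm, ← integral_Icc_eq_integral_Ioc] at this
    rw [this]; simp
  have e1 : (∫ z in B, 10 * kq σ M z ^ 4 * ω (x - z)) - (∫ z in B, 10 * kq σ M z ^ 4) * ω x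
      = ∫ z in B, ∫ t in Icc (0:ℝ) 1, 10 * kq σ M z ^ 4 * ⟪P (x - t • z), -z⟫ := by
    rw [← integral_mul_const, ← integral_sub]
    · refine integral_congr_ae (ae_of_all _ fun z => ?_)
      simp only []
      rw [integral_const_mul, ← ftc]; ring
    · exact (Continuous.continuousOn (by fun_prop)).integrableOn_compact hBc
    · exact (Continuous.continuousOn (by fun_prop)).integrableOn_compact hBc
  have e2 := swapK (f := fun (z : E n) (t : ℝ) => 10 * kq σ M z ^ 4 * ⟪P (x - t • z), -z⟫) (by fun_prop) hBc (isCompact_Icc (a := (0:ℝ)) (b := 1))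
  have e3 : ∀ t ∈ Ioc (0:ℝ) 1, ∫ z in B, 10 * kq σ M z ^ 4 * ⟪P (x - t • z), -z⟫
      = ∫ z in B, t * (kq σ M z ^ 5 * tr (inv M * G (x - t • z))) := by
    intro t ht
    have hs := hω.aff x (-t)
    have ibp := IBP (icb (0 : E n) (1/4)) (subset_univ _) isOpen_univ (kq_C1 σ hM.sym)
      (fun z h => by simp [hz z h]) (fun z h => by simp [hz z h]) hs (DF_const (hM.inv hl))
    have hr : ∀ f : E n → ℝ, (∀ z, kq σ M z = 0 → f z = 0) → ∫ z in B, f z = ∫ z, f z := fun f hf =>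
      setIntegral_eq_integral_of_forall_compl_eq_zero fun z hzB => hf z (hz z fun h => hzB (h14 h))
    rw [hr _ (fun z h => by simp [h]), hr _ (fun z h => by simp [h])]
    have hxz : ∀ z : E n, x + (-t) • z = x - t • z := fun z => by rw [neg_smul, sub_eq_add_neg]
    have l1 : ∫ z, kq σ M z ^ 5 * tr (inv M * ((-t) ^ 2 • G (x + (-t) • z))) = t * ∫ z, t * (kq σ M z ^ 5 * tr (inv M * G (x - t • z))) := by
      rw [← integral_const_mul]
      refine integral_congr_ae (ae_of_all _ fun z => ?_)
      simp only []
      rw [mul_smulL, map_smul, hxz, smul_eq_mul]; ring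
    have l2 : ∫ z, ⟪inv M ((-(10 * kq σ M z ^ 4)) • M z), (-t) • P (x + (-t) • z)⟫ = - (t * ∫ z, 10 * kq σ M z ^ 4 * ⟪P (x - t • z), -z⟫) := by
      rw [← integral_const_mul, ← integral_neg]
      refine integral_congr_ae (ae_of_all _ fun z => ?_)
      have : inv M (M z) = z := by rw [← mul_apply_eq_comp, hM.inv_mul hl]; rfl
      simp only []
      rw [map_smul, this, hxz, isl, inner_smul_right, inner_neg_right, real_inner_comm]; simp; ring
    rw [l1, l2, neg_neg] at ibp
    exact (mul_left_cancel₀ ht.1.ne' ibp).symm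
  have e4 : ∫ t in Icc (0:ℝ) 1, ∫ z in B, 10 * kq σ M z ^ 4 * ⟪P (x - t • z), -z⟫
      = ∫ t in Icc (0:ℝ) 1, ∫ z in B, t * (kq σ M z ^ 5 * tr (inv M * G (x - t • z))) := by
    rw [integral_Icc_eq_integral_Ioc, integral_Icc_eq_integral_Ioc]
    exact setIntegral_congr_fun measurableSet_Ioc e3
  linarith
theorem cK_int (h : Continuous f) : IntegrableOn f (closedBall c r) := cB_int h.continuousOn
theorem vol_cb (hn : 1 ≤ n) (hr : 0 ≤ r) (c : E n) : volume.real (closedBall c r) = r ^ n * volume.real (Bz 1) := by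
  have : Nonempty (Fin n) := ⟨⟨0, hn⟩⟩
  rw [measureReal_def, Measure.addHaar_closedBall _ _ hr, ← Measure.addHaar_closedBall_eq_addHaar_ball, finrank_euclideanSpace_fin,
    ENNReal.toReal_mul, ENNReal.toReal_ofReal pp, measureReal_def]
theorem vol_pos (c : E n) (hr : 0 < r) : 0 < volume.real (closedBall c r) :=
  ENNReal.toReal_pos (measure_closedBall_pos _ _ hr).ne' (icb _ _).measure_lt_top.ne
theorem set_le {K : ℝ} (hf : Continuous f) (h : ∀ x ∈ closedBall c r, f x ≤ K) :
    ∫ x in closedBall c r, f x ≤ K * volume.real (closedBall c r) := by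
  refine (setIntegral_mono_on (cK_int hf) (cK_int continuous_const) mcb h).trans ?_
  simp [mul_comm]
theorem Dbd (hσ : 16 * σ ^ 2 ≤ l) (hl : 0 < l) (hl1 : l ≤ 1) (hM : Ell l m M) {k : E n → ℝ} (hk : Continuous k)
    (hθ : θ ≤ 1/4) :
    ∫ x in Bz θ, |∫ t in Icc (0:ℝ) 1, ∫ z in Bz 1, t * (kq σ M z ^ 5 * k (x - t • z))|
      ≤ volume.real (Bz 1) * ∫ x in Bz (1/2), |k x| := by
  set B := Bz 1 with hB
  have hBc : IsCompact B := icb _ _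
  have hIc : IsCompact (Icc (0:ℝ) 1) := isCompact_Icc
  have hkq := kq_cont σ M
  set g : E n → ℝ → E n → ℝ := fun x t z => |t| * (kq σ M z ^ 5 * |k (x - t • z)|) with hg
  have hgc : Continuous fun q : (E n × ℝ) × E n => g q.1.1 q.1.2 q.2 := by simp only [hg]; fun_prop
  have hgz : Continuous fun q : E n × ℝ => ∫ z in B, g q.1 q.2 z :=
    continuous_parametric_integral_of_continuous hgc hBc
  have h0c : Continuous fun q : E n × ℝ => ∫ z in B, q.2 * (kq σ M z ^ 5 * k (q.1 - q.2 • z)) :=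
    continuous_parametric_integral_of_continuous (f := fun (q : E n × ℝ) z => q.2 * (kq σ M z ^ 5 * k (q.1 - q.2 • z))) (by
      simp only [Function.uncurry_def]; fun_prop) hBc
  have hx1 : ∀ x, |∫ t in Icc (0:ℝ) 1, ∫ z in B, t * (kq σ M z ^ 5 * k (x - t • z))| ≤ ∫ t in Icc (0:ℝ) 1, ∫ z in B, g x t z := by
    intro x
    refine abs_integral_le_integral_abs.trans ?_
    refine setIntegral_mono_on ?_ ?_ measurableSet_Icc fun t ht => ?_
    · have : Continuous fun t : ℝ => |∫ z in B, t * (kq σ M z ^ 5 * k (x - t • z))| :=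
        (h0c.comp (Continuous.prodMk_right x)).abs
      exact this.continuousOn.integrableOn_compact hIc
    · exact (hgz.comp (Continuous.prodMk_right x)).continuousOn.integrableOn_compact hIc
    · refine abs_integral_le_integral_abs.trans (le_of_eq (integral_congr_ae (ae_of_all _ fun z => ?_)))
      simp only [hg, abs_mul, abs_of_nonneg (pow_nonneg (kq_nn σ M z) 5)]
  have hgt : Continuous fun x : E n => ∫ t in Icc (0:ℝ) 1, ∫ z in B, g x t z :=
    continuous_parametric_integral_of_continuous (f := fun x t => ∫ z in B, g x t z) hgz hIc
  have h0t : Continuous fun x : E n => ∫ t in Icc (0:ℝ) 1, ∫ z in B, t * (kq σ M z ^ 5 * k (x - t • z)) :=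
    continuous_parametric_integral_of_continuous (f := fun x t => ∫ z in B, t * (kq σ M z ^ 5 * k (x - t • z))) h0c hIc
  refine (setIntegral_mono_on (cK_int h0t.abs) (cK_int hgt) mcb fun x _ => hx1 x).trans ?_
  rw [swapK hgz (icb _ _) hIc]
  set I := ∫ x in Bz (1/2), |k x| with hI
  have hI0 : 0 ≤ I := integral_nonneg fun x => abs_nonneg _
  have hin : ∀ t ∈ Icc (0:ℝ) 1, ∀ z, ∫ x in Bz θ, g x t z ≤ I := by
    intro t ht z
    by_cases hz : z ∈ Bz (1/4)
    · have hkb : kq σ M z ^ 5 ≤ 1 := by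
        refine pow_le_one₀ (kq_nn σ M z) (max_le ?_ nm)
        have := hM.lo z
        nlinarith [mul_nonneg hl.le (sq_nonneg ‖z‖)]
      have e1 : ∫ x in Bz (1/2), |k x| = ∫ x, (Bz (1/2)).indicator (fun x => |k x|) (x - t • z) := by
        rw [integral_sub_right_eq_self (fun x => (Bz (1/2)).indicator (fun x => |k x|) x), integral_indicator mcb]
      have hii : Integrable ((Bz (1/2)).indicator (fun x => |k x|)) :=
        (integrable_indicator_iff mcb).2 (cK_int hk.abs)
      have hgx : Continuous fun x => g x t z := by simp only [hg]; fun_prop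
      rw [hI, e1, ← integral_indicator mcb]
      refine integral_mono ((integrable_indicator_iff mcb).2 (cK_int hgx)) (hii.comp_sub_right _) fun x => ?_
      by_cases hx : x ∈ Bz θ
      · rw [indicator_of_mem hx, indicator_of_mem]
        · simp only [hg]
          have : |t| ≤ 1 := by rw [abs_of_nonneg ht.1]; exact ht.2
          have h5 := pow_nonneg (kq_nn σ M z) 5
          calc _ ≤ 1 * (1 * |k (x - t • z)|) := by gcongr
            _ = _ := by ring
        · rw [mcz] at *
          refine (norm_sub_le _ _).trans ?_
          rw [norm_smul, rnn ht.1]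
          have : t * ‖z‖ ≤ 1 * (1/4) := by gcongr; exact ht.2
          linarith
      · rw [indicator_of_notMem hx]; exact indicator_nonneg (fun _ _ => abs_nonneg _) _
    · simp [hg, kq_zero hσ hl hM hz, hI0]
  have ht : ∀ t ∈ Icc (0:ℝ) 1, ∫ x in Bz θ, ∫ z in B, g x t z ≤ volume.real B * I := by
    intro t ht
    have hgt : Continuous fun q : E n × E n => g q.1 t q.2 := by simp only [hg]; fun_prop
    rw [swapK hgt (icb _ _) hBc, mul_comm]
    refine set_le ?_ fun z _ => hin t ht z
    have hgt' : Continuous fun q : E n × E n => g q.2 t q.1 := by simp only [hg]; fun_prop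
    exact continuous_parametric_integral_of_continuous (f := fun z x => g x t z) hgt' (icb _ _)
  have hgz' : Continuous fun q : ℝ × E n => ∫ z in B, g q.2 q.1 z := hgz.comp (continuous_snd.prodMk continuous_fst)
  have hc : Continuous fun t : ℝ => ∫ x in Bz θ, ∫ z in B, g x t z :=
    continuous_parametric_integral_of_continuous (f := fun t x => ∫ z in B, g x t z) hgz' (icb _ _)
  refine (setIntegral_mono_on (hc.continuousOn.integrableOn_compact hIc) (integrableOn_const (by simp)) measurableSet_Icc ht).trans ?_
  simp
theorem ax1 (ha : a ≤ 1) (hb : 0 ≤ b) : 2 * (a * b) ≤ 2 * b := by nlinarith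
theorem ax2 {x j : ℝ} (hx : 0 ≤ x) (hx4 : x ≤ 1/4) (h1 : |i| ≤ 2 * x) (h2 : |j| ≤ 2 * x ^ 2) :
    |2 * i - j| ≤ 6 * x ∧ |j - 4 * i| ≤ 10 * x := by
  have : x ^ 2 ≤ x * (1/4) := by nlinarith
  simp only [abs_le] at *; constructor <;> constructor <;> linarith [h1.1, h1.2, h2.1, h2.2]
theorem ax3 {y : ℝ} (hs : s = l / 16) (hl : 0 < l) (hl1 : l ≤ 1) (h : l * y ^ 2 ≤ i) : s - i ≤ 1 := by
  nlinarith [mul_nonneg hl.le (sq_nonneg y)]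
theorem ax4 {y : ℝ} (h2 : i ≤ 2 * y ^ 2) (h3 : y ^ 2 ≤ (s/2) ^ 2) : s ^ 2 / 2 ≤ s ^ 2 - i := by nlinarith
theorem ax5 {V X Y c : ℝ} (hV : 0 < V) (hX : 0 ≤ X) (hY : 0 ≤ Y) (hc : 0 < c) : c⁻¹ * (200000 * V * V * X + V * Y) ≤
    c⁻¹ * ((3000 * V + 200000 * V * V) * X + (3000 * V + 200000 * V * V) * Y) := by
  refine mll (add_le_add ?_ ?_) pp
  · nlinarith [mul_nonneg hV.le hX]
  · nlinarith [mul_nonneg (mul_nonneg hV.le hV.le) hY]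
theorem ax6 {A x X : ℝ} (hA : A ≤ 70 * d) (hd : d ≤ (6 * x) ^ 3) (hB : B ≤ 6 * 1 * (20 * x ^ 3)) (hx : 0 ≤ x) (hX : X ≤ A + B) :
    X ≤ 20000 * x ^ 3 := by
  nlinarith [pow_nonneg hx 3]
theorem HA (hn : 1 ≤ n) (hl : 0 < l) (hl1 : l ≤ 1) : ∃ C : ℝ, 0 < C ∧ ∀ (M : L n) (_ : Ell l 2 M) (ω : E n → ℝ) (P : E n → E n)
    (G : E n → L n) (_ : C2 univ ω P G) (c : ℝ), ∃ (c0 : ℝ) (p0 : E n) (M0 : L n), (∀ x y, ⟪M0 x, y⟫ = ⟪x, M0 y⟫) ∧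
    ∀ e : ℝ, (∀ x ∈ Bz 1, |ω x| ≤ e) → ‖M0‖ ≤ C * e ∧ ∀ θ : ℝ, 0 < θ → θ ≤ 1/4 →
    ∫ x in Bz θ, |ω x - qd c0 p0 M0 x| ≤
      C * (∫ x in Bz (1/2), |tr (inv M * G x) - c|) + C * θ ^ (n + 3) * e := by
  set σ := Real.sqrt l / 4 with hσd
  have hσ2 : σ ^ 2 = l / 16 := by rw [hσd, div_pow, Real.sq_sqrt hl.le]; norm_num
  have hσ : 16 * σ ^ 2 ≤ l := by rw [hσ2]; linarith
  have hσ0 : 0 < σ := pp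
  have hσ1 : σ / 2 ≤ 1 := by have : σ ^ 2 ≤ 1 ^ 2 := by rw [hσ2]; linarith
                             linarith [(abs_le_of_sq_le_sq' this nm).2]
  set B := Bz 1 with hB
  have hBc : IsCompact B := icb _ _
  set V := volume.real B with hV
  have hV0 : 0 < V := vol_pos _ one_pos
  set c1 := 10 * (σ ^ 2 / 2) ^ 4 * volume.real (Bz (σ/2)) with hc1
  have hc10 : 0 < c1 := by have := vol_pos (0 : E n) (show 0 < σ/2 from pp); positivity
  refine ⟨(3000 * V + 200000 * V * V) / c1, pp, ?_⟩
  intro M hM ω P G hω c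
  have hw : Continuous ω := continuousOn_univ.1 hω.c1.cw
  have hG : Continuous G := continuousOn_univ.1 hω.c
  have hk := kq_cont σ M
  have hkB : ∀ z, z ∉ Bz (1/4) → kq σ M z = 0 := fun z hz => kq_zero hσ hl hM hz
  set Φ := ∫ z in B, 10 * kq σ M z ^ 4 with hΦ
  have hΦ1 : c1 ≤ Φ := by
    have h1 : ∫ z in Bz (σ/2), 10 * (σ ^ 2 / 2) ^ 4 ≤ ∫ z in Bz (σ/2), 10 * kq σ M z ^ 4 := by
      refine setIntegral_mono_on (cK_int continuous_const) (cK_int (by fun_prop)) mcb fun z hz => ?_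
      rw [mcz] at hz
      have h2 := hM.hi z
      have h3 := pow_le_pow_left₀ (norm_nonneg z) hz 2
      have h4 : σ ^ 2 / 2 ≤ kq σ M z := le_trans (ax4 h2 h3) (le_max_left _ _)
      gcongr
    have h2 : ∫ z in Bz (σ/2), 10 * kq σ M z ^ 4 ≤ Φ :=
      setIntegral_mono_set (cK_int (by fun_prop)) (ae_of_all _ fun z => by have := kq_nn σ M z; positivity)
        (cbs hσ1).eventuallyLE
    refine le_trans (le_of_eq ?_) (h1.trans h2)
    simp [hc1, mul_comm]
  have hΦ0 : 0 < Φ := hc10.trans_le hΦ1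
  set κ := ∫ t in Icc (0:ℝ) 1, ∫ z in B, t * kq σ M z ^ 5 with hκ
  set k : E n → ℝ := fun x => tr (inv M * G x) - c with hkd
  have hkc : Continuous k := by
    have := tr_cont (U := fun _ => inv M) (Ω := univ) continuousOn_const hω.c
    exact (continuousOn_univ.1 this).sub continuous_const
  set D : E n → ℝ := fun x => ∫ t in Icc (0:ℝ) 1, ∫ z in B, t * (kq σ M z ^ 5 * k (x - t • z)) with hD
  have hJ : ∀ x, ∫ t in Icc (0:ℝ) 1, ∫ z in B, t * (kq σ M z ^ 5 * tr (inv M * G (x - t • z))) = c * κ + D x := by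
    intro x
    have hz1 : Continuous fun t : ℝ => ∫ z in B, t * kq σ M z ^ 5 :=
      continuous_parametric_integral_of_continuous (f := fun (t : ℝ) z => t * kq σ M z ^ 5) (by simp only [Function.uncurry_def]; fun_prop) hBc
    have hz2 : Continuous fun t : ℝ => ∫ z in B, t * (kq σ M z ^ 5 * k (x - t • z)) :=
      continuous_parametric_integral_of_continuous (f := fun (t : ℝ) z => t * (kq σ M z ^ 5 * k (x - t • z))) (by simp only [Function.uncurry_def]; fun_prop) hBc
    have hIc : IsCompact (Icc (0:ℝ) 1) := isCompact_Icc
    rw [hκ, hD, ← integral_const_mul]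
    simp only []
    rw [← integral_add ((hz1.const_mul c).continuousOn.integrableOn_compact hIc) (hz2.continuousOn.integrableOn_compact hIc)]
    refine integral_congr_ae (ae_of_all _ fun t => ?_)
    simp only []
    rw [← integral_const_mul, ← integral_add (cK_int (by fun_prop)) (cK_int (by fun_prop))]
    refine integral_congr_ae (ae_of_all _ fun z => ?_)
    simp only [hkd]; ring
  have hDc : Continuous D := by
    have h0c : Continuous fun q : E n × ℝ => ∫ z in B, q.2 * (kq σ M z ^ 5 * k (q.1 - q.2 • z)) :=
      continuous_parametric_integral_of_continuous (f := fun (q : E n × ℝ) z => q.2 * (kq σ M z ^ 5 * k (q.1 - q.2 • z))) (by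
        simp only [Function.uncurry_def]; fun_prop) hBc
    exact continuous_parametric_integral_of_continuous (f := fun x t => ∫ z in B, t * (kq σ M z ^ 5 * k (x - t • z))) h0c isCompact_Icc
  set a : E n → ℝ := fun y => 10 * (ω y * kq σ M y ^ 4) with ha
  set p : E n → E n := fun y => (10 * (8 * ω y * kq σ M y ^ 3)) • M y with hp
  set N : E n → L n := fun y => (10 * ω y) • ((-8 * kq σ M y ^ 3) • M + (48 * kq σ M y ^ 2) • ro (M y) (M y)) with hN
  have hac : Continuous a := by fun_prop
  have hpc : Continuous p := by fun_prop
  have hNc : Continuous N := by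
    have : Continuous fun y => ro (M y) (M y) := continuousOn_univ.1 (ro_cont (by fun_prop) (by fun_prop))
    fun_prop
  have hNs : ∀ y u v, ⟪N y u, v⟫ = ⟪u, N y v⟫ := by
    intro y u v
    simp only [hN, smul_apply, add_apply, ro_apply, isl, inner_smul_right, inner_add_left, inner_add_right, hM.sym u v,
      RCLike.conj_to_real, real_inner_comm u (M y)]
    ring
  have hA : ∀ x ∈ Bz (1/4), ∫ z in B, 10 * kq σ M z ^ 4 * ω (x - z) = ∫ y in B, 10 * kq σ M (x - y) ^ 4 * ω y := by
    intro x hx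
    rw [setIntegral_eq_integral_of_forall_compl_eq_zero fun z hzB => by
        rw [hkB z fun h => hzB (cbs nm h)]; simp,
      setIntegral_eq_integral_of_forall_compl_eq_zero fun y hyB => by
        rw [hkB (x - y) fun h => hyB ?_]
        · simp
        · rw [mcz] at *
          have := norm_sub_norm_le y x
          rw [norm_sub_rev] at this; linarith,
      ← integral_sub_left_eq_self (fun y => 10 * kq σ M (x - y) ^ 4 * ω y) volume x]
    simp
  have hM2 := hM.norm_le hl.le nm
  have hAp : ∀ e, (∀ x ∈ B, |ω x| ≤ e) → ∀ x ∈ Bz (1/4),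
      |(∫ y in B, 10 * kq σ M (x - y) ^ 4 * ω y) - qd (∫ y in B, a y) (∫ y in B, p y) (∫ y in B, N y) x| ≤ 200000 * e * ‖x‖ ^ 3 * V := by
    intro e he x hx
    rw [mcz] at hx
    have hq : Continuous fun y => qd (a y) (p y) (N y) x := by unfold qd; fun_prop
    rw [← qd_int hBc hac hpc hNc, ← integral_sub (cK_int (by fun_prop)) (cK_int hq)]
    refine abs_integral_le_integral_abs.trans ?_
    refine set_le (by fun_prop) fun y hy => ?_
    have hye := he y hy
    have he0 := (abs_nonneg _).trans hye
    rw [mcz] at hy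
    set t := σ ^ 2 - ⟪M y, y⟫ with ht
    set i1 := ⟪M y, x⟫ with hi1
    set i2 := ⟪M x, x⟫ with hi2
    have hx0 := norm_nonneg x
    have b1 : |i1| ≤ 2 * ‖x‖ := (inner_le_mn hM2 y x).trans (ax1 hy hx0)
    have b2 : |i2| ≤ 2 * ‖x‖ ^ 2 := (inner_le_mn hM2 x x).trans (by rw [sq])
    have e1 : kq σ M (x - y) = max (t + (2 * i1 - i2)) 0 := by
      rw [kq, map_sub, inner_sub_left, inner_sub_right, inner_sub_right, hM.sym x y, real_inner_comm (M y) x]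
      congr 1; ring
    have e2 : qd (a y) (p y) (N y) x = 10 * ω y * (max t 0 ^ 4 + 4 * max t 0 ^ 3 * (2 * i1 - i2) + 6 * max t 0 ^ 2 * (4 * i1 ^ 2)) := by
      simp only [qd, ha, hp, hN, smul_apply, add_apply, ro_apply, isl, inner_add_left, ← hi1, ← hi2, kq, ← ht]
      ring
    obtain ⟨hd, hd'⟩ := ax2 hx0 hx b1 b2
    have ht1 : t ≤ 1 := ax3 hσ2 hl hl1 (hM.lo y)
    have hT := tay4 ht1 (hd.trans (by linarith))
    have hd3 : |2 * i1 - i2| ^ 3 ≤ (6 * ‖x‖) ^ 3 := pow_le_pow_left₀ (abs_nonneg _) hd 3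
    have hm : max t 0 ^ 2 ≤ 1 := pow_le_one₀ (le_max_right _ _) (max_le ht1 nm)
    have hq3 : |(2 * i1 - i2) ^ 2 - 4 * i1 ^ 2| ≤ 20 * ‖x‖ ^ 3 := by
      rw [show (2 * i1 - i2) ^ 2 - 4 * i1 ^ 2 = i2 * (i2 - 4 * i1) by ring, abs_mul]
      calc _ ≤ (2 * ‖x‖ ^ 2) * (10 * ‖x‖) := by gcongr
        _ = _ := by ring
    have hq4 : |6 * max t 0 ^ 2 * ((2 * i1 - i2) ^ 2 - 4 * i1 ^ 2)| ≤ 6 * 1 * (20 * ‖x‖ ^ 3) := by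
      rw [abs_mul, abs_of_nonneg (show 0 ≤ 6 * max t 0 ^ 2 from pp)]; gcongr
    rw [e1, e2, show 10 * max (t + (2 * i1 - i2)) 0 ^ 4 * ω y - 10 * ω y * (max t 0 ^ 4 + 4 * max t 0 ^ 3 * (2 * i1 - i2) + 6 * max t 0 ^ 2 * (4 * i1 ^ 2))
      = 10 * (ω y * ((max (t + (2 * i1 - i2)) 0 ^ 4 - (max t 0 ^ 4 + 4 * max t 0 ^ 3 * (2 * i1 - i2) + 6 * max t 0 ^ 2 * (2 * i1 - i2) ^ 2))
        + 6 * max t 0 ^ 2 * ((2 * i1 - i2) ^ 2 - 4 * i1 ^ 2))) by ring, abs_mul, abs_mul]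
    have h9 := (abs_add_le (max (t + (2 * i1 - i2)) 0 ^ 4 - (max t 0 ^ 4 + 4 * max t 0 ^ 3 * (2 * i1 - i2) + 6 * max t 0 ^ 2 * (2 * i1 - i2) ^ 2))
      (6 * max t 0 ^ 2 * ((2 * i1 - i2) ^ 2 - 4 * i1 ^ 2)))
    calc _ ≤ |(10:ℝ)| * (e * (20000 * ‖x‖ ^ 3)) := by gcongr; exact ax6 hT hd3 hq4 hx0 h9
      _ = _ := by norm_num; ring
  refine ⟨Φ⁻¹ * ((∫ y in B, a y) - c * κ), Φ⁻¹ • ∫ y in B, p y, Φ⁻¹ • ∫ y in B, N y, fun u v => by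
    simp only [smul_apply, isl, inner_smul_right, sym_int hBc hNc hNs u v], ?_⟩
  intro e he
  have he0 : 0 ≤ e := (abs_nonneg _).trans (he 0 (by simp [hB]))
  refine ⟨?_, ?_⟩
  · have hNb : ∀ y ∈ B, ‖N y‖ ≤ 3000 * e := by
      intro y hy
      have hye := he y hy
      rw [mcz] at hy
      have hk0 := kq_nn σ M y
      have hk1 : kq σ M y ≤ 1 := max_le (ax3 hσ2 hl hl1 (hM.lo y)) zero_le_one
      have hMy : ‖M y‖ ≤ 2 := (M.le_opNorm y).trans (by nlinarith only [norm_nonneg M, hM.norm_le hl.le zero_le_two, hy, norm_nonneg y])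
      rw [hN]; simp only []
      rw [norm_smul]
      refine (mul_le_mul (b := 10 * e) (d := 8 * 1 ^ 3 * 2 + 48 * 1 ^ 2 * (2 * 2)) ?_ ((norm_add_le _ _).trans (add_le_add ?_ ?_)) (norm_nonneg _) pp).trans (by linarith)
      · rw [Real.norm_eq_abs, abs_mul]; norm_num; exact hye
      · rw [norm_smul, Real.norm_eq_abs, abs_mul, abs_of_nonneg (pow_nonneg hk0 3), abs_neg, abs_of_nonneg (nm : (0:ℝ) ≤ 8)]; gcongr
      · rw [norm_smul, rnn pp]
        exact mul_le_mul (by gcongr) ((ro_norm _ _).trans (by gcongr)) (norm_nonneg _) nm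
    have h1 := norm_setIntegral_le_of_norm_le_const (hBc.measure_lt_top (μ := volume)) hNb
    rw [norm_smul, norm_inv, rnn hΦ0.le]
    calc _ ≤ c1⁻¹ * (3000 * e * V) := by gcongr
      _ ≤ c1⁻¹ * (3000 * e * V) + c1⁻¹ * (200000 * V * V * e) := le_add_of_nonneg_right pp
      _ = _ := by ring
  intro θ hθ0 hθ
  have hpt : ∀ x ∈ Bz θ, |ω x - qd (Φ⁻¹ * ((∫ y in B, a y) - c * κ)) (Φ⁻¹ • ∫ y in B, p y) (Φ⁻¹ • ∫ y in B, N y) x|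
      ≤ c1⁻¹ * (200000 * e * θ ^ 3 * V + |D x|) := by
    intro x hx
    have hx4 : x ∈ Bz (1/4) := cbs hθ hx
    have hr := rep hσ hl hM hω x
    rw [hJ x, hA x hx4] at hr
    have h2 := hAp e he x hx4
    have e1 : ω x - qd (Φ⁻¹ * ((∫ y in B, a y) - c * κ)) (Φ⁻¹ • ∫ y in B, p y) (Φ⁻¹ • ∫ y in B, N y) x
        = Φ⁻¹ * ((∫ y in B, 10 * kq σ M (x - y) ^ 4 * ω y) - qd (∫ y in B, a y) (∫ y in B, p y) (∫ y in B, N y) x - D x) := by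
      have : ω x = Φ⁻¹ * (Φ * ω x) := by field_simp
      rw [this, hr]
      simp only [qd, smul_apply, isl]; ring
    rw [e1, abs_mul, abs_of_pos (inv_pos.2 hΦ0)]
    have h3 : ‖x‖ ^ 3 ≤ θ ^ 3 := pow_le_pow_left₀ (norm_nonneg x) (mcz.1 hx) 3
    gcongr
    refine (abs_sub _ _).trans (by gcongr; exact h2.trans (by gcongr))
  have hqc : Continuous (qd (Φ⁻¹ * ((∫ y in B, a y) - c * κ)) (Φ⁻¹ • ∫ y in B, p y) (Φ⁻¹ • ∫ y in B, N y)) := by unfold qd; fun_prop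
  refine (setIntegral_mono_on (cK_int (by fun_prop)) (cK_int (by fun_prop)) mcb hpt).trans ?_
  rw [integral_const_mul, integral_add (cK_int continuous_const) (cK_int (by fun_prop))]
  have hDb := Dbd hσ hl hl1 hM hkc hθ
  have hcst : ∫ x in Bz θ, 200000 * e * θ ^ 3 * V = 200000 * V * V * θ ^ (n+3) * e := by
    rw [setIntegral_const, vol_cb hn hθ0.le, smul_eq_mul]; ring
  rw [hcst]
  set I := ∫ x in Bz (1/2), |k x|
  have hI0 : 0 ≤ I := integral_nonneg fun x => abs_nonneg _
  have : 0 ≤ θ ^ (n+3) * e := pp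
  calc _ ≤ c1⁻¹ * (200000 * V * V * (θ ^ (n+3) * e) + V * I) := by rw [← mul_assoc]; gcongr
    _ ≤ _ := ax5 hV0 this hI0 hc10
    _ = _ := by field_simp; ring
theorem tay {P G} (hw : C2 univ w P G) (hG : ∀ t ∈ Icc (0:ℝ) 1, 0 ≤ ⟪G (x + t • h) h, h⟫) :
    w x + ⟪P x, h⟫ ≤ w (x + h) := by
  have hl : ∀ t : ℝ, HasDerivAt (fun t : ℝ => x + t • h) h t := fun t => by
    simpa using ((hasDerivAt_id t).smul_const h).const_add x
  have h1 : ∀ t : ℝ, HasDerivAt (fun t : ℝ => w (x + t • h)) ⟪P (x + t • h), h⟫ t := fun t =>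
    (hw.d1 _ trivial).comp_hasDerivAt t (hl t)
  have h2 : ∀ t : ℝ, HasDerivAt (fun t : ℝ => ⟪P (x + t • h), h⟫) ⟪G (x + t • h) h, h⟫ t := fun t => by
    have h0 : HasDerivAt (fun t : ℝ => P (x + t • h)) (G (x + t • h) h) t := (hw.d2 _ trivial).comp_hasDerivAt t (hl t)
    simpa using h0.inner ℝ (hasDerivAt_const t h)
  obtain ⟨c, hc, ec⟩ := exists_hasDerivAt_eq_slope _ _ one_pos (fun t _ => (h1 t).continuousAt.continuousWithinAt) fun t _ => h1 t
  obtain ⟨d, hd, ed⟩ := exists_hasDerivAt_eq_slope _ _ hc.1 (fun t _ => (h2 t).continuousAt.continuousWithinAt) fun t _ => h2 t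
  have h3 := hG d ⟨hd.1.le, (hd.2.trans hc.2).le⟩
  rw [ed, sub_zero, zero_smul, add_zero] at h3
  have h4 := (div_nonneg_iff.1 h3).resolve_right fun h => absurd hc.1 (not_lt.2 h.2)
  simp at ec; linarith [h4.1]
def trn (n : ℕ) : ℝ := ‖(tr : L n →L[ℝ] ℝ)‖
theorem trn_nn : 0 ≤ trn n := norm_nonneg (tr : L n →L[ℝ] ℝ)
theorem tr_nb (U G : L n) : |tr (U * G)| ≤ trn n * (‖U‖ * ‖G‖) := by
  rw [← Real.norm_eq_abs]; exact (tr.le_opNorm _).trans (mll (norm_mul_le _ _) trn_nn)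
theorem det_lip (hμ : 0 < μ) (hX : Ell μ 2 X) (hY : Ell μ 2 Y) : |Y.det - X.det| ≤ 2 ^ n * |ldet X - ldet Y| := by
  have h : ∀ {X Y : L n}, Ell μ 2 X → Ell μ 2 Y → Y.det - X.det ≤ 2 ^ n * |ldet X - ldet Y| := fun {X Y} hX hY => by
    have h1 := Real.add_one_le_exp (ldet X - ldet Y)
    have hx := hX.det_pos hμ
    have hy := hY.det_pos hμ
    rw [Real.exp_sub, ldet, ldet, Real.exp_log hx, Real.exp_log hy, le_div_iff₀ hy] at h1
    have h2 : Y.det * -(ldet X - ldet Y) ≤ 2 ^ n * |ldet X - ldet Y| :=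
      (mll (neg_le_abs _) hy.le).trans (by gcongr; exact (hY.det_bd hμ).2)
    unfold ldet at *; linarith
  rw [abs_sub_le_iff]; refine ⟨h hX hY, ?_⟩
  rw [abs_sub_comm]; exact h hY hX
theorem inv_diff (hμ : 0 < μ) (hX : Ell μ m X) (hY : Ell μ m Y) : inv Y - inv X = inv X * (X - Y) * inv Y := by
  rw [mul_subL, hX.inv_mul hμ, sub_mulL, one_mul, mul_assoc, hY.mul_inv hμ, mul_one]
theorem inv_lip (hμ : 0 < μ) (hm : 0 ≤ m) (hX : Ell μ m X) (hY : Ell μ m Y) : ‖inv Y - inv X‖ ≤ μ⁻¹ ^ 2 * ‖X - Y‖ := by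
  rw [inv_diff hμ hX hY]
  have h1 := (hX.inv hμ).norm_le pp pp
  have h2 := (hY.inv hμ).norm_le pp pp
  calc _ ≤ ‖inv X‖ * ‖X - Y‖ * ‖inv Y‖ := (norm_mul_le _ _).trans (by gcongr; exact norm_mul_le _ _)
    _ ≤ μ⁻¹ * ‖X - Y‖ * μ⁻¹ := by gcongr
    _ = _ := by ring
theorem PT (hμ : 0 < μ) : ∃ c C : ℝ, 0 < c ∧ 1 ≤ C ∧ ∀ X Y : L n, Ell μ 2 X → Ell μ 2 Y →
    tr (inv Y * (X - Y)) - (ldet X - ldet Y) ≤ C * ‖X - Y‖ ^ 2 ∧ ‖cof Y - cof X‖ ≤ C * ‖X - Y‖ ∧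
    c * ‖X - Y‖ ^ 2 ≤ tr ((cof Y - cof X) * (X - Y)) + C * |ldet X - ldet Y| ^ 2 ∧ |ldet X - ldet Y| ≤ C ∧ ‖X - Y‖ ≤ C := by
  set t := trn n with ht
  have ht0 : 0 ≤ t := trn_nn
  set i := μ⁻¹ with hi
  have hi0 : 0 < i := inv_pos.2 hμ
  set κ : ℝ := 1 / (2 * (2 / μ + 1) * 2 ^ 2) with hκ
  have hκ0 : 0 < κ := pp
  refine ⟨κ * μ ^ n, 4 + t * i ^ 2 + (2 ^ n * i ^ 2 + 2 ^ n * t * i * i) + 2 ^ n + t * i * 4, pp, ?_, ?_⟩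
  · have : 0 ≤ t * i ^ 2 + (2 ^ n * i ^ 2 + 2 ^ n * t * i * i) + 2 ^ n + t * i * 4 := pp
    linarith
  intro X Y hX hY
  set D := X - Y with hD
  set ℓ := ldet X - ldet Y with hℓ
  set C1 := (2 ^ n * i ^ 2 + 2 ^ n * t * i * i) with hC1
  have hC10 : 0 ≤ C1 := pp
  have f1 := F2 hμ hX hY nm
  have f2 := F2 hμ hY hX nm
  rw [← hD, ← hκ] at f1
  rw [norm_sub_rev, ← hD, ← hκ, show Y - X = -D by rw [hD]; abel, mul_negL, map_neg] at f2
  have hxi := (hX.inv hμ).norm_le pp pp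
  have hyi := (hY.inv hμ).norm_le pp pp
  have hil := inv_lip hμ nm hX hY
  have hd0 := norm_nonneg D
  have hD4 : ‖D‖ ≤ 4 := (norm_sub_le _ _).trans (by
    linarith [hX.norm_le hμ.le nm, hY.norm_le hμ.le nm])
  have hκD : 0 ≤ κ * ‖D‖ ^ 2 := pp
  have g1 : |tr (inv X * D)| ≤ t * i * ‖D‖ := (tr_nb _ _).trans (by rw [mul_assoc]; gcongr)
  have g2 : |tr (inv Y * D)| ≤ t * i * ‖D‖ := (tr_nb _ _).trans (by rw [mul_assoc]; gcongr)
  have hl : |ℓ| ≤ t * i * ‖D‖ := by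
    rw [abs_le] at *; constructor <;> linarith [g1.1, g2.2]
  have hl4 : |ℓ| ≤ t * i * 4 := hl.trans (by gcongr)
  have hdl := det_lip hμ hX hY
  have hx := hX.det_bd hμ
  have hy := hY.det_bd hμ
  have e1 : tr ((cof Y - cof X) * D) = Y.det * tr (inv Y * D) - X.det * tr (inv X * D) := by
    rw [cof, cof, sub_mulL, smul_mulL, smul_mulL, map_sub, map_smul, map_smul, smul_eq_mul, smul_eq_mul]
  have hx0 := hX.det_pos hμ
  have hy0 := hY.det_pos hμ
  have hti4 : 0 ≤ t * i * 4 := pp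
  have hti2 : 0 ≤ t * i ^ 2 := pp
  have h2n : (0:ℝ) ≤ 2 ^ n := pp
  refine ⟨?_, ?_, ?_, by linarith, by linarith⟩
  · have h3 : |tr ((inv Y - inv X) * D)| ≤ t * (i ^ 2 * ‖D‖ * ‖D‖) := (tr_nb _ _).trans (by gcongr)
    rw [sub_mulL, map_sub] at h3
    have h4 : t * (i ^ 2 * ‖D‖ * ‖D‖) ≤ (4 + t * i ^ 2 + C1 + 2 ^ n + t * i * 4) * ‖D‖ ^ 2 := by
      rw [show t * (i ^ 2 * ‖D‖ * ‖D‖) = t * i ^ 2 * ‖D‖ ^ 2 by ring]; gcongr; linarith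
    linarith [(abs_le.1 h3).2]
  · have : cof Y - cof X = X.det • (inv Y - inv X) + (Y.det - X.det) • inv Y := by
      rw [cof, cof]; module
    rw [this]
    refine (norm_add_le _ _).trans ?_
    rw [norm_smul, norm_smul, Real.norm_eq_abs, Real.norm_eq_abs, abs_of_pos hx0]
    calc _ ≤ 2 ^ n * (i ^ 2 * ‖D‖) + 2 ^ n * (t * i * ‖D‖) * i := by
          gcongr
          · exact hx.2
          · exact hdl.trans (by gcongr)
      _ = C1 * ‖D‖ := by ring
      _ ≤ _ := by gcongr; linarith
  · rw [e1]
    have a1 := mll f1 hy0.le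
    have a2 := mll f2 hx0.le
    have a3 : |(Y.det - X.det) * ℓ| ≤ 2 ^ n * |ℓ| ^ 2 := by
      rw [abs_mul, sq, ← mul_assoc]; gcongr
    have a4 : 2 ^ n * |ℓ| ^ 2 ≤ (4 + t * i ^ 2 + C1 + 2 ^ n + t * i * 4) * |ℓ| ^ 2 := by gcongr; linarith
    have a5 : κ * μ ^ n * ‖D‖ ^ 2 ≤ Y.det * (κ * ‖D‖ ^ 2) := by
      calc _ = μ ^ n * (κ * ‖D‖ ^ 2) := by ring
        _ ≤ _ := by gcongr; exact hy.1
    have a6 : 0 ≤ X.det * (κ * ‖D‖ ^ 2) := pp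
    have a7 := (abs_le.1 a3).1
    have e2 : ldet Y - ldet X = -ℓ := by rw [hℓ]; ring
    rw [e2] at a2
    linarith
structure Maj (g : E n → ℝ) (g0 F : ℝ) (ψ : E n → ℝ) (Pψ : E n → E n) (Gψ : E n → L n) : Prop where
  c2 : C2 univ ψ Pψ Gψ
  psd : ∀ x, Psd (Gψ x)
  dom : ∀ x ∈ Bz 1, |g x - g0| ≤ tr (Gψ x)
  nn : ∀ x ∈ Bz 1, 0 ≤ ψ x
  le : ∀ x ∈ Bz 1, ψ x ≤ F
theorem trc {V : E n → L n} (hU : Continuous U) (hV : Continuous V) : Continuous fun x => tr (U x * V x) :=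
  continuousOn_univ.1 (tr_cont hU.continuousOn hV.continuousOn)
theorem ct_cont (R : ℝ) : Continuous (ct R : E n → ℝ) := continuousOn_univ.1 (ct_C2 R univ).c1.cw
theorem C2.cw {P G} (h : C2 univ w P G) : Continuous w := continuousOn_univ.1 h.c1.cw
theorem C2.cG {P G} (h : C2 univ w P G) : Continuous G := continuousOn_univ.1 h.c
theorem Sol.ld (hμ : 0 < μ) {v P} (h : Sol μ v P H) : Continuous fun x => ldet (H x) :=
  (det_diff.continuous.comp h.cont).log fun x => ((h.ell x).det_pos hμ).ne'
theorem int_mono (hf : Continuous f) (hg : Continuous g) (h : ∀ x ∈ closedBall c r, f x ≤ g x) :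
    ∫ x in closedBall c r, f x ≤ ∫ x in closedBall c r, g x :=
  setIntegral_mono_on (cK_int hf) (cK_int hg) mcb h
theorem int_add (hf : Continuous f) (hg : Continuous g) :
    ∫ x in closedBall c r, (f x + g x) = (∫ x in closedBall c r, f x) + ∫ x in closedBall c r, g x :=
  integral_add (cK_int hf) (cK_int hg)
theorem int_sub (hf : Continuous fun x => f x) (hg : Continuous fun x => g x) :
    ∫ x in closedBall c r, (f x - g x) = (∫ x in closedBall c r, f x) - ∫ x in closedBall c r, g x :=
  integral_sub (cK_int hf) (cK_int hg)
theorem IBd (hR : 0 ≤ R) (hR2 : R ≤ 2) {s : E n → ℝ} {P G} (hs : C2 univ s P G) {W : E n → L n} (hU : DF l m U)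
    (hW : DF l' m' W) : |∫ x in Bz R, ct R x * tr ((U x - W x) * G x)| ≤
      trn n * 480 * ∫ x in Bz R, |s x| * ‖U x - W x‖ := by
  have hK : IsCompact (Bz R) := icb _ _
  have h0 : ∀ x ∉ Bz R, ct R x = 0 := fun x hx => (ct_zero hR hx).1
  have h2 : ∀ x ∉ Bz R, ctG R x = 0 := fun x hx => (ct_zero hR hx).2.2
  have key : ∀ {l m : ℝ} {U : E n → L n}, DF l m U → ∫ x in Bz R, ct R x * tr (U x * G x) =
      ∫ x in Bz R, s x * tr (U x * ctG R x) := fun {l m U} hU => by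
    have := IBP2 hK (subset_univ _) isOpen_univ (ct_C2 R univ) h0 (fun x hx => (ct_zero hR hx).2.1) h2 hs hU
    rw [setIntegral_eq_integral_of_forall_compl_eq_zero (fun x hx => by rw [h0 x hx, zero_mul]), this,
      setIntegral_eq_integral_of_forall_compl_eq_zero (fun x hx => by rw [h2 x hx]; simp)]
  have c1 := hs.cw
  have c2 := trc hU.cont hs.cG
  have c3 := trc hW.cont hs.cG
  have c4 := trc hU.cont (ct_C2 R univ).cG
  have c5 := trc hW.cont (ct_C2 R univ).cG
  have c6 := ct_cont (n := n) R
  have c7 := hU.cont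
  have c8 := hW.cont
  have e : ∫ x in Bz R, ct R x * tr ((U x - W x) * G x) =
      ∫ x in Bz R, s x * tr ((U x - W x) * ctG R x) := by
    simp only [sub_mulL, map_sub, mul_sub]
    rw [int_sub (f := fun x => ct R x * tr (U x * G x)) (g := fun x => ct R x * tr (W x * G x)) (c6.mul c2) (c6.mul c3), int_sub (f := fun x => s x * tr (U x * ctG R x)) (g := fun x => s x * tr (W x * ctG R x)) (c1.mul c4) (c1.mul c5)]
    exact congrArg₂ _ (key hU) (key hW)
  rw [e, ← integral_const_mul]
  refine abs_integral_le_integral_abs.trans (int_mono (c1.mul (trc (c7.sub c8) (ct_C2 R univ).cG)).abs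
    (continuous_const.mul (c1.abs.mul (c7.sub c8).norm)) fun x _ => ?_)
  rw [abs_mul]
  have h3 := (tr_nb (U x - W x) (ctG R x)).trans (mll (mll (ct_bd hR hR2 x).2.2 (norm_nonneg _)) trn_nn)
  calc _ ≤ |s x| * (trn n * (‖U x - W x‖ * 480)) := by gcongr
    _ = _ := by ring
theorem DF0 : DF 0 0 (fun _ : E n => (0 : L n)) := DF_const ⟨fun x y => by simp, fun x => by simp, fun x => by simp⟩
theorem IB (hR : 0 ≤ R) (hR2 : R ≤ 2) {s : E n → ℝ} {P G} (hs : C2 univ s P G) (hl : 0 ≤ l) (hm : 0 ≤ m) (hU : DF l m U) :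
    |∫ x in Bz R, ct R x * tr (U x * G x)| ≤ trn n * 480 * m * ∫ x in Bz R, |s x| := by
  have := IBd hR hR2 hs hU DF0
  simp only [sub_zero] at this
  refine this.trans ?_
  rw [mul_assoc (trn n * 480)]
  refine mll ?_ (mul_nonneg trn_nn nm)
  rw [← integral_const_mul]
  refine int_mono (hs.cw.abs.mul hU.cont.norm) (continuous_const.mul hs.cw.abs) fun x _ => ?_
  rw [mul_comm]; gcongr; exact (hU.ell x).norm_le hl hm
theorem Ell_one : Ell 1 1 (1 : L n) :=
  ⟨fun x y => by simp, fun x => by simp, fun x => by simp⟩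
theorem J2 (hμ : 0 < μ) {v P} (h : Sol μ v P H) {g0 F ψ Pψ Gψ} (hM : Maj (fun x => ldet (H x)) g0 F ψ Pψ Gψ) :
    ∫ x in Bz 1, ct 1 x * |ldet (H x) - g0| ≤ trn n * 480 * volume.real (Bz 1) * F := by
  have h1 := IB (R := 1) nm nm hM.c2 nm nm (DF_const Ell_one)
  simp only [one_mul] at h1
  refine (int_mono ((ct_cont 1).mul ((h.ld hμ).sub continuous_const).abs) ((ct_cont 1).mul (tr.continuous.comp hM.c2.cG))
    fun x hx => mll (hM.dom x hx) (ct_nn _ _)).trans ((le_abs_self _).trans (h1.trans ?_))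
  have h2 := set_le (c := 0) (r := 1) hM.c2.cw.abs fun x hx => (abs_of_nonneg (hM.nn x hx)).trans_le (hM.le x hx)
  rw [mul_one, mul_assoc _ _ F, mul_comm _ F]
  exact mll h2 (mul_nonneg trn_nn nm)
theorem J3 (hμ : 0 < μ) (hμ1 : μ ≤ 1) : ∃ C : ℝ, 0 < C ∧ ∀ (v : E n → ℝ) (P : E n → E n) (H : E n → L n) (_ : Sol μ v P H) (g0 F : ℝ)
    (ψ : E n → ℝ) (Pψ : E n → E n) (Gψ : E n → L n) (_ : Maj (fun x => ldet (H x)) g0 F ψ Pψ Gψ) (c : ℝ) (p : E n) (M : L n) (_ : Ell μ 2 M),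
    |g0 - ldet M| ≤ C * ((∫ x in Bz 1, |v x - qd c p M x|) + F) := by
  set V := volume.real (Bz 1) with hV
  have hV0 : 0 < V := vol_pos _ one_pos
  set Φ := ∫ x in Bz 1, ct 1 x with hΦ
  have hΦ0 : 0 < Φ := by
    have h1 : ∫ x in Bz (1/2), ((1:ℝ) ^ 2 - (1/2) ^ 2) ^ 3 ≤ ∫ x in Bz (1/2), ct 1 x :=
      int_mono continuous_const (ct_cont 1) fun x hx => ct_lo nm nm hx
    have h2 : ∫ x in Bz (1/2), ct 1 x ≤ Φ := setIntegral_mono_set (cK_int (ct_cont 1)) (ae_of_all _ fun x => ct_nn _ _)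
      (cbs nm).eventuallyLE
    refine lt_of_lt_of_le ?_ (h1.trans h2)
    rw [setIntegral_const, smul_eq_mul]
    exact mul_pos (vol_pos _ nm) nm
  set T := trn n * 480 with hT
  have hT0 : 0 ≤ T := mul_nonneg trn_nn nm
  refine ⟨(μ ^ n * Φ)⁻¹ * (T * μ⁻¹ + T * V + 1), pp, ?_⟩
  intro v P H hv g0 F ψ Pψ Gψ hψ c p M hM
  have hF : 0 ≤ F := (hψ.nn 0 (by simp)).trans (hψ.le 0 (by simp))
  have hw := hv.c2.sub (qd_C2 univ c p hM.sym)
  set L1 := ∫ x in Bz 1, |v x - qd c p M x| with hL1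
  have hL : 0 ≤ L1 := integral_nonneg fun x => abs_nonneg _
  have j2 := J2 hμ hv hψ
  have u1 := IB (R := 1) nm nm hw pp (inv_pos.2 hμ).le (DF_const (hM.inv hμ))
  have u2 := IB (R := 1) nm nm hw pp (inv_pos.2 hμ).le (hv.df hμ hμ1)
  rw [← hL1, ← hT] at u1 u2
  rw [← hT, ← hV] at j2
  have cg : Continuous fun x => ct 1 x * |ldet (H x) - g0| := (ct_cont 1).mul ((hv.ld hμ).sub continuous_const).abs
  have cdet : Continuous fun x => (H x).det := det_diff.continuous.comp hv.cont
  have c1 : Continuous fun x => ct 1 x * tr (inv M * (H x - M)) := (ct_cont 1).mul (trc continuous_const hw.cG)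
  have c2 : Continuous fun x => ct 1 x * tr (cof (H x) * (H x - M)) := (ct_cont 1).mul (trc (hv.df hμ hμ1).cont hw.cG)
  have hHe : ∀ x, Ell μ 2 (H x) := fun x => (hv.ell x).mono le_rfl nm
  have up : (g0 - ldet M) * Φ ≤ T * μ⁻¹ * L1 + T * V * F := by
    have h1 : ∫ x in Bz 1, (g0 - ldet M) * ct 1 x ≤ ∫ x in Bz 1,
        (ct 1 x * tr (inv M * (H x - M)) + ct 1 x * |ldet (H x) - g0|) := by
      refine int_mono (continuous_const.mul (ct_cont 1)) (c1.add cg) fun x hx => ?_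
      rw [← mul_add, mul_comm]
      refine mll ?_ (ct_nn _ _)
      linarith [F2' hμ (hHe x) hM nm, neg_le_abs (ldet (H x) - g0)]
    rw [integral_const_mul, int_add c1 cg] at h1
    linarith [(abs_le.1 u1).2]
  have lo : -(g0 - ldet M) * ∫ x in Bz 1, ct 1 x * (H x).det ≤ T * μ⁻¹ * L1 + T * V * F := by
    have h1 : ∫ x in Bz 1, -(g0 - ldet M) * (ct 1 x * (H x).det) ≤ ∫ x in Bz 1,
        (-(ct 1 x * tr (cof (H x) * (H x - M))) + ct 1 x * |ldet (H x) - g0|) := by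
      refine int_mono (continuous_const.mul ((ct_cont 1).mul cdet)) (c2.neg.add cg) fun x hx => ?_
      have hd := (hv.ell x).det_bd hμ
      rw [one_pow] at hd
      have f := F2' hμ hM (hHe x) nm
      rw [show M - H x = -(H x - M) by abel, mul_negL, map_neg] at f
      have e : tr (cof (H x) * (H x - M)) = (H x).det * tr (inv (H x) * (H x - M)) := by
        rw [cof, smul_mulL, map_smul, smul_eq_mul]
      have h0 := ((hv.ell x).det_pos hμ).le
      have h2 := mll f h0
      have h3 : (H x).det * (ldet (H x) - g0) ≤ |ldet (H x) - g0| :=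
        (mll (le_abs_self _) h0).trans (mul_le_of_le_one_left (abs_nonneg _) hd.2)
      have h4 : -(g0 - ldet M) * (H x).det ≤ -tr (cof (H x) * (H x - M)) + |ldet (H x) - g0| := by rw [e]; linarith
      have h5 := mll h4 (ct_nn 1 x)
      linarith
    rw [integral_const_mul, int_add (f := fun x => -(ct 1 x * tr (cof (H x) * (H x - M)))) c2.neg cg, integral_neg] at h1
    linarith [(abs_le.1 u2).1]
  have hdet : μ ^ n * Φ ≤ ∫ x in Bz 1, ct 1 x * (H x).det := by
    rw [hΦ, ← integral_const_mul]
    refine int_mono (continuous_const.mul (ct_cont 1)) ((ct_cont 1).mul cdet) fun x hx => ?_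
    rw [mul_comm]
    exact mll ((hv.ell x).det_bd hμ).1 (ct_nn _ _)
  have hμn : μ ^ n * Φ ≤ Φ := mul_le_of_le_one_left hΦ0.le (pow_le_one₀ hμ.le hμ1)
  have fin : μ ^ n * Φ * |g0 - ldet M| ≤ T * μ⁻¹ * L1 + T * V * F := by
    rcases le_total 0 (g0 - ldet M) with h | h
    · rw [abs_of_nonneg h]
      exact (mlr hμn h).trans (by rwa [mul_comm])
    · rw [abs_of_nonpos h]
      exact (mlr hdet (by linarith)).trans (by rwa [mul_comm])
  rw [mul_assoc, ← div_eq_inv_mul, le_div_iff₀' pp]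
  refine fin.trans ?_
  have : 0 ≤ T * μ⁻¹ * F + T * V * L1 + 1 * (L1 + F) := pp
  linarith
theorem Psd_one : Psd (1 : L n) := ⟨fun x y => by simp, fun x => by simp⟩
theorem L1SUP (hn : 1 ≤ n) (hμ : 0 < μ) (hμ1 : μ ≤ 1) : ∃ C : ℝ, 0 < C ∧ ∀ (v : E n → ℝ) (P : E n → E n) (H : E n → L n) (_ : Sol μ v P H)
    (g0 F : ℝ) (ψ : E n → ℝ) (Pψ : E n → E n) (Gψ : E n → L n) (_ : Maj (fun x => ldet (H x)) g0 F ψ Pψ Gψ) (c : ℝ) (p : E n) (M : L n)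
    (_ : Ell μ 2 M), ∀ x ∈ Bz (1/2), |v x - qd c p M x| ≤ C * ((∫ x in Bz 1, |v x - qd c p M x|) + F) := by
  obtain ⟨A, hA, lmp⟩ := LMP hn (l := 1/2) (m := μ⁻¹) nm (inv_pos.2 hμ).le
  obtain ⟨B, hB, j3⟩ := J3 (n := n) hμ hμ1
  set V := volume.real (Bz 1) with hV
  have hV0 : 0 < V := vol_pos _ one_pos
  refine ⟨A * (1 + V * (2 + B)), pp, ?_⟩
  intro v P H hv g0 F ψ Pψ Gψ hψ c p M hM
  have hF : 0 ≤ F := (hψ.nn 0 (by simp)).trans (hψ.le 0 (by simp))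
  have hK := j3 v P H hv g0 F ψ Pψ Gψ hψ c p M hM
  have hw := hv.c2.sub (qd_C2 univ c p hM.sym)
  set L1 := ∫ x in Bz 1, |v x - qd c p M x| with hL1
  have hL : 0 ≤ L1 := integral_nonneg fun x => abs_nonneg _
  set K := |g0 - ldet M| with hKd
  have hK0 : 0 ≤ K := abs_nonneg _
  have key : ∀ (σ : ℝ) (U : E n → L n), |σ| = 1 → (∀ x, Ell (1/2) μ⁻¹ (U x)) →
      (∀ x ∈ Bz 1, 0 ≤ σ * tr (U x * (H x - M)) + |ldet (H x) - g0| + K) →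
      ∀ x ∈ Bz (1/2), σ * (v x - qd c p M x) ≤ A * (L1 + (2 * F + K) * V) := by
    intro σ U hσ hU hs x hx
    have hx1 : x ∈ Bz 1 := cbs nm hx
    have h2 := ((hw.smul σ).add (hψ.c2.smul 2)).add (qd_C2 univ 0 0 (M := (2 * K) • (1 : L n)) fun x y => by
      simp [isl, inner_smul_right])
    have h3 := lmp univ isOpen_univ (subset_univ _) _ _ _ h2 U (fun x _ => hU x) (fun x hx => by
      have t1 := tr_mul_psd (hU x) (hψ.psd x)
      have t2 := tr_mul_psd (hU x) Psd_one
      rw [mul_one, tr_one] at t2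
      simp only [mul_add, mul_smulL, map_add, map_smul, smul_eq_mul, mul_one]
      have t3 : (1:ℝ) ≤ n := by exact_mod_cast hn
      have t4 : K * 1 ≤ K * (2 * tr (U x)) := mll (by linarith) hK0
      linarith [hs x hx, hψ.dom x hx]) x hx
    have e : ∀ y : E n, qd 0 0 ((2 * K) • (1 : L n)) y = K * ‖y‖ ^ 2 := fun y => by
      simp [qd, isl]; ring
    have h4 : ∫ y in Bz 1, max (σ * (v y - qd c p M y) + 2 * ψ y + qd 0 0 ((2 * K) • (1 : L n)) y) 0 ≤
        ∫ y in Bz 1, (|v y - qd c p M y| + (2 * F + K)) := by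
      refine int_mono (h2.cw.max continuous_const) (hw.cw.abs.add continuous_const) fun y hy => max_le ?_ pp
      have h5 : σ * (v y - qd c p M y) ≤ |v y - qd c p M y| := (le_abs_self _).trans (by rw [abs_mul, hσ, one_mul])
      rw [e]
      rw [mcz] at hy
      have := mll (pow_le_one₀ (n := 2) (norm_nonneg y) hy) hK0
      linarith [hψ.le y (by rwa [mcz])]
    rw [int_add (f := fun y => |v y - qd c p M y|) hw.cw.abs continuous_const, setIntegral_const, smul_eq_mul, ← hL1, mul_comm _ (2 * F + K), ← hV] at h4
    refine le_trans ?_ (h3.trans (mll h4 hA.le))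
    rw [e]
    have := hψ.nn x hx1
    have : 0 ≤ K * ‖x‖ ^ 2 := pp
    linarith
  have hfin : A * (L1 + (2 * F + K) * V) ≤ A * (1 + V * (2 + B)) * (L1 + F) := by
    rw [mul_assoc]
    refine mll ?_ hA.le
    have h1 := mll hK hV0.le
    have : 0 ≤ V * 2 * L1 := pp
    linarith
  intro x hx
  have h2 : (1:ℝ)/2 ≤ 1 := nm
  refine le_trans (abs_le.2 ⟨?_, ?_⟩) hfin
  · have := key (-1) (fun x => inv (H x)) (by simp) (fun x => ((hv.ell x).inv hμ).mono nm le_rfl) (fun x hx => ?_) x hx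
    · linarith
    · have f := F2' hμ hM ((hv.ell x).mono le_rfl (nm : (1:ℝ) ≤ 2)) nm
      rw [show M - H x = -(H x - M) by abel, mul_negL, map_neg] at f
      linarith [le_abs_self (ldet (H x) - g0), le_abs_self (g0 - ldet M)]
  · have := key 1 (fun _ => inv M) (by simp) (fun x => (hM.inv hμ).mono nm le_rfl) (fun x hx => ?_) x hx
    · linarith
    · have f := F2' hμ ((hv.ell x).mono le_rfl (nm : (1:ℝ) ≤ 2)) hM nm
      linarith [neg_le_abs (ldet (H x) - g0), neg_le_abs (g0 - ldet M)]
theorem ct_mono (hR : 0 ≤ R) (hR1 : R ≤ 1) (x : E n) : ct R x ≤ ct 1 x := by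
  refine pow_le_pow_left₀ (cm_nn _ _) (max_le_max_right _ ?_) 3
  nlinarith
theorem ay1 (h1 : l ≤ d + k) (h2 : l ≤ C) (hk : k ≤ C) (hd : 0 ≤ d) (hk0 : 0 ≤ k) (hl : 0 ≤ l) : l ^ 2 ≤ 2 * C * d + k ^ 2 := by
  nlinarith [mul_nonneg hd hk0, mlr h2 hd, mlr hk hd]
theorem EN (hμ : 0 < μ) (hμ1 : μ ≤ 1) : ∃ C : ℝ, 0 < C ∧ ∀ (v : E n → ℝ) (P : E n → E n) (H : E n → L n) (_ : Sol μ v P H)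
    (c : ℝ) (p : E n) (M : L n) (_ : Ell μ 2 M) (e R : ℝ) (_ : 0 ≤ R) (_ : R ≤ 1) (_ : ∀ x ∈ Bz R, |v x - qd c p M x| ≤ e),
    ∫ x in Bz R, ct R x * ‖H x - M‖ ^ 2 ≤ C * (e * (∫ x in Bz R, ‖H x - M‖) +
      ∫ x in Bz 1, ct 1 x * |ldet (H x) - ldet M| ^ 2) := by
  obtain ⟨c0, A, hc0, hA, pt⟩ := PT (n := n) hμ
  set T := trn n * 480 with hT
  have hT0 : 0 ≤ T := mul_nonneg trn_nn nm
  refine ⟨c0⁻¹ * (A * (T + 1)), pp, ?_⟩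
  intro v P H hv c p M hM e R hR hR1 he
  have hw := hv.c2.sub (qd_C2 univ c p hM.sym)
  have hHe : ∀ x, Ell μ 2 (H x) := fun x => (hv.ell x).mono le_rfl nm
  have e0 : 0 ≤ e := (abs_nonneg _).trans (he 0 (by simpa using hR))
  have dM := DF_const ((hM.inv hμ).smul (hM.det_pos hμ).le)
  have dH := hv.df hμ hμ1
  have hb := IBd hR (by linarith) hw dM dH
  have cD : Continuous fun x => ‖H x - M‖ := (hv.cont.sub continuous_const).norm
  have cl : Continuous fun x => |ldet (H x) - ldet M| ^ 2 := ((hv.ld hμ).sub continuous_const).abs.pow 2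
  have ctr : Continuous fun x => ct R x * tr ((cof M - cof (H x)) * (H x - M)) :=
    (ct_cont R).mul (trc (continuous_const.sub dH.cont) hw.cG)
  have h1 : ∫ x in Bz R, |v x - qd c p M x| * ‖cof M - cof (H x)‖ ≤ e * A * ∫ x in Bz R, ‖H x - M‖ := by
    rw [← integral_const_mul]
    refine int_mono (hw.cw.abs.mul (continuous_const.sub dH.cont).norm) (continuous_const.mul cD) fun x hx => ?_
    rw [mul_assoc]
    exact mul_le_mul (he x hx) (pt _ _ (hHe x) hM).2.1 (norm_nonneg _) e0
  have h2 : ∫ x in Bz R, c0 * (ct R x * ‖H x - M‖ ^ 2) ≤ ∫ x in Bz R,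
      (ct R x * tr ((cof M - cof (H x)) * (H x - M)) + A * (ct R x * |ldet (H x) - ldet M| ^ 2)) := by
    refine int_mono (continuous_const.mul ((ct_cont R).mul (cD.pow 2))) (ctr.add (continuous_const.mul ((ct_cont R).mul cl))) fun x _ => ?_
    have := mll (pt _ _ (hHe x) hM).2.2.1 (ct_nn R x)
    linarith
  have h3 : ∫ x in Bz R, ct R x * |ldet (H x) - ldet M| ^ 2 ≤ ∫ x in Bz 1, ct 1 x * |ldet (H x) - ldet M| ^ 2 :=
    (int_mono ((ct_cont R).mul cl) ((ct_cont 1).mul cl) fun x _ => mlr (ct_mono hR hR1 x) (sq_nonneg _)).trans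
    (setIntegral_mono_set (cK_int ((ct_cont 1).mul cl)) (ae_of_all _ fun x => mul_nonneg (ct_nn 1 x) (sq_nonneg _))
      (cbs hR1).eventuallyLE)
  rw [integral_const_mul, int_add (g := fun x => A * (ct R x * |ldet (H x) - ldet M| ^ 2)) ctr (continuous_const.mul ((ct_cont R).mul cl)), integral_const_mul] at h2
  set I := ∫ x in Bz R, ‖H x - M‖ with hI
  have hI0 : 0 ≤ I := integral_nonneg fun x => norm_nonneg _
  set J := ∫ x in Bz 1, ct 1 x * |ldet (H x) - ldet M| ^ 2 with hJ
  have hJ0 : 0 ≤ J := integral_nonneg fun x => mul_nonneg (ct_nn 1 x) (sq_nonneg _)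
  rw [mul_assoc, ← div_eq_inv_mul, le_div_iff₀' hc0]
  have h4 := (le_abs_self _).trans (hb.trans (mll h1 hT0))
  have h5 := mll h3 (by linarith : 0 ≤ A)
  have h6 : 0 ≤ A * (e * I) + A * T * J := pp
  unfold cof at *
  linarith
theorem cut_lo (hr : 0 ≤ r) (hR : r ≤ R) (hf : Continuous f) (h0 : ∀ x, 0 ≤ f x) :
    (R ^ 2 - r ^ 2) ^ 3 * ∫ x in Bz r, f x ≤ ∫ x in Bz R, ct R x * f x := by
  rw [← integral_const_mul]
  refine (int_mono (continuous_const.mul hf) ((ct_cont R).mul hf) fun x hx => mlr (ct_lo hr hR hx) (h0 x)).trans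
    (setIntegral_mono_set (cK_int ((ct_cont R).mul hf)) (ae_of_all _ fun x => mul_nonneg (ct_nn R x) (h0 x))
      (cbs hR).eventuallyLE)
theorem ay2 {V : ℝ} (hs : 0 ≤ s) (hs1 : s ≤ 1) (hF : 0 ≤ F) (hF1 : F ≤ 1) (hB : 0 ≤ B) (hV : 0 ≤ V) (hk : k ≤ B * (s ^ 2 * V + F)) (hk0 : 0 ≤ k) :
    k ≤ B * (V + 1) ∧ k ^ 2 ≤ B ^ 2 * (2 * V ^ 2 + 2) * (s ^ 3 + F) := by
  have h2 : s ^ 2 ≤ 1 := pow_le_one₀ hs hs1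
  have h4 : s ^ 4 ≤ s ^ 3 := pow_le_pow_of_le_one hs hs1 nm
  constructor
  · refine hk.trans (mll ?_ hB); nlinarith
  · refine (pow_le_pow_left₀ hk0 hk 2).trans ?_
    rw [mul_pow, mul_assoc]
    refine mll ?_ (sq_nonneg B)
    have h5 : F ^ 2 ≤ F := by nlinarith
    have h6 : V ^ 2 * s ^ 4 ≤ V ^ 2 * s ^ 3 := mll h4 (sq_nonneg V)
    have h7 : 0 ≤ V ^ 2 * F := pp
    have h8 : 0 ≤ s ^ 3 := pp
    nlinarith [sq_nonneg (s ^ 2 * V - F)]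
theorem ay3 (hs : 0 ≤ s) (d : ℝ) : s ^ 2 * d ≤ s ^ 3 + s * d ^ 2 := by
  nlinarith [mul_nonneg hs (sq_nonneg (s - d)), mul_nonneg hs (sq_nonneg d), pow_nonneg hs 3]
theorem J5 (hμ : 0 < μ) (hμ1 : μ ≤ 1) : ∃ C : ℝ, 0 < C ∧ ∀ (v : E n → ℝ) (P : E n → E n) (H : E n → L n) (_ : Sol μ v P H)
    (g0 F : ℝ) (ψ : E n → ℝ) (Pψ : E n → E n) (Gψ : E n → L n) (_ : Maj (fun x => ldet (H x)) g0 F ψ Pψ Gψ) (c : ℝ) (p : E n) (M : L n)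
    (_ : Ell μ 2 M) (s : ℝ) (_ : 0 ≤ s) (_ : s ≤ 1) (_ : F ≤ 1) (_ : ∀ x ∈ Bz 1, |v x - qd c p M x| ≤ s ^ 2),
    ∫ x in Bz (1/2), |tr (inv M * (H x - M)) - (g0 - ldet M)| ≤ C * (s ^ 3 + F) := by
  obtain ⟨c0, A, hc0, hA, pt⟩ := PT (n := n) hμ
  obtain ⟨B, hB, j3⟩ := J3 (n := n) hμ hμ1
  obtain ⟨D, hD, en⟩ := EN (n := n) hμ hμ1
  set V := volume.real (Bz 1) with hV
  have hV0 : 0 < V := vol_pos _ one_pos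
  set T := trn n * 480 * V with hT
  have hT0 : 0 ≤ T := mul_nonneg (mul_nonneg trn_nn nm) hV0.le
  have hA0 : 0 ≤ A := by linarith
  set C1 := 2 * (A + B * (V + 1)) * T + B ^ 2 * (2 * V ^ 2 + 2) * (64 * V) with hC1
  have hC10 : 0 ≤ C1 := pp
  set C2 := D * (A * V + C1) * (16 / 7) ^ 3 with hC2
  have hC20 : 0 ≤ C2 := pp
  set C3 := D * (V + C2 + C1) * (16 / 5) ^ 3 with hC3
  have hC30 : 0 ≤ C3 := pp
  refine ⟨A * C3 + T * (4 / 3) ^ 3 + 1, pp, ?_⟩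
  intro v P H hv g0 F ψ Pψ Gψ hψ c p M hM s hs hs1 hF1 he
  have hF : 0 ≤ F := (hψ.nn 0 (by simp)).trans (hψ.le 0 (by simp))
  have hw := hv.c2.sub (qd_C2 univ c p hM.sym)
  have hHe : ∀ x, Ell μ 2 (H x) := fun x => (hv.ell x).mono le_rfl nm
  have cD : Continuous fun x => ‖H x - M‖ := (hv.cont.sub continuous_const).norm
  have cl : Continuous fun x => |ldet (H x) - ldet M| ^ 2 := ((hv.ld hμ).sub continuous_const).abs.pow 2
  have cg : Continuous fun x => |ldet (H x) - g0| := ((hv.ld hμ).sub continuous_const).abs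
  have j2 := J2 hμ hv hψ
  rw [← hV, ← hT] at j2
  set k := |g0 - ldet M| with hk
  have hkb : k ≤ B * (s ^ 2 * V + F) := (j3 v P H hv g0 F ψ Pψ Gψ hψ c p M hM).trans
    (mll (add_le_add (set_le hw.cw.abs he) le_rfl) hB.le)
  obtain ⟨hk1, hk2⟩ := ay2 hs hs1 hF hF1 hB.le hV0.le hkb (abs_nonneg _)
  set X := s ^ 3 + F with hX
  have hX0 : 0 ≤ X := pp
  set J := ∫ x in Bz 1, ct 1 x * |ldet (H x) - ldet M| ^ 2 with hJ
  have hJb : J ≤ C1 * X := by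
    have h1 : J ≤ ∫ x in Bz 1, (2 * (A + B * (V + 1)) * (ct 1 x * |ldet (H x) - g0|) + k ^ 2 * ct 1 x) := by
      refine int_mono ((ct_cont 1).mul cl) ((continuous_const.mul ((ct_cont 1).mul cg)).add (continuous_const.mul (ct_cont 1))) fun x _ => ?_
      have h2 : |ldet (H x) - ldet M| ≤ |ldet (H x) - g0| + k := abs_sub_le _ _ _
      have h3 : 0 ≤ B * (V + 1) := pp
      have := mll (ay1 h2 ((pt _ _ (hHe x) hM).2.2.2.1.trans (by linarith : A ≤ A + B * (V + 1)))
        (by linarith) (abs_nonneg _) (abs_nonneg _) (abs_nonneg _)) (ct_nn 1 x)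
      linarith
    rw [int_add (f := fun x => 2 * (A + B * (V + 1)) * (ct 1 x * |ldet (H x) - g0|)) (g := fun x => k ^ 2 * ct 1 x)
      (continuous_const.mul ((ct_cont 1).mul cg)) (continuous_const.mul (ct_cont 1)), integral_const_mul, integral_const_mul] at h1
    have h4 : ∫ x in Bz 1, ct 1 x ≤ 64 * V := set_le (ct_cont 1) fun x _ => (ct_bd nm nm x).1
    have h5 := mul_le_mul hk2 h4 (integral_nonneg fun x => ct_nn 1 x) pp
    have h6 := mll (j2.trans (mll (by rw [hX]; linarith [pow_nonneg hs 3] : F ≤ X) hT0))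
      (show 0 ≤ 2 * (A + B * (V + 1)) from pp)
    linarith
  have e1 := en v P H hv c p M hM _ 1 zero_le_one le_rfl he
  have e2 := en v P H hv c p M hM _ (3/4) nm nm fun x hx => he x (cbs nm hx)
  have s1 : ∫ x in Bz 1, ‖H x - M‖ ≤ A * V := set_le cD fun x _ => (pt _ _ (hHe x) hM).2.2.2.2
  set I2 := ∫ x in Bz (3/4), ‖H x - M‖ ^ 2 with hI2
  have cl1 := cut_lo (r := 3/4) (R := 1) nm nm (cD.pow 2) fun x => sq_nonneg _
  have cl2 := cut_lo (n := n) (r := 1/2) (R := 3/4) nm nm (cD.pow 2) fun x => sq_nonneg _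
  have cl3 := cut_lo (n := n) (r := 1/2) (R := 1) nm nm cg fun x => abs_nonneg _
  have s32 : s ^ 3 ≤ s ^ 2 := pow_le_pow_of_le_one hs hs1 nm
  have hsF : s * F ≤ F := mul_le_of_le_one_left hF hs1
  have hI2b : I2 ≤ C2 * (s ^ 2 + F) := by
    have h1 : D * (s ^ 2 * (∫ x in Bz 1, ‖H x - M‖) + J) ≤ D * ((A * V + C1) * (s ^ 2 + F)) := by
      refine mll ?_ hD.le
      have h2 := mll s1 (sq_nonneg s)
      have h3 := mll (by rw [hX]; linarith : X ≤ s ^ 2 + F) hC10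
      have h4 : 0 ≤ A * V * F := pp
      linarith
    norm_num at cl1
    rw [hC2]; linarith
  have hI1 : s ^ 2 * ∫ x in Bz (3/4), ‖H x - M‖ ≤ (V + C2) * X := by
    have h1 : ∫ x in Bz (3/4), s ^ 2 * ‖H x - M‖ ≤ ∫ x in Bz (3/4), (s ^ 3 + s * ‖H x - M‖ ^ 2) := by
      refine int_mono (continuous_const.mul cD) (continuous_const.add (continuous_const.mul (cD.pow 2))) fun x _ => ?_
      exact ay3 hs _
    rw [int_add (f := fun _ => s ^ 3) (g := fun x => s * ‖H x - M‖ ^ 2) continuous_const (continuous_const.mul (cD.pow 2)), integral_const_mul,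
      integral_const_mul, setIntegral_const, smul_eq_mul] at h1
    have h2 : volume.real (Bz (3/4)) ≤ V := measureReal_mono (cbs nm)
      (icb _ _).measure_lt_top.ne
    have h3 := mlr h2 (pow_nonneg hs 3)
    have h4 := mll hI2b hs
    have h5 := mll hsF hC20
    have h6 : 0 ≤ V * F := pp
    rw [← hI2] at h1
    rw [hX]; linarith
  have hfin : ∫ x in Bz (1/2), ‖H x - M‖ ^ 2 ≤ C3 * X := by
    have h1 := mll (add_le_add hI1 hJb) hD.le
    norm_num at cl2
    rw [hC3]; linarith
  have h1 : ∫ x in Bz (1/2), |tr (inv M * (H x - M)) - (g0 - ldet M)| ≤ ∫ x in Bz (1/2),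
      (A * ‖H x - M‖ ^ 2 + |ldet (H x) - g0|) := by
    refine int_mono ((trc continuous_const hw.cG).sub continuous_const).abs ((continuous_const.mul (cD.pow 2)).add cg) fun x _ => ?_
    have h2 := F2' hμ (hHe x) hM nm
    have h3 := (pt _ _ (hHe x) hM).1
    rw [abs_le]
    have h4 := neg_abs_le (ldet (H x) - g0)
    have h5 := le_abs_self (ldet (H x) - g0)
    have h6 : 0 ≤ A * ‖H x - M‖ ^ 2 := pp
    constructor <;> linarith
  rw [int_add (f := fun x => A * ‖H x - M‖ ^ 2) (continuous_const.mul (cD.pow 2)) cg, integral_const_mul] at h1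
  have h2 := mll hfin hA0
  norm_num at cl3
  have h3 : 0 ≤ T * s ^ 3 := pp
  have h4 : T * F ≤ T * X := mll (by rw [hX]; linarith [pow_nonneg hs 3]) hT0
  linarith
def Sy (M : L n) : Prop := ∀ x y, ⟪M x, y⟫ = ⟪x, M y⟫
def rs (v : E n → ℝ) (z : E n) (r : ℝ) (x : E n) : ℝ := (r ^ 2)⁻¹ * v (z + r • x)
def Ap (v : E n → ℝ) (M : L n) (e : ℝ) : Prop := Sy M ∧ ∃ c p, ∀ x ∈ Bz 1, |v x - qd c p M x| ≤ e
theorem rs_rs (v : E n → ℝ) (z : E n) (r t : ℝ) : rs (rs v z r) 0 t = rs v z (r * t) := by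
  funext x; simp only [rs, zero_add, smul_smul, mul_pow, mul_inv]; ring
theorem C2.rs {P G} (h : C2 univ v P G) (z : E n) (hr : 0 < r) :
    C2 univ (rs v z r) (fun x => r⁻¹ • P (z + r • x)) (fun x => G (z + r • x)) := by
  have h1 := (h.aff z r).smul (r ^ 2)⁻¹
  have e1 : (r ^ 2)⁻¹ * r = r⁻¹ := by field_simp
  simp only [smul_smul, inv_mul_cancel₀ (pow_pos hr 2).ne', one_smul, e1] at h1
  exact h1
theorem Sol.rs {P H} (h : Sol l v P H) (z : E n) (hr : 0 < r) :
    Sol l (rs v z r) (fun x => r⁻¹ • P (z + r • x)) (fun x => H (z + r • x)) := ⟨h.c2.rs z hr, fun _ => h.ell _⟩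
theorem qd_sh (hM : Sy M) (c : ℝ) (p z x : E n) (r : ℝ) (hr : 0 < r) :
    (r ^ 2)⁻¹ * qd c p M (z + r • x) = qd ((r ^ 2)⁻¹ * qd c p M z) (r⁻¹ • (p + M z)) M x := by
  have h := hM x z
  simp only [qd, map_add, map_smul, inner_add_left, inner_add_right, isl, inner_smul_right, h, real_inner_comm x (M z)]
  field_simp; ring
theorem ApS (hM : Sy M) {c : ℝ} {p : E n} (hr : 0 < r)
    (h : ∀ x ∈ closedBall z r, |v x - qd c p M x| ≤ e) : Ap (rs v z r) M ((r ^ 2)⁻¹ * e) := by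
  refine ⟨hM, (r ^ 2)⁻¹ * qd c p M z, r⁻¹ • (p + M z), fun x hx => ?_⟩
  rw [← qd_sh hM c p z x r hr, rs, ← mul_sub, abs_mul, abs_of_pos (pp : 0 < (r ^ 2)⁻¹)]
  refine mll (h _ ?_) pp
  rw [mcz] at hx
  rw [mem_closedBall, dist_eq_norm, add_sub_cancel_left, norm_smul, rnn hr.le]
  nlinarith
theorem Ap.sub (h : Ap v M e) (hr : 0 < r) (hz : ‖z‖ + r ≤ 1) : Ap (rs v z r) M ((r ^ 2)⁻¹ * e) := by
  obtain ⟨hM, c, p, h⟩ := h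
  exact ApS hM hr fun x hx => h x (closedBall_subset_closedBall' (by rw [dist_zero_right]; linarith) hx)
theorem SDlo {P G} (hw : C2 univ w P G) (hN : Sy N) (hG : ∀ x ∈ Bz 1, ∀ h, ⟪N h, h⟫ ≤ ⟪G x h, h⟫)
    (h : Ap w M e) (y : E n) : ⟪N y, y⟫ ≤ ⟪M y, y⟫ + 4 * e * ‖y‖ ^ 2 := by
  obtain ⟨_, c, p, h⟩ := h
  have key : ∀ y : E n, ‖y‖ = 1 → ⟪N y, y⟫ ≤ ⟪M y, y⟫ + 4 * e := by
    intro y hy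
    have h2 := hw.sub (qd_C2 univ 0 0 hN)
    have ha : ∀ y : E n, ‖y‖ = 1 → ∀ t ∈ Icc (0:ℝ) 1, 0 ≤ ⟪(G (0 + t • y) - N) y, y⟫ := fun y hy t ht => by
      rw [sub_apply, inner_sub_left]
      have := hG (0 + t • y) (by simpa [norm_smul, hy, abs_of_nonneg ht.1] using ht.2) y
      linarith
    have t1 := tay h2 (ha y hy)
    have t2 := tay h2 (ha (-y) (by rwa [norm_neg]))
    have a0 := abs_le.1 (h 0 (by simp))
    have a1 := abs_le.1 (h y (by simp [hy]))
    have a2 := abs_le.1 (h (-y) (by simp [hy]))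
    simp only [qd, zero_add, map_zero, map_neg, inner_neg_left, inner_neg_right, inner_zero_left, inner_zero_right, neg_neg] at *
    linarith [a0.1, a0.2, a1.1, a1.2, a2.1, a2.2]
  rcases eq_or_ne y 0 with rfl | hy
  · simp
  have hy' := norm_pos_iff.2 hy
  have k := key (‖y‖⁻¹ • y) (by rw [norm_smul, norm_inv, norm_norm, inv_mul_cancel₀ hy'.ne'])
  simp only [map_smul, isl, inner_smul_right] at k
  have := mll k (sq_nonneg ‖y‖)
  field_simp at this
  linarith
theorem Sy.smul1 (k : ℝ) : Sy (k • (1 : L n)) := fun x y => by simp [isl, inner_smul_right]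
theorem Sy.add (h : Sy M) (h' : Sy N) : Sy (M + N) := fun x y => by
  rw [add_apply, add_apply, inner_add_left, inner_add_right, h, h']
theorem Sy.sm (h : Sy M) (k : ℝ) : Sy (k • M) := fun x y => by
  rw [smul_apply, smul_apply, isl, inner_smul_right, h]
theorem Sy.sub (h : Sy M) (h' : Sy N) : Sy (M - N) := fun x y => by
  rw [sub_apply, sub_apply, inner_sub_left, inner_sub_right, h, h']
theorem Ap.neg (h : Ap v M e) : Ap (fun x => (-1) * v x) ((-1 : ℝ) • M) e := by
  obtain ⟨hM, c, p, h⟩ := h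
  refine ⟨hM.sm _, -c, -p, fun x hx => ?_⟩
  have : (-1) * v x - qd (-c) (-p) ((-1 : ℝ) • M) x = -(v x - qd c p M x) := by
    simp only [qd, smul_apply, isl, inner_neg_left]; simp; ring
  rw [this, abs_neg]; exact h x hx
theorem SD {P G} (hw : C2 univ w P G) (hN : Sy N) (hη : 0 ≤ η) (he : 0 ≤ e)
    (hG : ∀ x ∈ Bz 1, ‖G x - N‖ ≤ η) (h : Ap w M e) : ‖M - N‖ ≤ 4 * e + η := by
  have ha : ∀ x ∈ Bz 1, ∀ h, |⟪(G x - N) h, h⟫| ≤ η * ‖h‖ ^ 2 := fun x hx h =>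
    (inner_le_mn (hG x hx) _ _).trans_eq (by ring)
  refine norm_le_of_quad pp (h.1.sub hN) fun y => ?_
  have h1 := SDlo hw (hN.sub (Sy.smul1 η)) (fun x hx h => by
    have := (abs_le.1 (ha x hx h)).1
    simp only [sub_apply, smul_apply, inner_sub_left, isl, one_apply_eq_self, rsq] at this ⊢
    linarith) h y
  have h2 := SDlo (hw.smul (-1)) ((hN.add (Sy.smul1 η)).sm (-1)) (fun x hx h => by
    have := (abs_le.1 (ha x hx h)).2
    simp only [sub_apply, add_apply, smul_apply, inner_sub_left, inner_add_left, isl, one_apply_eq_self, rsq] at this ⊢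
    linarith) h.neg y
  simp only [sub_apply, add_apply, smul_apply, inner_sub_left, inner_add_left, isl, one_apply_eq_self, rsq] at h1 h2 ⊢
  rw [abs_le]
  constructor <;> linarith
theorem Ap.nn (h : Ap v M e) : 0 ≤ e := by
  obtain ⟨_, c, p, h⟩ := h; exact (abs_nonneg _).trans (h 0 (by simp))
theorem Ap.diff {M' : L n} (h : Ap v M e) (h' : Ap v M' e') : ‖M - M'‖ ≤ 4 * (e + e') := by
  have n1 := h.nn
  have n2 := h'.nn
  obtain ⟨hM, c, p, h⟩ := h
  obtain ⟨hM', c', p', h'⟩ := h'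
  have := SD (qd_C2 univ 0 0 hM') (M := M) hM' le_rfl (by linarith : 0 ≤ e + e') (fun x _ => by simp) ⟨hM, c - c', p - p', fun x hx => by
    have e1 : qd 0 0 M' x - qd (c - c') (p - p') M x = (v x - qd c p M x) - (v x - qd c' p' M' x) := by
      simp only [qd, inner_sub_left, inner_zero_left]; ring
    rw [e1]
    exact (abs_sub _ _).trans (add_le_add (h x hx) (h' x hx))⟩
  linarith
theorem Ap.ell {P H} (hv : Sol l v P H) (h : Ap v M e) (he : e ≤ l / 8) (hl : l ≤ 1) : Ell (l/2) (3/2) M := by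
  refine ⟨h.1, fun y => ?_, fun y => ?_⟩
  · have h1 := SDlo hv.c2 (Sy.smul1 l) (fun x hx h => by simpa [isl] using (hv.ell x).lo h) h y
    simp only [smul_apply, isl, one_apply_eq_self, rsq] at h1
    nlinarith [sq_nonneg ‖y‖]
  · have h1 := SDlo (hv.c2.smul (-1)) (Sy.smul1 (-1)) (fun x hx h => by simpa [isl] using (hv.ell x).hi h) h.neg y
    simp only [smul_apply, isl, one_apply_eq_self, rsq] at h1
    nlinarith [sq_nonneg ‖y‖]
theorem ar1 {A : ℝ} (hβ : β < 1) (hA : 0 < A) : ∃ κ : ℝ, 0 < κ ∧ κ ≤ 1/8 ∧ A * κ ≤ κ ^ β / 2 := by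
  have hb : 0 < 1 - β := by linarith
  set t : ℝ := ((2 * A)⁻¹) ^ (1 / (1 - β)) with ht
  have ht0 : 0 < t := pp
  have hk : 0 < min (1/8) t := lt_min nm ht0
  refine ⟨min (1/8) t, hk, min_le_left _ _, ?_⟩
  set κ := min (1/8) t
  have h1 : κ ^ (1 - β) ≤ (2 * A)⁻¹ := by
    refine (Real.rpow_le_rpow hk.le (min_le_right _ _) hb.le).trans_eq ?_
    rw [ht, ← Real.rpow_mul pp, one_div_mul_cancel hb.ne', Real.rpow_one]
  have h2 : κ = κ ^ (1 - β) * κ ^ β := by rw [← Real.rpow_add hk]; simp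
  have h3 := mlr h1 (Real.rpow_nonneg hk.le β)
  rw [← h2] at h3
  calc A * κ ≤ A * ((2 * A)⁻¹ * κ ^ β) := mll h3 hA.le
    _ = _ := by field_simp
theorem int_rs (hr : 0 < r) : ∫ x in Bz 1, f (r • x) = (r ^ n)⁻¹ * ∫ x in Bz r, f x := by
  have := Measure.setIntegral_comp_smul_of_pos (volume : Measure (E n)) f (closedBall 0 1) hr
  rw [this, _root_.smul_closedBall _ _ zero_le_one, smul_zero, mul_one, finrank_euclideanSpace_fin, rnn hr.le, smul_eq_mul]
theorem Maj.rs {g0 F ψ Pψ Gψ} (h : Maj g g0 F ψ Pψ Gψ) (hr : 0 < r) (hr1 : r ≤ 1) :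
    Maj (fun x => g (0 + r • x)) g0 ((r ^ 2)⁻¹ * F) (rs ψ 0 r) (fun x => r⁻¹ • Pψ (0 + r • x)) (fun x => Gψ (0 + r • x)) := by
  have hm : ∀ x ∈ Bz 1, 0 + r • x ∈ Bz 1 := fun x hx => by
    rw [mcz] at hx ⊢
    rw [zero_add, norm_smul, rnn hr.le]; nlinarith [norm_nonneg x]
  have := inv_nonneg.2 (sq_nonneg r)
  exact ⟨h.c2.rs 0 hr, fun x => h.psd _, fun x hx => h.dom _ (hm x hx), fun x hx => mul_nonneg this (h.nn _ (hm x hx)),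
    fun x hx => mll (h.le _ (hm x hx)) this⟩
theorem ay4 {A N : ℝ} (hθ : θ = 2 * κ) (hκ : 0 < κ) (hN : 0 < N)
    (h1 : 8 * B * A * κ ≤ b / 2) (h2 : 4 * B * N⁻¹ * (θ^2)⁻¹ * (A * D) * s ≤ b / 2) :
    ((1/2 : ℝ) ^ 2)⁻¹ * (B * ((θ^2)⁻¹ * (N⁻¹ * (A * (D * (s ^ 3 + F)) + A * (N * θ ^ 3) * s ^ 2)) + (θ^2)⁻¹ * F)) ≤
      b * s ^ 2 + (4 * B * N⁻¹ * (θ^2)⁻¹ * (A * D) + 4 * B * (θ^2)⁻¹) * F := by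
  have e : ((1/2 : ℝ) ^ 2)⁻¹ * (B * ((θ^2)⁻¹ * (N⁻¹ * (A * (D * (s ^ 3 + F)) + A * (N * θ ^ 3) * s ^ 2)) + (θ^2)⁻¹ * F)) =
     (8 * B * A * κ) * s ^ 2 + (4 * B * N⁻¹ * (θ^2)⁻¹ * (A * D) * s) * s ^ 2 + (4 * B * N⁻¹ * (θ^2)⁻¹ * (A * D) + 4 * B * (θ^2)⁻¹) * F := by
    rw [hθ]; field_simp; ring
  rw [e]
  nlinarith [sq_nonneg s]
theorem DEC (hn : 1 ≤ n) (hl : 0 < l) (hl1 : l ≤ 1) (hβ : β < 1) : ∃ κ ε C : ℝ, 0 < κ ∧ κ ≤ 1/8 ∧ 0 < ε ∧ 0 < C ∧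
    ∀ (v : E n → ℝ) (P : E n → E n) (H : E n → L n) (_ : Sol l v P H)
    (g0 F : ℝ) (ψ : E n → ℝ) (Pψ : E n → E n) (Gψ : E n → L n) (_ : Maj (fun x => ldet (H x)) g0 F ψ Pψ Gψ) (M : L n) (e : ℝ)
    (_ : Ap v M e) (_ : e ≤ ε), ∃ M', Ap (rs v 0 κ) M' (κ ^ β * e + C * F) := by
  have hμ : 0 < l / 4 := by linarith
  have hμ1 : l / 4 ≤ 1 := by linarith
  obtain ⟨A, hA, ha⟩ := HA (n := n) hn hμ hμ1
  obtain ⟨D, hD, j5⟩ := J5 (n := n) hμ hμ1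
  obtain ⟨B, hB, sup⟩ := L1SUP (n := n) hn hμ hμ1
  obtain ⟨κ, hκ, hκ1, hk⟩ := ar1 (A := 8 * B * A) hβ pp
  set θ := 2 * κ with hθ
  have hθ0 : 0 < θ := pp
  set T := 4 * B * (θ ^ n)⁻¹ * (θ^2)⁻¹ * (A * D) with hT
  have hT0 : 0 < T := pp
  set b := κ ^ β with hb
  have hb0 : 0 < b := pp
  set ε := min (min (l / 8) (l / (4 * A))) (min 1 ((b / (2 * T)) ^ 2)) with hε
  refine ⟨κ, ε, T + 4 * B * (θ^2)⁻¹ + (κ ^ 2)⁻¹ * ε, hκ, hκ1, pp, pp, ?_⟩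
  intro v P H hv g0 F ψ Pψ Gψ hψ M e hap hee
  have he := hap.nn
  have hF : 0 ≤ F := (hψ.nn 0 (by simp)).trans (hψ.le 0 (by simp))
  have e1 : e ≤ l / 8 := hee.trans ((min_le_left _ _).trans (min_le_left _ _))
  have e2 : e ≤ l / (4 * A) := hee.trans ((min_le_left _ _).trans (min_le_right _ _))
  have e3 : e ≤ 1 := hee.trans ((min_le_right _ _).trans (min_le_left _ _))
  have e4 : e ≤ (b / (2 * T)) ^ 2 := hee.trans ((min_le_right _ _).trans (min_le_right _ _))
  rcases lt_or_ge 1 F with hF1 | hF1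
  · refine ⟨M, hap.1, ?_⟩
    obtain ⟨-, c, p, h⟩ := hap.sub hκ (z := 0) (by simp; linarith)
    refine ⟨c, p, fun x hx => (h x hx).trans ?_⟩
    have h1 : (κ ^ 2)⁻¹ * e ≤ (κ ^ 2)⁻¹ * ε := mll hee pp
    have h2 : 0 ≤ b * e := pp
    have h3 : 0 ≤ (T + 4 * B * (θ^2)⁻¹) * F := pp
    have h4 : (κ ^ 2)⁻¹ * ε * 1 ≤ (κ ^ 2)⁻¹ * ε * F := mll hF1.le pp
    linarith
  have hMe := hap.ell hv e1 hl1
  have hMu : Ell (l/4) 2 M := hMe.mono (by linarith) nm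
  have hvu : Sol (l/4) v P H := ⟨hv.c2, fun x => (hv.ell x).mono (by linarith) le_rfl⟩
  obtain ⟨hMs, c, p, hvq⟩ := hap
  obtain ⟨c0, p0, M0, hM0, hh⟩ := ha M hMu _ _ _ (hv.c2.sub (qd_C2 univ c p hMs)) (g0 - ldet M)
  obtain ⟨hM0n, hint⟩ := hh e hvq
  have hint := hint θ hθ0 (by linarith)
  set s := √e with hs
  have hse : s ^ 2 = e := Real.sq_sqrt he
  have hs0 : 0 ≤ s := Real.sqrt_nonneg e
  have hs1 : s ≤ 1 := Real.sqrt_le_one.2 e3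
  have hsb : s ≤ b / (2 * T) := Real.sqrt_le_iff.2 ⟨pp, e4⟩
  have hj := j5 v P H hvu g0 F ψ Pψ Gψ hψ c p M hMu s hs0 hs1 hF1 (by rwa [hse])
  have hM0q : ∀ x, |⟪M0 x, x⟫| ≤ l / 4 * ‖x‖ ^ 2 := fun x =>
    (inner_le_mn (hM0n.trans (by rw [le_div_iff₀ pp] at e2; linarith : A * e ≤ l / 4)) x x).trans_eq (by ring)
  have hM' : Ell (l/4) 2 (M + M0) := by
    refine ⟨Sy.add hMs hM0, fun x => ?_, fun x => ?_⟩ <;> rw [add_apply, inner_add_left]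
    · have := (abs_le.1 (hM0q x)).1; have := hMe.lo x; linarith
    · nlinarith only [(abs_le.1 (hM0q x)).2, hMe.hi x, hl1, sq_nonneg ‖x‖]
  have hsup := sup _ _ _ (hvu.rs 0 hθ0) g0 _ _ _ _ (hψ.rs hθ0 (by linarith))
    ((θ^2)⁻¹ * qd (c + c0) (p + p0) (M + M0) 0) (θ⁻¹ • ((p + p0) + (M + M0) 0)) _ hM'
  have e5 : ∀ x, qd (c + c0) (p + p0) (M + M0) x = qd c p M x + qd c0 p0 M0 x := fun x => by
    simp only [qd, add_apply, inner_add_left]; ring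
  have e6 : ∀ x : E n, rs v 0 θ x - qd ((θ^2)⁻¹ * qd (c + c0) (p + p0) (M + M0) 0) (θ⁻¹ • ((p + p0) + (M + M0) 0)) (M + M0) x
      = (θ^2)⁻¹ * (v (θ • x) - qd c p M (θ • x) - qd c0 p0 M0 (θ • x)) := fun x => by
    rw [← qd_sh hM'.sym _ _ _ _ _ hθ0, rs, e5, zero_add]; ring
  have e7 : ∫ x in Bz 1, |rs v 0 θ x - qd ((θ^2)⁻¹ * qd (c + c0) (p + p0) (M + M0) 0) (θ⁻¹ • ((p + p0) + (M + M0) 0)) (M + M0) x|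
      = (θ^2)⁻¹ * ((θ ^ n)⁻¹ * ∫ x in Bz θ, |v x - qd c p M x - qd c0 p0 M0 x|) := by
    rw [← int_rs hθ0 (f := fun x => |v x - qd c p M x - qd c0 p0 M0 x|), ← integral_const_mul]
    congr 1; funext x; rw [e6, abs_mul, abs_of_pos (pp : 0 < (θ^2)⁻¹)]
  rw [e7] at hsup
  have ap := ApS hM'.sym (nm : (0:ℝ) < 1/2) hsup
  rw [rs_rs, show θ * (1/2) = κ by rw [hθ]; ring] at ap
  obtain ⟨hs', c', p', ap⟩ := ap
  refine ⟨M + M0, hs', c', p', fun x hx => (ap x hx).trans ?_⟩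
  have a1 : (∫ x in Bz θ, |v x - qd c p M x - qd c0 p0 M0 x|) ≤ A * (D * (s ^ 3 + F)) + A * (θ ^ n * θ ^ 3) * s ^ 2 := by
    rw [hse, ← pow_add]; exact hint.trans (add_le_add (mll hj hA.le) le_rfl)
  have a2 := ay4 (F := F) (N := θ ^ n) (D := D) hθ hκ pp hk (by
    have := mll hsb hT0.le
    rw [show T * (b / (2 * T)) = b / 2 by field_simp] at this; exact this)
  rw [hse, ← hT] at a2
  have a3 : 0 ≤ (κ ^ 2)⁻¹ * ε * F := pp
  refine le_trans ?_ (a2.trans (by linarith))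
  rw [hse] at a1
  gcongr
def LL (f : E n → ℝ) : Prop := f 0 = 0 ∧ ∀ x y, |f x - f y| ≤ (‖x‖ + ‖y‖) * ‖x - y‖
theorem LL.rs (h : LL f) (hr : 0 < r) : LL (rs f 0 r) := by
  refine ⟨by simp [MAx.rs, h.1], fun x y => ?_⟩
  have := h.2 (0 + r • x) (0 + r • y)
  rw [MAx.rs, MAx.rs, ← mul_sub, abs_mul, abs_of_pos (pp : 0 < (r ^ 2)⁻¹), inv_mul_le_iff₀ pp]
  refine this.trans_eq ?_
  rw [zero_add, zero_add, ← smul_sub, norm_smul, norm_smul, norm_smul, rnn hr.le]; ring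
theorem LL.cont (h : LL f) : Continuous f := by
  refine continuous_iff_continuousAt.2 fun x => ?_
  rw [ContinuousAt, tendsto_iff_dist_tendsto_zero]
  refine squeeze_zero (fun _ => dist_nonneg) (fun y => h.2 y x) ?_
  have : Continuous fun y : E n => (‖y‖ + ‖x‖) * ‖y - x‖ := by fun_prop
  simpa using this.tendsto x
theorem UL0 {ι : Type*} (U : Ultrafilter ι) {f : ι → E n → ℝ} (hf : ∀ᶠ i in (U : Filter ι), LL (f i)) : ∃ V, LL V ∧ ∀ y, Tendsto (fun i => f i y) U (𝓝 (V y)) := by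
  have : ∀ y, ∃ a, Tendsto (fun i => f i y) U (𝓝 a) := fun y => by
    have h1 : ∀ᶠ i in (U : Filter ι), f i y ∈ Icc (-(‖y‖ * ‖y‖)) (‖y‖ * ‖y‖) := hf.mono fun i hi => by
      have := hi.2 y 0; rw [hi.1] at this; simp at this; exact abs_le.1 (by simpa using this)
    obtain ⟨a, -, ha⟩ := isCompact_Icc.ultrafilter_le_nhds' (U.map fun i => f i y) h1
    exact ⟨a, ha⟩
  choose V hV using this
  refine ⟨V, ⟨?_, fun x y => ?_⟩, hV⟩
  · exact tendsto_nhds_unique (hV 0) (tendsto_const_nhds.congr' (hf.mono fun i hi => hi.1.symm))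
  · exact le_of_tendsto ((hV x).sub (hV y)).abs (hf.mono fun i hi => hi.2 x y)
theorem UNI {ι : Type*} {l : Filter ι} {f : ι → E n → ℝ} (hf : ∀ᶠ i in l, LL (f i)) (hV : LL V)
    (h : ∀ y, Tendsto (fun i => f i y) l (𝓝 (V y))) (hρ : 0 < ρ) (hε : 0 < ε) :
    ∀ᶠ i in l, ∀ y ∈ Bz ρ, |f i y - V y| ≤ ε := by
  have hd : 0 < ε / (6 * ρ) := pp
  obtain ⟨t, hts, htf, hc⟩ := (icb (0 : E n) ρ).finite_cover_balls hd
  have h1 : ∀ᶠ i in l, ∀ z ∈ t, |f i z - V z| ≤ ε / 3 := (eventually_all_finite htf).2 fun z _ => by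
    have := (h z).eventually (Metric.closedBall_mem_nhds _ (pp : 0 < ε / 3))
    exact this.mono fun i hi => by simpa [Real.dist_eq] using hi
  filter_upwards [hf, h1] with i hi hit y hy
  obtain ⟨z, hz, hyz⟩ := mem_iUnion₂.1 (hc hy)
  have hz' := mcz.1 (hts hz)
  have hy' := mcz.1 hy
  rw [mem_ball, dist_eq_norm] at hyz
  have b : ∀ g : E n → ℝ, LL g → |g y - g z| ≤ ε / 3 := fun g hg => by
    refine (hg.2 y z).trans ((mul_le_mul (by linarith : ‖y‖ + ‖z‖ ≤ 2 * ρ) hyz.le (norm_nonneg _) pp).trans_eq ?_)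
    field_simp; norm_num
  have b1 := abs_le.1 (b _ hi); have b2 := abs_le.1 (b _ hV); have b3 := abs_le.1 (hit z hz)
  rw [abs_le]; constructor <;> linarith [b1.1, b1.2, b2.1, b2.2, b3.1, b3.2]
theorem Sol.P_lip {P H} (hl : 0 ≤ l) (h : Sol l v P H) (x y : E n) : ‖P x - P y‖ ≤ ‖x - y‖ := by
  have := convex_univ.norm_image_sub_le_of_norm_hasFDerivWithin_le (f := P) (C := 1) (fun x hx => (h.c2.d2 x hx).hasFDerivWithinAt)
    (fun x _ => (h.ell x).norm_le hl zero_le_one) (mem_univ y) (mem_univ x)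
  rwa [one_mul] at this
theorem Sol.LL {P H} (hl : 0 ≤ l) (h : Sol l v P H) (h0 : v 0 = 0) (hp : P 0 = 0) : LL v := by
  refine ⟨h0, fun x y => ?_⟩
  refine (convex_closedBall (0 : E n) (‖x‖ + ‖y‖)).norm_image_sub_le_of_norm_hasFDerivWithin_le (f := v) (fun x _ => (h.c2.d1 x trivial).hasFDerivWithinAt)
    (fun z hz => ?_) (x := y) (y := x) (by simp) (by simp)
  refine ContinuousLinearMap.opNorm_le_bound _ pp fun t => ?_
  rw [gr_apply]
  refine (norm_inner_le_norm _ _).trans (mlr ?_ (norm_nonneg t))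
  have := h.P_lip hl z 0
  rw [hp, sub_zero, sub_zero] at this
  exact this.trans (mcz.1 hz)
structure FF (H : E n → L n) (g0 K : ℝ) (ψ : E n → ℝ) (Pψ : E n → E n) (Gψ : E n → L n) : Prop where
  c2 : C2 univ ψ Pψ Gψ
  psd : ∀ x, Psd (Gψ x)
  dom : ∀ x, |ldet (H x) - g0| ≤ tr (Gψ x)
  nn : ∀ x, 0 ≤ ψ x
  le : ∀ x, ψ x ≤ K * (1 + ‖x‖)
theorem SUPER (hl : 0 < l) {Z B D : L n} (hX : Ell l 1 X) (hY : Ell l 1 Y) (hZ : Ell l 1 Z) (hA : Psd A) (hB : Psd B) (hD : Psd D) 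
    (a : |ldet Y - g0| ≤ tr A) (b : |ldet Z - g0| ≤ tr B) (c : |ldet X - g0| ≤ tr D) :
    0 ≤ tr (cof X * (Y + Z - (2:ℝ) • X + (A + B + (2:ℝ) • D))) := by
  have f1 := F2' hl hY hX one_pos
  have f2 := F2' hl hZ hX one_pos
  have hi := hX.inv hl
  rw [inv_one] at hi
  have p1 := tr_mul_psd hi hA; have p2 := tr_mul_psd hi hB; have p3 := tr_mul_psd hi hD
  have d0 := hX.det_pos hl
  rw [cof, smul_mulL, map_smul, smul_eq_mul]
  refine mul_nonneg d0.le ?_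
  simp only [mul_subL, mul_add, mul_smulL, map_add, map_sub, map_smul, smul_eq_mul] at *
  have := abs_le.1 a; have := abs_le.1 b; have := abs_le.1 c
  linarith [(abs_le.1 a).1, (abs_le.1 b).1, (abs_le.1 c).2]
def dl (h : E n) (V : E n → ℝ) (x : E n) : ℝ := V (x + h) + V (x - h) - 2 * V x
theorem dl_cont (h : E n) (hV : Continuous V) : Continuous (dl h V) := by unfold dl; fun_prop
theorem Sol.dl_bd {P H} (hl : 0 ≤ l) (hv : Sol l v P H) (h x : E n) : 0 ≤ dl h v x ∧ dl h v x ≤ ‖h‖ ^ 2 := by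
  have e : ∀ (w : E n → ℝ) P G, C2 univ w P G → (∀ y, 0 ≤ ⟪G y h, h⟫) → 0 ≤ w (x + h) + w (x - h) - 2 * w x := by
    intro w P G hw hG
    have t1 := tay hw (x := x) (h := h) fun t _ => hG _
    have t2 := tay hw (x := x) (h := -h) fun t _ => by simpa using hG (x + t • -h)
    rw [← sub_eq_add_neg, inner_neg_right] at t2
    linarith
  refine ⟨e _ _ _ hv.c2 fun y => (pp : 0 ≤ l * ‖h‖ ^ 2).trans ((hv.ell y).lo h), ?_⟩
  have := e _ _ _ ((qd_C2 univ 0 0 (Sy.smul1 1)).sub hv.c2) fun y => by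
    have := (hv.ell y).hi h
    simpa [inner_sub_left] using this
  simp only [qd, one_smul, one_apply_eq_self, inner_zero_left, inner_add_left, inner_add_right, inner_sub_left, inner_sub_right, rsq] at this
  rw [dl]; linarith [real_inner_comm x h]
theorem rs_add (v : E n → ℝ) (z h : E n) (y : E n) : rs v (R • (z + h)) (R * t) y = (t ^ 2)⁻¹ * rs v 0 R ((z + t • y) + h) := by
  simp only [rs, zero_add, smul_add, smul_smul, mul_pow, mul_inv]
  rw [add_right_comm]; ring
theorem ay5 {T : ℝ} (hs : 0 < s) {A A' B' D' : ℝ} (ht : 0 < t) (e : T = A + B - 2 * D + (A' + B' + 2 * D')) :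
    s⁻¹ * (m + κ) - s⁻¹ * t ^ 2 * ((t ^ 2)⁻¹ * A + (t ^ 2)⁻¹ * B - 2 * ((t ^ 2)⁻¹ * D) + ((t ^ 2)⁻¹ * A' + (t ^ 2)⁻¹ * B' + 2 * ((t ^ 2)⁻¹ * D'))) = s⁻¹ * (m + κ - T) := by
  rw [e]; field_simp
theorem CL (hn : 1 ≤ n) (hl : 0 < l) (hl1 : l ≤ 1) {P H} (hv : Sol l v P H) (h0 : v 0 = 0) (hp : P 0 = 0) {g0 K ψ Pψ Gψ}
    (hψ : FF H g0 K ψ Pψ Gψ) {U : Filter ℝ} [U.NeBot] (hU : U ≤ atTop) (hV : LL V) (hVt : ∀ y, Tendsto (fun R => rs v 0 R y) U (𝓝 (V y)))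
    (hm : IsLUB (range (dl h V)) m) (hν : 0 < ν) (hs : 0 < s) : ∃ x0 : E n, ∀ ρ : ℝ, 0 < ρ →
    volume {y ∈ Bz 1 | s ≤ m - dl h V (x0 + ρ • y)} < ENNReal.ofReal ν := by
  obtain ⟨c, hc, wh⟩ := WH (n := n) hn (pow_pos hl n) (inv_pos.2 hl).le hν
  have hκ : 0 < c * s / 4 := pp
  set κ := c * s / 4 with hκd
  obtain ⟨_, ⟨x0, rfl⟩, hx0, -⟩ := hm.exists_between (sub_lt_self m hκ)
  refine ⟨x0, fun ρ hρ => ?_⟩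
  by_contra! hvol
  have hbig : ∀ᶠ R in U, (1:ℝ) ≤ R := hU (eventually_ge_atTop 1)
  have hLL : ∀ᶠ R in U, LL (rs v 0 R) := hbig.mono fun R hR => (hv.LL hl.le h0 hp).rs (by linarith)
  set r := ‖x0‖ + 3 * ρ + ‖h‖ with hr
  have hr0 : 0 < r := pp
  have hK : 0 ≤ K := by have := hψ.le 0; have := hψ.nn 0; simp at *; linarith
  have hψb : ∀ᶠ R in U, 4 * (K * (1 + r) * R⁻¹) ≤ κ / 4 := by
    have : Tendsto (fun R : ℝ => 4 * (K * (1 + r) * R⁻¹)) U (𝓝 (4 * (K * (1 + r) * 0))) :=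
      ((tendsto_inv_atTop_zero.mono_left hU).const_mul _).const_mul 4
    rw [mul_zero, mul_zero] at this
    exact this.eventually_le_const pp
  obtain ⟨R, hR1, hRψ, hRu⟩ := (hbig.and (hψb.and (UNI hLL hV hVt hr0 (pp : 0 < κ / 16)))).exists
  have hR : 0 < R := by linarith
  set ψR := rs ψ 0 R with hψR
  have psb : ∀ y ∈ Bz r, 0 ≤ ψR y ∧ 4 * ψR y ≤ κ / 4 := fun y hy => by
    have hi := inv_nonneg.2 (sq_nonneg R)
    refine ⟨mul_nonneg hi (hψ.nn _), le_trans (mll ?_ nm) hRψ⟩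
    refine (mll (hψ.le _) hi).trans ?_
    rw [zero_add, norm_smul, rnn hR.le, inv_mul_le_iff₀ pp]
    have := mcz.1 hy
    rw [show R ^ 2 * (K * (1 + r) * R⁻¹) = K * (R * (1 + r)) by field_simp]
    refine mll ?_ hK
    nlinarith only [this, hR1, hR]
  set T : E n → ℝ := fun z => rs v 0 R (z + h) + rs v 0 R (z + -h) - 2 * rs v 0 R (z + 0) + (ψR (z + h) + ψR (z + -h) + 2 * ψR (z + 0)) with hT
  have hTb : ∀ y ∈ Bz 3, |T (x0 + ρ • y) - dl h V (x0 + ρ • y)| ≤ κ / 2 := fun y hy => by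
    have hy := mcz.1 hy
    have hz : ‖x0 + ρ • y‖ ≤ ‖x0‖ + 3 * ρ := (norm_add_le _ _).trans (by rw [norm_smul, rnn hρ.le]; nlinarith only [hy, hρ])
    have hb : ∀ k : E n, ‖k‖ ≤ ‖h‖ → (x0 + ρ • y) + k ∈ Bz r := fun k hk =>
      mcz.2 ((norm_add_le _ _).trans (add_le_add hz hk))
    have b1 := hb h le_rfl; have b2 := hb (-h) (by simp); have b3 := hb 0 (by simp)
    have u1 := abs_le.1 (hRu _ b1); have u2 := abs_le.1 (hRu _ b2); have u3 := abs_le.1 (hRu _ b3)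
    have v1 := psb _ b1; have v2 := psb _ b2; have v3 := psb _ b3
    simp only [hT, dl, ← sub_eq_add_neg, add_zero] at *
    clear_value r ψR κ
    rw [abs_le]; constructor <;> linarith [u1.1, u1.2, u2.1, u2.2, u3.1, u3.2, v1.1, v1.2, v2.1, v2.2, v3.1, v3.2]
  have hρR : 0 < R * ρ := pp
  set a : E n → E n := fun k => R • (x0 + k) with ha
  have c2 := (qd_C2 univ (s⁻¹ * (m + κ)) 0 (Sy.smul1 0)).sub ((((((hv.c2.rs (a h) hρR).add (hv.c2.rs (a (-h)) hρR)).sub ((hv.c2.rs (a 0) hρR).smul 2)).add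
    (((hψ.c2.rs (a h) hρR).add (hψ.c2.rs (a (-h)) hρR)).add ((hψ.c2.rs (a 0) hρR).smul 2))).smul (s⁻¹ * ρ ^ 2)))
  have hw : ∀ y : E n, qd (s⁻¹ * (m + κ)) 0 ((0:ℝ) • (1 : L n)) y - s⁻¹ * ρ ^ 2 * (rs v (a h) (R * ρ) y + rs v (a (-h)) (R * ρ) y - 2 * rs v (a 0) (R * ρ) y +
      (rs ψ (a h) (R * ρ) y + rs ψ (a (-h)) (R * ρ) y + 2 * rs ψ (a 0) (R * ρ) y)) = s⁻¹ * (m + κ - T (x0 + ρ • y)) := fun y => by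
    simp only [ha, rs_add, ← hψR]
    rw [← ay5 hs hρ rfl]
    simp [qd]
  have hmb : ∀ x, 0 ≤ m - dl h V x := fun x => sub_nonneg.2 (hm.1 ⟨x, rfl⟩)
  have si := inv_pos.2 hs
  have fin := wh (ball 0 3) isOpen_ball (closedBall_subset_ball nm) _ _ _ (c2.mono (subset_univ _)) (fun y hy => ?_) _ ((hv.rs (a 0) hρR).df hl hl1)
    (fun y _ => ?_) _ (fun y hy => hy.1) (fun y hy => ?_) hvol
  · rw [hw, smul_zero, add_zero] at fin
    have := (abs_le.1 (hTb 0 (by simp))).1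
    rw [smul_zero, add_zero] at this
    have f2 : s⁻¹ * (m + κ - T x0) < s⁻¹ * (3 * κ) := mul_lt_mul_of_pos_left (by linarith) si
    rw [show s⁻¹ * (3 * κ) = 3 / 4 * c by rw [hκd]; field_simp] at f2
    linarith
  · rw [hw]
    have := (abs_le.1 (hTb y (ball_subset_closedBall hy))).2
    exact mul_pos si (by linarith [hmb (x0 + ρ • y)])
  · have := SUPER hl (hv.ell (a 0 + (R * ρ) • y)) (hv.ell (a h + (R * ρ) • y)) (hv.ell (a (-h) + (R * ρ) • y)) (hψ.psd _) (hψ.psd _) (hψ.psd _) (hψ.dom _) (hψ.dom _) (hψ.dom _)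
    rw [zero_smul, zero_sub, mul_negL, map_neg, mul_smulL, map_smul, smul_eq_mul]
    exact neg_nonpos.2 (mul_nonneg (pp : 0 ≤ s⁻¹ * ρ ^ 2) this)
  · rw [hw]
    have := (abs_le.1 (hTb y (cbs nm hy.1))).2
    have hy2 : s ≤ m - dl h V (x0 + ρ • y) := hy.2
    calc (1:ℝ) = s⁻¹ * s := (inv_mul_cancel₀ hs.ne').symm
      _ ≤ _ := mll (by linarith) si.le
theorem shI (hf : Continuous f) (h0 : ∀ x, 0 ≤ f x) {a : E n} (ha : ‖a‖ ≤ d) :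
    ∫ x in Bz ρ, f (x + a) ≤ ∫ x in Bz (ρ + d), f x := by
  have h1 := (measurePreserving_add_right (volume : Measure (E n)) a).setIntegral_preimage_emb (measurableEmbedding_addRight a) f (closedBall a ρ)
  have h2 : (fun x => x + a) ⁻¹' closedBall a ρ = Bz ρ := by ext x; simp [dist_eq_norm]
  rw [h2] at h1
  rw [h1]
  exact setIntegral_mono_set (cK_int hf) (ae_of_all _ h0) (closedBall_subset_closedBall' (by simpa [add_comm ρ] using ha)).eventuallyLE
theorem int_meas (hf : Continuous f) {S : ℝ} (hS : ∀ x, f x ≤ S) (hS0 : 0 ≤ S) (hs : 0 ≤ s) (hν : 0 ≤ ν)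
    (h : volume {y ∈ Bz 1 | s ≤ f y} < ENNReal.ofReal ν) :
    ∫ x in Bz 1, f x ≤ s * volume.real (Bz 1) + S * ν := by
  set Z := {y ∈ Bz 1 | s ≤ f y}
  have hZ : MeasurableSet Z := (isClosed_closedBall.inter (isClosed_le continuous_const hf)).measurableSet
  have hZs : Z ⊆ Bz 1 := fun y hy => hy.1
  have hfi : IntegrableOn (Z.indicator fun _ => S) (Bz 1) :=
    (cK_int (continuous_const (y := S))).indicator hZ
  have h1 : ∫ x in Bz 1, f x ≤ ∫ x in Bz 1, (s + Z.indicator (fun _ => S) x) := by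
    refine setIntegral_mono_on (cK_int hf) ((cK_int continuous_const).add hfi) mcb fun x hx => ?_
    by_cases hxZ : x ∈ Z
    · rw [indicator_of_mem hxZ]; linarith [hS x]
    · rw [indicator_of_notMem hxZ, add_zero]
      by_contra! hc
      exact hxZ ⟨hx, hc.le⟩
  rw [integral_add (cK_int continuous_const) hfi, setIntegral_indicator hZ, inter_eq_right.2 hZs, setIntegral_const, setIntegral_const, smul_eq_mul, smul_eq_mul] at h1
  have h2 : volume.real Z ≤ ν := ENNReal.toReal_le_of_le_ofReal hν h.le
  nlinarith
theorem AVG (hV : Continuous V) (hm : ∀ x, 0 ≤ m - dl h V x) (k : ℕ) : (∀ x, 0 ≤ m - (4 ^ k)⁻¹ * dl ((2:ℝ) ^ k • h) V x) ∧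
    ∀ ρ, ∫ x in Bz ρ, (m - (4 ^ k)⁻¹ * dl ((2:ℝ) ^ k • h) V x) ≤ ∫ x in Bz (ρ + (2 ^ k - 1) * ‖h‖), (m - dl h V x) := by
  induction k with
  | zero => simpa using hm
  | succ k ih =>
    obtain ⟨i1, i2⟩ := ih
    set w : E n → ℝ := fun x => m - (4 ^ k)⁻¹ * dl ((2:ℝ) ^ k • h) V x with hw
    set a := (2:ℝ) ^ k • h with ha
    have e : ∀ x, m - (4 ^ (k+1))⁻¹ * dl ((2:ℝ) ^ (k+1) • h) V x = 1/4 * w (x + a) + 1/2 * w x + 1/4 * w (x + -a) := fun x => by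
      have e1 : (2:ℝ) ^ (k+1) • h = a + a := by rw [pow_succ, mul_comm, mul_smul, two_smul]
      have e2 : x - (a + a) = x + -a - a := by abel
      have e3 : x + -a + a = x := by abel
      simp only [hw, dl]
      rw [e1, e2, e3, ← add_assoc, add_sub_cancel_right, ← sub_eq_add_neg, pow_succ, mul_inv]; ring
    have wc : Continuous w := continuous_const.sub (continuous_const.mul (dl_cont _ hV))
    simp only [e]
    refine ⟨fun x => by have := i1 (x + a); have := i1 x; have := i1 (x + -a); positivity, fun ρ => ?_⟩
    have ws : ∀ b : E n, Continuous fun x => w (x + b) := fun b => wc.comp (by fun_prop)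
    have hN : ‖a‖ = 2 ^ k * ‖h‖ := by rw [ha, norm_smul]; simp
    rw [int_add (f := fun x => 1/4 * w (x + a) + 1/2 * w x) (g := fun x => 1/4 * w (x + -a)) (((ws a).const_mul _).add (wc.const_mul _)) ((ws _).const_mul _),
      int_add (f := fun x => 1/4 * w (x + a)) (g := fun x => 1/2 * w x) ((ws a).const_mul _) (wc.const_mul _), integral_const_mul, integral_const_mul, integral_const_mul]
    have s1 := shI wc i1 (ρ := ρ) (a := a) hN.le
    have s2 := shI wc i1 (ρ := ρ) (a := -a) (by rw [norm_neg, hN])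
    have s3 := shI wc i1 (ρ := ρ) (a := 0) (by rw [norm_zero]; positivity : ‖(0 : E n)‖ ≤ 2 ^ k * ‖h‖)
    simp only [add_zero] at s3
    have := i2 (ρ + 2 ^ k * ‖h‖)
    rw [show ρ + 2 ^ k * ‖h‖ + (2 ^ k - 1) * ‖h‖ = ρ + (2 ^ (k+1) - 1) * ‖h‖ by ring] at this
    linarith
theorem dl_rs (V : E n → ℝ) (h x : E n) (k : ℕ) : dl h (rs V 0 (2 ^ k)) x = (4 ^ k)⁻¹ * dl ((2:ℝ) ^ k • h) V ((2:ℝ) ^ k • x) := by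
  simp only [dl, rs, zero_add, smul_add, smul_sub, ← pow_mul, mul_comm k 2]
  rw [pow_mul]; norm_num; ring
theorem LL.dl (hf : LL f) (h : E n) (hy : ‖y - x‖ ≤ 1) : |dl h f y - dl h f x| ≤ 8 * (‖x‖ + 1 + ‖h‖) * ‖y - x‖ := by
  have hyn : ‖y‖ ≤ ‖x‖ + 1 := by have := norm_sub_norm_le y x; linarith
  have key : ∀ k : E n, ‖k‖ ≤ ‖h‖ → |f (y + k) - f (x + k)| ≤ 2 * (‖x‖ + 1 + ‖h‖) * ‖y - x‖ := fun k hk => by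
    have := hf.2 (y + k) (x + k)
    rw [add_sub_add_right_eq_sub] at this
    refine this.trans (mlr ?_ (norm_nonneg _))
    have := norm_add_le y k; have := norm_add_le x k; linarith
  have k1 := abs_le.1 (key h le_rfl); have k2 := abs_le.1 (key (-h) (by simp)); have k3 := abs_le.1 (key 0 (by simp))
  simp only [MAx.dl, ← sub_eq_add_neg, add_zero] at *
  rw [abs_le]; constructor <;> linarith [k1.1, k1.2, k2.1, k2.2, k3.1, k3.2]
theorem WC (hn : 1 ≤ n) (hl : 0 < l) (hl1 : l ≤ 1) {P H} (hv : Sol l v P H) (h0 : v 0 = 0) (hp : P 0 = 0) {g0 K ψ Pψ Gψ}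
    (hψ : FF H g0 K ψ Pψ Gψ) {U : Filter ℝ} [U.NeBot] (hU : U ≤ atTop) (hV : LL V) (hVt : ∀ y, Tendsto (fun R => rs v 0 R y) U (𝓝 (V y)))
    {N : Filter ℕ} [N.NeBot] (hN : N ≤ atTop) (hWt : ∀ y, Tendsto (fun k : ℕ => rs V 0 (2 ^ k) y) N (𝓝 (W y))) (h : E n) :
    ∃ m, ∀ x, dl h W x = m := by
  have dlt : ∀ {ι : Type} {F : Filter ι} {f : ι → E n → ℝ} {g : E n → ℝ}, (∀ y, Tendsto (fun i => f i y) F (𝓝 (g y))) → ∀ x,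
      Tendsto (fun i => dl h (f i) x) F (𝓝 (dl h g x)) := fun hh x => ((hh _).add (hh _)).sub ((hh _).const_mul 2)
  have hb : ∀ x, 0 ≤ dl h V x ∧ dl h V x ≤ ‖h‖ ^ 2 := fun x => by
    have hev : ∀ᶠ R in U, 0 ≤ dl h (rs v 0 R) x ∧ dl h (rs v 0 R) x ≤ ‖h‖ ^ 2 := Eventually.mono (hU (eventually_gt_atTop 0)) fun R hR => (hv.rs 0 hR).dl_bd hl.le h x
    exact ⟨ge_of_tendsto (dlt hVt x) (hev.mono fun _ h => h.1), le_of_tendsto (dlt hVt x) (hev.mono fun _ h => h.2)⟩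
  obtain ⟨m, hm⟩ := Real.exists_isLUB (range_nonempty (dl h V)) ⟨‖h‖ ^ 2, by rintro _ ⟨x, rfl⟩; exact (hb x).2⟩
  have hm0 : ∀ x, 0 ≤ m - dl h V x := fun x => sub_nonneg.2 (hm.1 ⟨x, rfl⟩)
  have hmS : ∀ x, m - dl h V x ≤ ‖h‖ ^ 2 := fun x => by
    have : m ≤ ‖h‖ ^ 2 := hm.2 (by rintro _ ⟨x, rfl⟩; exact (hb x).2)
    linarith [(hb x).1]
  have wc : Continuous fun x => m - dl h V x := continuous_const.sub (dl_cont h hV.cont)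
  refine ⟨m, fun x => le_antisymm ?_ ?_⟩
  · refine le_of_tendsto (dlt hWt x) (Eventually.of_forall fun k => ?_)
    rw [dl_rs]; linarith [(AVG hV.cont hm0 k).1 ((2:ℝ) ^ k • x)]
  by_contra! hlt
  set c := (m - dl h W x) / 2 with hc
  have hc0 : 0 < c := by linarith
  set Λ := 8 * (‖x‖ + 1 + ‖h‖) with hΛ
  have hΛ0 : 0 < Λ := pp
  set d := min 1 (c / (2 * Λ)) with hd
  have hd0 : 0 < d := pp
  set r1 := ‖x‖ + 1 + ‖h‖ with hr1
  have hr10 : 0 < r1 := pp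
  set V1 := volume.real (Bz 1) with hV1
  have hV0 : 0 < V1 := vol_pos _ one_pos
  set T := c / 2 * volume.real (closedBall x d) with hT
  have hT0 : 0 < T := mul_pos pp (vol_pos x hd0)
  set s := T / (4 * (2 * r1) ^ n * V1) with hs
  set ν := T / (4 * (2 * r1) ^ n * (‖h‖ ^ 2 + 1)) with hν
  obtain ⟨x0, hx0⟩ := CL hn hl hl1 hv h0 hp hψ hU hV hVt hm (pp : 0 < ν) (pp : 0 < s)
  have ev1 : ∀ᶠ k in N, ‖x0‖ ≤ 2 ^ k * r1 := hN (((tendsto_pow_atTop_atTop_of_one_lt (nm : (1:ℝ) < 2)).atTop_mul_const hr10).eventually_ge_atTop _)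
  have ev2 : ∀ᶠ k in N, dl h (rs V 0 (2 ^ k)) x < m - c := (dlt hWt x).eventually_lt_const (by linarith)
  obtain ⟨k, hk1, hk2⟩ := (ev1.and ev2).exists
  have hp2 : (0:ℝ) < 2 ^ k := pp
  obtain ⟨A1, A2⟩ := AVG hV.cont hm0 k
  set w : E n → ℝ := fun x => m - (4 ^ k)⁻¹ * dl ((2:ℝ) ^ k • h) V x with hw
  have wkc : Continuous w := continuous_const.sub (continuous_const.mul (dl_cont _ hV.cont))
  have wsc : Continuous fun y : E n => w ((2:ℝ) ^ k • y) := wkc.comp (by fun_prop)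
  have lower : T ≤ ∫ y in Bz (‖x‖ + 1), w ((2:ℝ) ^ k • y) := by
    have l1 : T ≤ ∫ y in closedBall x d, w ((2:ℝ) ^ k • y) := by
      have : ∫ y in closedBall x d, c / 2 ≤ ∫ y in closedBall x d, w ((2:ℝ) ^ k • y) := by
        refine setIntegral_mono_on (cK_int continuous_const) (cK_int wsc) mcb fun y hy => ?_
        rw [mem_closedBall, dist_eq_norm] at hy
        have q := (abs_le.1 ((hV.rs hp2).dl h (hy.trans (min_le_left _ _)))).2
        have q2 : Λ * ‖y - x‖ ≤ c / 2 := (mll (hy.trans (min_le_right _ _)) hΛ0.le).trans_eq (by field_simp)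
        simp only [hw, ← dl_rs]
        linarith
      rwa [setIntegral_const, smul_eq_mul, mul_comm] at this
    exact l1.trans (setIntegral_mono_set (cK_int wsc) (ae_of_all _ fun y => A1 _)
      (closedBall_subset_closedBall' (by rw [dist_zero_right, hd]; linarith [min_le_left 1 (c / (2 * Λ))])).eventuallyLE)
  have sc : ∀ (f : E n → ℝ) {r t : ℝ}, 0 < r → 0 < t → ∫ y in Bz t, f (r • y) = (r ^ n)⁻¹ * ∫ y in Bz (r * t), f y := fun f r t hr ht => by
    have := Measure.setIntegral_comp_smul_of_pos (volume : Measure (E n)) f (closedBall 0 t) hr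
    rw [this, _root_.smul_closedBall _ _ ht.le, smul_zero, finrank_euclideanSpace_fin, rnn hr.le, smul_eq_mul]
  rw [sc _ hp2 pp] at lower
  have u1 : ∫ y in Bz (2 ^ k * (‖x‖ + 1)), w y ≤ ∫ y in Bz (2 * (2 ^ k * r1)), (m - dl h V (y + x0)) := by
    refine (A2 _).trans ?_
    have := shI (f := fun y => m - dl h V (y + x0)) (wc.comp (by fun_prop : Continuous fun y : E n => y + x0)) (fun y => hm0 _) (a := -x0) (ρ := 2 ^ k * r1) (d := 2 ^ k * r1) (by rwa [norm_neg])
    simp only [neg_add_cancel_right, ← two_mul] at this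
    refine le_trans (setIntegral_mono_set (cK_int wc) (ae_of_all _ hm0) (cbs ?_).eventuallyLE) this
    rw [hr1]; nlinarith only [mul_nonneg hp2.le (norm_nonneg h), mul_nonneg hp2.le (norm_nonneg x), hp2]
  have hρ : 0 < 2 * (2 ^ k * r1) := pp
  have u2 := int_meas (wc.comp (by fun_prop : Continuous fun y : E n => x0 + (2 * (2 ^ k * r1)) • y)) (fun y => hmS _) pp (pp : 0 ≤ s) (pp : 0 ≤ ν) (hx0 _ hρ)
  simp only [Function.comp_def, add_comm x0] at u2
  rw [int_rs hρ (f := fun y => m - dl h V (y + x0)), ← hV1, inv_mul_le_iff₀ pp] at u2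
  have u3 := lower.trans (mll (u1.trans u2) pp)
  have e1 : ((2 ^ k : ℝ) ^ n)⁻¹ * ((2 * (2 ^ k * r1)) ^ n * (s * V1 + ‖h‖ ^ 2 * ν)) = T / 4 + T / 4 * (‖h‖ ^ 2 / (‖h‖ ^ 2 + 1)) := by
    rw [hs, hν]; simp only [mul_pow]; field_simp
  rw [e1] at u3
  have e2 : ‖h‖ ^ 2 / (‖h‖ ^ 2 + 1) ≤ 1 := (div_le_one pp).2 (by linarith)
  nlinarith only [u3, e2, hT0]
theorem QUAD (hW : LL W) (h : ∀ k : E n, ∃ m, ∀ x, dl k W x = m) : ∃ M : L n, Sy M ∧ ∀ x, W x = qd 0 0 M x := by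
  have hd : ∀ k x y : E n, dl k W x = dl k W y := fun k x y => by obtain ⟨m, hm⟩ := h k; rw [hm, hm]
  have add : ∀ k x y : E n, W (x + y + k) - W (x + y) - W k = (W (x + k) - W x - W k) + (W (y + k) - W y - W k) := by
    intro k
    have j : ∀ x t, W (x + t + k) - W (x + t) + (W (x - t + k) - W (x - t)) = 2 * (W (x + k) - W x) := fun x t => by
      have := hd t (x + k) x
      simp only [dl] at this
      rw [add_right_comm x t k, sub_add_eq_add_sub x t k]; linarith
    intro x y
    have e2 : ∀ z, W (z + z + k) - W (z + z) + W k = 2 * (W (z + k) - W z) := fun z => by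
      have := j z z; rw [sub_self, zero_add, hW.1] at this; linarith
    have h2 : (2:ℝ)⁻¹ • (x + y) + (2:ℝ)⁻¹ • (x + y) = x + y := by rw [← add_smul]; norm_num
    have h3 : (2:ℝ)⁻¹ • (x + y) + (2:ℝ)⁻¹ • (x - y) = x := by rw [← smul_add, add_add_sub_cancel, ← two_smul ℝ x, smul_smul]; norm_num
    have h4 : (2:ℝ)⁻¹ • (x + y) - (2:ℝ)⁻¹ • (x - y) = y := by rw [← smul_sub, add_sub_sub_cancel, ← two_smul ℝ y, smul_smul]; norm_num
    have j1 := j ((2:ℝ)⁻¹ • (x + y)) ((2:ℝ)⁻¹ • (x - y))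
    have j2 := e2 ((2:ℝ)⁻¹ • (x + y))
    rw [h3, h4] at j1
    rw [h2] at j2
    linarith
  have Wc := hW.cont
  have lin : ∀ k, ∃ p : E n, ∀ x, W (x + k) - W x - W k = ⟪p, x⟫ := fun k => by
    let φ : E n →+ ℝ := AddMonoidHom.mk' (fun x => W (x + k) - W x - W k) (add k)
    have hc : Continuous φ := by change Continuous fun x => W (x + k) - W x - W k; fun_prop
    refine ⟨(InnerProductSpace.toDual ℝ (E n)).symm (φ.toRealLinearMap hc), fun x => ?_⟩
    rw [InnerProductSpace.toDual_symm_apply]; rfl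
  choose p hp using lin
  have sy : ∀ k x, ⟪p k, x⟫ = ⟪k, p x⟫ := fun k x => by
    rw [real_inner_comm (p x) k, ← hp, ← hp, add_comm]; ring
  let M : L n := LinearMap.toContinuousLinearMap
    { toFun := p
      map_add' := fun a b => ext_inner_right ℝ fun x => by rw [inner_add_left, sy, sy, sy, inner_add_left]
      map_smul' := fun c a => ext_inner_right ℝ fun x => by
        rw [RingHom.id_apply, isl, sy, sy, isl] }
  refine ⟨M, sy, fun x => ?_⟩
  have e : ∀ x y, W (x + y) - W x - W y = ⟪M y, x⟫ := fun x y => hp y x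
  set g : E n → ℝ := fun x => W x - qd 0 0 M x with hg
  have g2 : ∀ x, g (x + x) = 2 * g x := fun x => by
    have := e x x
    simp only [hg, qd, map_add, inner_add_left, inner_add_right, inner_zero_left]; linarith
  have gb : ∀ x, |g x| ≤ (1 + ‖M‖) * ‖x‖ ^ 2 := fun x => by
    have a1 := hW.2 x 0
    have a2 := inner_le_mn (le_refl ‖M‖) x x
    rw [hW.1, sub_zero, sub_zero, norm_zero, add_zero] at a1
    have a3 := abs_le.1 a1; have a4 := abs_le.1 a2
    simp only [hg, qd, inner_zero_left]
    have : 0 ≤ ‖M‖ * (‖x‖ * ‖x‖) := pp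
    rw [abs_le]; constructor <;> linarith [a3.1, a3.2, a4.1, a4.2]
  have gs : ∀ (j : ℕ) (x : E n), g x = 2 ^ j * g ((2⁻¹:ℝ) ^ j • x) := fun j => by
    induction j with
    | zero => simp
    | succ j ih => 
      intro x
      rw [ih x]
      have : (2⁻¹:ℝ) ^ j • x = (2⁻¹:ℝ) ^ (j+1) • x + (2⁻¹:ℝ) ^ (j+1) • x := by rw [← add_smul]; congr 1; ring
      rw [this, g2]; ring
  have gz : |g x| ≤ 0 := by
    refine ge_of_tendsto' (f := fun j : ℕ => (2⁻¹:ℝ) ^ j * ((1 + ‖M‖) * ‖x‖ ^ 2)) (x := atTop) ?_ fun j => ?_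
    · simpa using (tendsto_pow_atTop_nhds_zero_of_lt_one (nm : (0:ℝ) ≤ 2⁻¹) nm).mul_const ((1 + ‖M‖) * ‖x‖ ^ 2)
    · rw [gs j, abs_mul, abs_of_pos (pp : (0:ℝ) < 2 ^ j)]
      refine (mll (gb _) pp).trans_eq ?_
      rw [norm_smul, rnn pp, mul_pow, inv_pow]; field_simp
  have := abs_nonpos_iff.1 gz
  simp only [hg] at this; linarith
theorem BD (hn : 1 ≤ n) (hl : 0 < l) (hl1 : l ≤ 1) {P H} (hv : Sol l v P H) {g0 K ψ Pψ Gψ}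
    (hψ : FF H g0 K ψ Pψ Gψ) (hε : 0 < ε) (R0 : ℝ) : ∃ R M, R0 ≤ R ∧ 1 ≤ R ∧ Ap (rs v 0 R) M ε := by
  have hv' : Sol l (fun x => v x - qd (v 0) (P 0) (0 • (1 : L n)) x) (fun x => P x - (P 0 + (0 • (1 : L n)) x)) H := by
    have := hv.c2.sub (qd_C2 univ (v 0) (P 0) (Sy.smul1 0))
    simp only [zero_smul, sub_zero] at this ⊢
    exact ⟨this, hv.ell⟩
  set v' := fun x => v x - qd (v 0) (P 0) (0 • (1 : L n)) x with hvd
  have h0 : v' 0 = 0 := by simp [hvd, qd]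
  have hp : P 0 - (P 0 + (0 • (1 : L n)) 0) = 0 := by simp
  have hLL := hv'.LL hl.le h0 hp
  set U : Ultrafilter ℝ := Ultrafilter.of atTop
  have hU : (U : Filter ℝ) ≤ atTop := Ultrafilter.of_le _
  have hUL : ∀ᶠ R in (U : Filter ℝ), LL (rs v' 0 R) := Eventually.mono (hU (eventually_gt_atTop 0)) fun R hR => hLL.rs hR
  obtain ⟨V, hV, hVt⟩ := UL0 U hUL
  set N : Ultrafilter ℕ := Ultrafilter.of atTop
  have hN : (N : Filter ℕ) ≤ atTop := Ultrafilter.of_le _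
  have hNL : ∀ᶠ k in (N : Filter ℕ), LL (rs V 0 (2 ^ k)) := Eventually.of_forall fun k => hV.rs pp
  obtain ⟨W, hW, hWt⟩ := UL0 N hNL
  obtain ⟨M, hM, hq⟩ := QUAD hW (WC hn hl hl1 hv' h0 hp hψ hU hV hVt hN hWt)
  obtain ⟨k, hk⟩ := (UNI hNL hW hWt one_pos (pp : 0 < ε / 2)).exists
  have h2 : (0:ℝ) < 2 ^ k := pp
  obtain ⟨R, hR, hR1, hR0⟩ := ((UNI hUL hV hVt h2 (pp : 0 < ε / 2 * (2 ^ k) ^ 2)).and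
    (((eventually_ge_atTop 1).filter_mono hU).and ((eventually_ge_atTop R0).filter_mono hU))).exists
  have hR' : 0 < R := by linarith
  have h1k : (1:ℝ) ≤ 2 ^ k := one_le_pow₀ nm
  refine ⟨R * 2 ^ k, M, ?_, by nlinarith, hM, ((R * 2 ^ k) ^ 2)⁻¹ * v 0, (R * 2 ^ k)⁻¹ • P 0, fun x hx => ?_⟩
  · nlinarith
  have a1 := hk x hx
  have a2 := hR (0 + (2:ℝ) ^ k • x) (by
    rw [mcz] at hx ⊢
    rw [zero_add, norm_smul, rnn h2.le]; nlinarith)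
  have a3 : |rs v' 0 (R * 2 ^ k) x - rs V 0 (2 ^ k) x| ≤ ε / 2 := by
    have : rs v' 0 (R * 2 ^ k) x - rs V 0 (2 ^ k) x = ((2 ^ k) ^ 2)⁻¹ * (rs v' 0 R (0 + (2:ℝ) ^ k • x) - V (0 + (2:ℝ) ^ k • x)) := by
      rw [← rs_rs]; simp only [rs]; ring
    rw [this, abs_mul, abs_of_pos pp, inv_mul_le_iff₀ pp, mul_comm]; exact a2
  have e : rs v 0 (R * 2 ^ k) x - qd (((R * 2 ^ k) ^ 2)⁻¹ * v 0) ((R * 2 ^ k)⁻¹ • P 0) M x = rs v' 0 (R * 2 ^ k) x - W x := by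
    rw [hq]
    simp only [rs, qd, hvd, zero_add, zero_smul, zero_apply, inner_zero_left, isl, inner_smul_right]
    field_simp; ring
  rw [e]
  exact (abs_sub_le _ _ _).trans (by linarith)
theorem Ap.mono (h : Ap v M e) (he : e ≤ e') : Ap v M e' := by
  obtain ⟨hM, c, p, h⟩ := h; exact ⟨hM, c, p, fun x hx => (h x hx).trans he⟩
theorem Ap.chg (h : Ap v M e) (hA : Sy A) : Ap v A (e + ‖M - A‖) := by
  obtain ⟨hM, c, p, h⟩ := h
  refine ⟨hA, c, p, fun x hx => ?_⟩
  have h1 := inner_le_mn (le_refl ‖M - A‖) x x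
  rw [mcz] at hx
  have h2 : ‖M - A‖ * (‖x‖ * ‖x‖) ≤ ‖M - A‖ * 1 := mll (by nlinarith [norm_nonneg x]) (norm_nonneg _)
  have h3 := h x (mcz.2 hx)
  have : v x - qd c p A x = (v x - qd c p M x) + 1 / 2 * ⟪(M - A) x, x⟫ := by simp only [qd, sub_apply, inner_sub_left]; ring
  rw [this]
  refine (abs_add_le _ _).trans (add_le_add h3 ?_)
  rw [abs_mul, abs_of_pos nm]; linarith [abs_nonneg ⟪(M - A) x, x⟫]
theorem rs_one (v : E n → ℝ) : rs v 0 1 = v := by funext x; simp [rs]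
theorem rs_rsz (v : E n → ℝ) (z y : E n) (r t : ℝ) : rs (rs v y r) z t = rs v (y + r • z) (r * t) := by
  funext x; simp only [rs, smul_add, smul_smul, mul_pow, mul_inv, add_assoc]; ring
theorem Ap.sc (h : Ap (rs v y r) M e) (ht : 0 < t) (htr : t ≤ r) : Ap (rs v y t) M ((r / t) ^ 2 * e) := by
  have hr : 0 < r := ht.trans_le htr
  have := h.sub (z := 0) (r := t / r) pp (by rw [norm_zero, zero_add]; exact (div_le_one hr).2 htr)
  rw [rs_rs, mul_div_cancel₀ _ hr.ne', ← inv_pow, inv_div] at this; exact this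
def Dc (n : ℕ) (l κ s C ε : ℝ) : Prop := ∀ (v : E n → ℝ) (P : E n → E n) (H : E n → L n) (_ : Sol l v P H)
    (g0 F : ℝ) (ψ : E n → ℝ) (Pψ : E n → E n) (Gψ : E n → L n) (_ : Maj (fun x => ldet (H x)) g0 F ψ Pψ Gψ) (M : L n) (e : ℝ)
    (_ : Ap v M e) (_ : e ≤ ε), ∃ M', Ap (rs v 0 κ) M' (s * e + C * F)
theorem ITER (dc : Dc n l κ s C ε) (hκ : 0 < κ) {P H} (hv : Sol l v P H) {q : ℝ} 
    (hq : 0 ≤ q) (hB0 : 0 ≤ B) (hB : C * F ≤ B * (q - s)) (h0 : Ap v M e) (m : ℕ)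
    (hM : ∀ k < m, ∃ ψ Pψ Gψ, Maj (fun x => ldet (H (0 + κ ^ k • x))) g0 (F * q ^ k) ψ Pψ Gψ)
    (hs : ∀ k < m, s ^ k * e + B * q ^ k ≤ ε) : ∀ k ≤ m, ∃ M, Ap (rs v 0 (κ ^ k)) M (s ^ k * e + B * q ^ k) := by
  intro k
  induction k with
  | zero => exact fun _ => ⟨M, by rw [pow_zero, rs_one]; exact h0.mono (by simpa using hB0)⟩
  | succ k ih =>
    intro hk
    obtain ⟨M, h⟩ := ih (by omega)
    obtain ⟨ψ, Pψ, Gψ, hψ⟩ := hM k (by omega)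
    obtain ⟨M', h'⟩ := dc _ _ _ (hv.rs 0 (pow_pos hκ k)) _ _ _ _ _ hψ M _ h (hs k (by omega))
    rw [rs_rs, ← pow_succ] at h'
    refine ⟨M', h'.mono ?_⟩
    have := mlr hB (pow_nonneg hq k)
    rw [pow_succ, pow_succ]; linarith
theorem FF.maj {g0 K ψ Pψ Gψ} (h : FF H g0 K ψ Pψ Gψ) (hK : 0 ≤ K) (hr : 0 < r) (hF : K * (1 + r) / r ^ 2 ≤ F) :
    Maj (fun x => ldet (H (0 + r • x))) g0 F (rs ψ 0 r) (fun x => r⁻¹ • Pψ (0 + r • x)) (fun x => Gψ (0 + r • x)) := by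
  refine ⟨h.c2.rs 0 hr, fun x => h.psd _, fun x _ => h.dom _, fun x _ => mul_nonneg pp (h.nn _), fun x hx => le_trans ?_ hF⟩
  rw [rs, inv_mul_eq_div]
  rw [mcz] at hx
  gcongr
  refine (h.le _).trans ?_
  rw [zero_add, norm_smul, rnn hr.le]
  gcongr; nlinarith
theorem FAR (hn : 1 ≤ n) (hl : 0 < l) (hl1 : l ≤ 1) {P H} (hv : Sol l v P H) {g0 K ψ Pψ Gψ}
    (hψ : FF H g0 K ψ Pψ Gψ) (hK : 0 ≤ K) : ∃ r0 D, 1 ≤ r0 ∧ 0 < D ∧ ∀ r, r0 ≤ r → ∃ M, Ap (rs v 0 r) M (D / r) := by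
  obtain ⟨κ, ε, C, hκ, hκ1, hε, hC, dc⟩ := DEC hn hl hl1 (nm : (1/2:ℝ) < 1)
  set s := κ ^ (1/2:ℝ) with hs
  have hs0 : 0 < s := Real.rpow_pos_of_pos hκ _
  have hs1 : s < 1 := Real.rpow_lt_one hκ.le (by linarith) nm
  have hq1 : 8 ≤ κ⁻¹ := by rw [le_inv_comm₀ nm hκ]; linarith
  set D := 2 * K * C
  have hD : 0 ≤ D := pp
  refine ⟨max 1 (2 * D / ε), (κ⁻¹) ^ 2 * (1 + D), le_max_left _ _, pp, fun r hr => ?_⟩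
  have hr1 : 1 ≤ r := (le_max_left _ _).trans hr
  have hr0 : 0 < r := by linarith
  have hrD : D / r ≤ ε / 2 := by
    have := (le_max_right _ _).trans hr
    rw [div_le_iff₀ hε] at this; rw [div_le_iff₀ hr0]; linarith
  obtain ⟨k0, hk0⟩ := exists_pow_lt_of_lt_one (pp : 0 < (1 / (r * ε))) hs1
  obtain ⟨R, M, hR, hR1, hM⟩ := BD hn hl hl1 hv hψ (half_pos hε) (r / κ ^ k0)
  have hR0 : 0 < R := by linarith
  have hpk0 : κ ^ k0 ≤ 1 := pow_le_one₀ hκ.le (by linarith)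
  rw [div_le_iff₀ pp] at hR
  obtain ⟨k, k1, k2⟩ := exists_nat_pow_near_of_lt_one (div_pos hr0 hR0) ((div_le_one hR0).2 (by nlinarith only [hR, hpk0, hR0])) hκ (by linarith : κ < 1)
  rw [lt_div_iff₀ hR0] at k1
  rw [div_le_iff₀ hR0] at k2
  have hkk : k0 ≤ k := by
    by_contra! h
    have := pow_le_pow_of_le_one hκ.le (by linarith) (by omega : k + 1 ≤ k0)
    nlinarith only [k1, hR, this, hR0]
  have hsk : s ^ k * (ε / 2) ≤ 1 / r := by
    have h1 := pow_le_pow_of_le_one hs0.le hs1.le hkk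
    have h2 : s ^ k * ε ≤ 1 / (r * ε) * ε := mlr (by linarith) hε.le
    have h3 : 1 / (r * ε) * ε = 1 / r := by field_simp
    have : 0 < s ^ k * ε := pp
    linarith
  have hBq : ∀ j ≤ k, D / R * κ⁻¹ ^ j ≤ D / r := fun j hj => by
    have h1 := pow_le_pow_of_le_one hκ.le (by linarith) hj
    rw [inv_pow, ← div_eq_mul_inv, div_div]
    refine div_le_div_of_nonneg_left hD hr0 ?_
    nlinarith only [k2, h1, hR0]
  have it := ITER (q := κ⁻¹) (B := D / R) (F := 2 * K / R) (g0 := g0) dc hκ (hv.rs 0 hR0) pp pp ?_ hM k (fun j hj => ?_) (fun j hj => ?_) k le_rfl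
  · obtain ⟨M', h⟩ := it
    rw [rs_rs] at h
    refine ⟨M', (h.sc hr0 (by linarith)).mono ?_⟩
    rw [mul_div_assoc (κ⁻¹ ^ 2)]
    have h1 : R * κ ^ k / r ≤ κ⁻¹ := by rw [div_le_iff₀ hr0, inv_mul_eq_div, le_div_iff₀ hκ]; rw [pow_succ] at k1; linarith
    have h2 : s ^ k * (ε / 2) + D / R * κ⁻¹ ^ k ≤ (1 + D) / r := by rw [add_div]; linarith [hBq k le_rfl]
    have h3 : 0 ≤ R * κ ^ k / r := pp
    exact mul_le_mul (pow_le_pow_left₀ h3 h1 2) h2 pp pp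
  · have : C * (2 * K / R) = D / R * 1 := by simp only [D]; ring
    rw [this]; exact mll (by linarith) pp
  · have h1 := pow_le_pow_of_le_one hκ.le (by linarith) hj.le
    have h2 : 0 < κ ^ j := pp
    have h3 : 1 ≤ R * κ ^ j := by nlinarith only [k2, h1, hR0, hr1]
    have := hψ.maj hK (r := R * κ ^ j) pp (F := 2 * K / R * κ⁻¹ ^ j) (by
      rw [div_le_iff₀ pp, inv_pow]
      have : 2 * K / R * (κ ^ j)⁻¹ * (R * κ ^ j) ^ 2 = K * (R * κ ^ j + R * κ ^ j) := by field_simp; ring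
      rw [this]; gcongr)
    simp only [zero_add, smul_smul] at this ⊢
    exact ⟨_, _, _, this⟩
  · have h1 : s ^ j * (ε / 2) ≤ ε / 2 := mul_le_of_le_one_left pp (pow_le_one₀ hs0.le hs1.le)
    linarith [hBq j hj.le]
theorem Sy.lim {X : ℕ → L n} (h : ∀ k, Sy (X k)) (hA : Tendsto X atTop (𝓝 A)) : Sy A := fun x y => by
  have ha : ∀ z : E n, Tendsto (fun k => X k z) atTop (𝓝 (A z)) := fun z => ((ContinuousLinearMap.apply ℝ (E n) z).continuous.tendsto A).comp hA
  exact tendsto_nhds_unique (((ha x).inner tendsto_const_nhds).congr fun k => h k x y) (tendsto_const_nhds.inner (ha y))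
theorem FARA (hn : 1 ≤ n) (hl : 0 < l) (hl1 : l ≤ 1) {P H} (hv : Sol l v P H) {g0 K ψ Pψ Gψ}
    (hψ : FF H g0 K ψ Pψ Gψ) (hK : 0 ≤ K) : ∃ A r0 D, Sy A ∧ 1 ≤ r0 ∧ 0 < D ∧ ∀ r, r0 ≤ r → Ap (rs v 0 r) A (D / r) := by
  obtain ⟨r0, D, h0, hD, h⟩ := FAR hn hl hl1 hv hψ hK
  have h00 : 0 < r0 := by linarith
  have h2 : ∀ k : ℕ, r0 ≤ r0 * 2 ^ k := fun k => le_mul_of_one_le_right h00.le (one_le_pow₀ nm)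
  choose M hM using fun k : ℕ => h (r0 * 2 ^ k) (h2 k)
  have hd : ∀ k, dist (M k) (M (k+1)) ≤ (12 * D / r0) * (1/2) ^ k := fun k => by
    have h1 := (hM k).diff ((hM (k+1)).sc (t := r0 * 2 ^ k) pp (by rw [pow_succ]; nlinarith [h2 k]))
    rw [dist_eq_norm]
    refine h1.trans_eq ?_
    rw [one_div, inv_pow]; field_simp; ring
  obtain ⟨A, hA⟩ := cauchySeq_tendsto_of_complete (cauchySeq_of_le_geometric _ _ nm hd)
  have hS : Sy A := Sy.lim (fun k => (hM k).1) hA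
  refine ⟨A, r0, 100 * D, hS, h0, pp, fun r hr => ?_⟩
  have hr0 : 0 < r := by linarith
  obtain ⟨k, k1, k2⟩ := exists_nat_pow_near ((one_le_div h00).2 hr) (nm : (1:ℝ) < 2)
  rw [le_div_iff₀ h00] at k1; rw [div_lt_iff₀ h00] at k2
  have hd' := dist_le_of_le_geometric_of_tendsto _ _ nm hd hA (k+1)
  rw [dist_eq_norm] at hd'
  have h3 := (((hM (k+1)).chg hS)).sc (t := r) hr0 (by linarith)
  refine h3.mono ?_
  have e1 : r0 * 2 ^ (k + 1) / r ≤ 2 := by rw [div_le_iff₀ hr0, pow_succ]; linarith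
  have e2 : D / (r0 * 2 ^ (k+1)) ≤ D / r := div_le_div_of_nonneg_left hD.le hr0 (by linarith)
  have e3 : 12 * D / r0 * (1/2) ^ (k+1) / (1 - 1/2) = 24 * (D / (r0 * 2 ^ (k+1))) := by rw [one_div, inv_pow]; field_simp; norm_num
  have e4 : D / (r0 * 2 ^ (k + 1)) + ‖M (k + 1) - A‖ ≤ 25 * (D / r) := by rw [e3] at hd'; linarith
  have e5 : (r0 * 2 ^ (k + 1) / r) ^ 2 ≤ 2 ^ 2 := by gcongr
  exact (mul_le_mul e5 e4 (add_nonneg pp (norm_nonneg _)) pp).trans_eq (by ring)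
theorem majq (hn : 1 ≤ n) (hF : 0 ≤ F) (h : ∀ x ∈ Bz 1, |g x - g0| ≤ F) :
    ∃ ψ Pψ Gψ, Maj g g0 F ψ Pψ Gψ := by
  have e : ∀ x : E n, qd 0 0 (F • (1 : L n)) x = F / 2 * ‖x‖ ^ 2 := fun x => by
    simp only [qd, smul_apply, isl, one_apply_eq_self, rsq, inner_zero_left]; ring
  refine ⟨_, _, _, qd_C2 univ 0 0 (Sy.smul1 F), fun x => ⟨Sy.smul1 F, fun x => ?_⟩, fun x hx => (h x hx).trans ?_, fun x hx => ?_, fun x hx => ?_⟩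
  · simp only [smul_apply, isl, one_apply_eq_self, rsq]; positivity
  · rw [map_smul, tr_one, smul_eq_mul]; exact le_mul_of_one_le_right hF (by exact_mod_cast hn)
  · rw [e]; positivity
  · rw [e]; rw [mcz] at hx
    have : ‖x‖ ^ 2 ≤ 1 := pow_le_one₀ (norm_nonneg x) hx
    nlinarith
theorem PW (hn : 1 ≤ n) (hl : 0 < l) (hl1 : l ≤ 1) (hα : 0 < α) (hα1 : α < 1) : ∃ ε C : ℝ, 0 < ε ∧ 0 < C ∧
    ∀ (v : E n → ℝ) (P : E n → E n) (H : E n → L n) (_ : Sol l v P H) (F : ℝ) (_ : 0 ≤ F)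
    (_ : ∀ x ∈ Bz 1, |ldet (H x) - ldet (H 0)| ≤ F * ‖x‖ ^ α) (M : L n) (e : ℝ)
    (_ : Ap v M e) (_ : e + F ≤ ε), ∀ t, 0 < t → t ≤ 1 → Ap (rs v 0 t) (H 0) (C * (e + F) * t ^ α) := by
  obtain ⟨κ, ε, C, hκ, hκ1, hε, hC, dc⟩ := DEC hn hl hl1 (by linarith : (1 + α) / 2 < 1)
  set s := κ ^ ((1 + α) / 2) with hs
  set q := κ ^ α with hq
  have hs0 : 0 < s := Real.rpow_pos_of_pos hκ _
  have hq0 : 0 < q := Real.rpow_pos_of_pos hκ _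
  have hq1 : q < 1 := Real.rpow_lt_one hκ.le (by linarith) hα
  have hsq : s < q := Real.rpow_lt_rpow_of_exponent_gt hκ (by linarith) (by linarith)
  have hqs : 0 < q - s := by linarith
  have hqk : ∀ k : ℕ, (κ ^ k) ^ α = q ^ k := fun k => by
    rw [hq, ← Real.rpow_natCast, ← Real.rpow_natCast, ← Real.rpow_mul hκ.le, ← Real.rpow_mul hκ.le, mul_comm]
  set T := 1 + C / (q - s) with hT
  have hT0 : 0 < T := pp
  have h1q : 0 < 1 - q := by linarith
  set J := 8 * κ⁻¹ ^ 2 / (1 - q) with hJ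
  have hJ0 : 0 < J := pp
  refine ⟨ε / T, κ⁻¹ ^ 2 * (T * (1 + J)) * q⁻¹, pp, pp, fun v P H hv F hF hg M e hM heF => ?_⟩
  have he := hM.nn
  set W := T * (e + F) with hW
  have hW0 : 0 ≤ W := pp
  have hWε : W ≤ ε := by rw [le_div_iff₀ hT0] at heF; linarith
  have hB : 0 ≤ C * F / (q - s) := pp
  have heW : e + C * F / (q - s) ≤ W := by
    have : W = e + C * F / (q - s) + F + C / (q - s) * e := by rw [hW, hT]; ring
    have h2 : 0 ≤ C / (q - s) * e := pp
    linarith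
  have hk : ∀ k : ℕ, s ^ k * e + C * F / (q - s) * q ^ k ≤ W * q ^ k := fun k => by
    have : s ^ k * e ≤ q ^ k * e := by gcongr
    linarith [mlr heW (pow_pos hq0 k).le]
  have hqk1 : ∀ k : ℕ, q ^ k ≤ 1 := fun k => pow_le_one₀ hq0.le hq1.le
  have hM' : ∀ k : ℕ, ∃ M, Ap (rs v 0 (κ ^ k)) M (W * q ^ k) := fun k => by
    have hm : ∀ j < k, ∃ ψ Pψ Gψ, Maj (fun x => ldet (H (0 + κ ^ j • x))) (ldet (H 0)) (F * q ^ j) ψ Pψ Gψ := fun k _ => majq hn pp fun x hx => by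
      rw [mcz] at hx
      have e1 : ‖(0:E n) + κ ^ k • x‖ ≤ κ ^ k := by
        rw [zero_add, norm_smul, rnn pp]; exact mul_le_of_le_one_right pp hx
      refine (hg _ (mcz.2 (e1.trans (pow_le_one₀ hκ.le (by linarith))))).trans ?_
      rw [← hqk]
      gcongr
    obtain ⟨M, h⟩ := ITER (q := q) (B := C * F / (q - s)) (F := F) dc hκ hv hq0.le hB (by rw [div_mul_cancel₀ _ hqs.ne'])
      hM k hm (fun k _ => (hk k).trans (by nlinarith only [hqk1 k, hWε, hW0])) k le_rfl
    exact ⟨M, h.mono (hk k)⟩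
  choose N hN using hM'
  have hd : ∀ k, dist (N k) (N (k+1)) ≤ 8 * κ⁻¹ ^ 2 * W * q ^ k := fun k => by
    have h1 := ((hN k).sc (t := κ ^ (k+1)) pp (pow_le_pow_of_le_one hκ.le (by linarith) (by omega))).diff (hN (k+1))
    rw [dist_eq_norm]
    refine h1.trans ?_
    have e1 : κ ^ k / κ ^ (k+1) = κ⁻¹ := by rw [pow_succ]; field_simp
    have e2 : 1 ≤ κ⁻¹ ^ 2 := one_le_pow₀ ((one_le_inv₀ hκ).2 (by linarith))
    have e3 : W * q ^ (k+1) ≤ W * q ^ k := mll (pow_le_pow_of_le_one hq0.le hq1.le (by omega)) hW0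
    have e4 : 0 ≤ W * q ^ k := pp
    rw [e1]; nlinarith only [e2, e3, e4, mul_nonneg e4 (sub_nonneg.2 e2)]
  have hlim : Tendsto N atTop (𝓝 (H 0)) := by
    rw [tendsto_iff_norm_sub_tendsto_zero]
    rw [Metric.tendsto_atTop]
    intro η hη
    obtain ⟨δ, hδ, hc⟩ := Metric.continuousAt_iff.1 (hv.cont.continuousAt (x := 0)) (η / 2) pp
    have t1 := (tendsto_pow_atTop_nhds_zero_of_lt_one hq0.le hq1).const_mul (4 * W)
    have t2 := tendsto_pow_atTop_nhds_zero_of_lt_one hκ.le (by linarith : κ < 1)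
    rw [mul_zero] at t1
    obtain ⟨k0, h0⟩ := eventually_atTop.1 ((t1.eventually_lt_const (pp : 0 < η / 2)).and (t2.eventually_lt_const hδ))
    refine ⟨k0, fun k hk => ?_⟩
    obtain ⟨a1, a2⟩ := h0 k hk
    have := SD (hv.rs 0 (pow_pos hκ k)).c2 (N := H 0) (hv.ell 0).sym (pp : 0 ≤ η / 2) pp (fun x hx => ?_) (hN k)
    · rw [dist_zero_right, norm_norm]; linarith
    · rw [← dist_eq_norm]
      refine (hc ?_).le
      rw [mcz] at hx
      rw [dist_zero_right, zero_add, norm_smul, rnn pp]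
      exact (mul_le_of_le_one_right pp hx).trans_lt a2
  intro t ht ht1
  obtain ⟨k, k1, k2⟩ := exists_nat_pow_near_of_lt_one ht ht1 hκ (by linarith : κ < 1)
  have hd' := dist_le_of_le_geometric_of_tendsto _ _ hq1 hd hlim k
  rw [dist_eq_norm] at hd'
  refine (((hN k).chg (hv.ell 0).sym).sc ht k2).mono ?_
  have e1 : κ ^ k / t ≤ κ⁻¹ := by rw [div_le_iff₀ ht, inv_mul_eq_div, le_div_iff₀ hκ, ← pow_succ]; exact k1.le
  have e2 : q ^ k ≤ q⁻¹ * t ^ α := by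
    rw [inv_mul_eq_div, le_div_iff₀ hq0, ← pow_succ, ← hqk]
    exact Real.rpow_le_rpow pp k1.le hα.le
  have e3 : W * q ^ k + ‖N k - H 0‖ ≤ W * (1 + J) * (q⁻¹ * t ^ α) := by
    have : 8 * κ⁻¹ ^ 2 * W * q ^ k / (1 - q) = W * J * q ^ k := by rw [hJ]; ring
    rw [this] at hd'
    refine le_trans ?_ (mll e2 pp)
    linarith
  exact (mul_le_mul (pow_le_pow_left₀ pp e1 2) e3 (add_nonneg pp (norm_nonneg _)) pp).trans_eq (by rw [hW]; ring)
theorem FFmk (hn : 2 ≤ n) {K : ℝ} (hK : 0 ≤ K) (h : ∀ x, |ldet (H x) - g0| ≤ K / (1 + ‖x‖)) :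
    ∃ ψ Pψ Gψ, FF H g0 K ψ Pψ Gψ := by
  have e : ∀ x : E n, qd 1 0 ((2:ℝ) • (1 : L n)) x = 1 + ‖x‖ ^ 2 := fun x => by
    simp only [qd, smul_apply, isl, one_apply_eq_self, rsq, inner_zero_left]; ring
  have hw : ∀ x : E n, 0 < qd 1 0 ((2:ℝ) • (1 : L n)) x := fun x => by rw [e]; positivity
  have hq := qd_C2 univ 1 (0 : E n) (Sy.smul1 2)
  have hc := ((hq.comp (f := Real.sqrt) (f' := fun t => (2 * √t)⁻¹) (f'' := fun t => -(4 * (t * √t))⁻¹) (fun x _ => by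
      simpa using Real.hasDerivAt_sqrt (hw x).ne') (fun x _ => by
      have := ((Real.hasDerivAt_sqrt (hw x).ne').const_mul 2).inv (by have := Real.sqrt_pos.2 (hw x); positivity)
      refine this.congr_deriv ?_
      rw [mul_pow, Real.sq_sqrt (hw x).le]; have := Real.sqrt_pos.2 (hw x); have := hw x; field_simp; norm_num) (by
      refine (ContinuousOn.inv₀ ?_ fun x _ => ?_).neg
      · exact continuousOn_const.mul (hq.c1.cw.mul (Real.continuous_sqrt.comp_continuousOn hq.c1.cw))
      · have := Real.sqrt_pos.2 (hw x); have := hw x; positivity)).smul K)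
  refine ⟨_, _, _, hc, fun x => ⟨?_, fun y => ?_⟩, fun x => (h x).trans ?_, fun x => by positivity, fun x => ?_⟩
  all_goals
    simp only [e, zero_add]
    have hs : 0 < √(1 + ‖x‖ ^ 2) := Real.sqrt_pos.2 pp
    have hs2 : √(1 + ‖x‖ ^ 2) ^ 2 = 1 + ‖x‖ ^ 2 := Real.sq_sqrt pp
    have hs1 : √(1 + ‖x‖ ^ 2) ≤ 1 + ‖x‖ := Real.sqrt_le_iff.2 ⟨pp, by nlinarith [norm_nonneg x]⟩
    set s := √(1 + ‖x‖ ^ 2)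
    clear_value s
    try rw [← hs2]
  · refine Sy.sm (Sy.add ((Sy.smul1 2).sm _) (Sy.sm (fun y z => ?_) _)) K
    simp only [ro_apply, isl, inner_smul_right]; rw [real_inner_comm y]; ring
  · simp only [smul_apply, add_apply, ro_apply, inner_add_left, isl, one_apply_eq_self, rsq]
    refine mul_nonneg hK ?_
    have := abs_real_inner_le_norm x y
    have h2 : ⟪x, y⟫ ^ 2 ≤ s ^ 2 * ‖y‖ ^ 2 := by
      rw [hs2]; nlinarith [sq_abs ⟪x, y⟫, abs_nonneg ⟪x, y⟫, sq_nonneg ‖y‖, pow_le_pow_left₀ (abs_nonneg _) this 2]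
    have : (2 * s)⁻¹ * (2 * ‖y‖ ^ 2) + -(4 * (s ^ 2 * s))⁻¹ * (2 * ⟪x, y⟫ * (2 * ⟪x, y⟫)) = (s ^ 2 * ‖y‖ ^ 2 - ⟪x, y⟫ ^ 2) * (s ^ 3)⁻¹ := by field_simp; ring
    rw [this]; exact mul_nonneg (by linarith) pp
  · have hr : tr (ro (((2:ℝ) • (1 : L n)) x) (((2:ℝ) • (1 : L n)) x)) = 4 * ‖x‖ ^ 2 := by
      rw [← one_mul (ro _ _), tr_ro]
      simp only [smul_apply, isl, inner_smul_right, one_apply_eq_self, rsq]; ring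
    rw [map_smul, map_add, map_smul, map_smul, map_smul, tr_one, hr]
    simp only [smul_eq_mul]
    rw [div_eq_mul_inv]
    refine mll (le_trans ((inv_le_inv₀ pp hs).2 hs1) ?_) hK
    have : (2 * s)⁻¹ * (2 * (n:ℝ)) + -(4 * (s ^ 2 * s))⁻¹ * (4 * ‖x‖ ^ 2) = ((n * s ^ 2 - ‖x‖ ^ 2) / s ^ 2) * s⁻¹ := by field_simp; ring
    rw [this]
    refine le_mul_of_one_le_left pp ?_
    rw [le_div_iff₀ pp]
    have : (2:ℝ) ≤ n := by exact_mod_cast hn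
    nlinarith [sq_nonneg ‖x‖]
  · exact mll hs1 hK
theorem HAp {P H} (hv : Sol l v P H) (hr : 0 < r) (hη : 0 ≤ η) (h : ∀ x ∈ closedBall y r, ‖H x - H y‖ ≤ η) : Ap (rs v y r) (H y) η := by
  refine ⟨(hv.ell y).sym, rs v y r 0, r⁻¹ • P (y + r • (0 : E n)), fun x hx => ?_⟩
  rw [mcz] at hx
  have hb : ∀ t ∈ Icc (0:ℝ) 1, |⟪(H (y + r • (0 + t • x)) - H y) x, x⟫| ≤ η * (‖x‖ * ‖x‖) := fun t ht => by
    refine inner_le_mn (h _ ?_) x x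
    rw [mem_closedBall, dist_eq_norm, add_sub_cancel_left, zero_add, smul_smul, norm_smul, rnn (mul_nonneg hr.le ht.1)]
    have := mul_le_one₀ ht.2 (norm_nonneg x) hx
    nlinarith
  have hc := ((hv.c2.rs y hr).sub (qd_C2 univ 0 0 (hv.ell y).sym))
  have h1 := tay (hc.add (qd_C2 univ 0 0 (Sy.smul1 η))) (x := 0) (h := x) fun t ht => by
    have := (abs_le.1 (hb t ht)).1
    simp only [sub_apply, add_apply, smul_apply, inner_sub_left, inner_add_left, isl, one_apply_eq_self, rsq] at this ⊢
    linarith [sq ‖x‖]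
  have h2 := tay ((hc.smul (-1)).add (qd_C2 univ 0 0 (Sy.smul1 η))) (x := 0) (h := x) fun t ht => by
    have := (abs_le.1 (hb t ht)).2
    simp only [sub_apply, add_apply, smul_apply, inner_sub_left, inner_add_left, isl, one_apply_eq_self, rsq] at this ⊢
    linarith [sq ‖x‖]
  have h3 : η * ‖x‖ ^ 2 ≤ η := mul_le_of_le_one_right hη (pow_le_one₀ (norm_nonneg x) hx)
  simp only [qd, zero_add, map_zero, inner_zero_left, inner_zero_right, smul_apply, isl, one_apply_eq_self, rsq, add_zero, sub_zero, mul_zero, neg_one_smul, inner_neg_left] at h1 h2 ⊢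
  rw [abs_le]; constructor <;> linarith
theorem MAINV (hn : 2 ≤ n) (hl : 0 < l) (hl1 : l ≤ 1) (hα : 0 < α) (hα1 : α < 1) (hζ : 0 < ζ) {P H} (hv : Sol l v P H)
    {K c : ℝ} (hK : 0 ≤ K) (hΓ : 0 < Γ) (hc : 0 < c) (hc1 : c ≤ 1) (h1 : ∀ x, |ldet (H x) - g0| ≤ K / (1 + ‖x‖))
    (h2 : ∀ x y, ‖x - y‖ ≤ 1 → |ldet (H x) - ldet (H y)| ≤ Γ * ‖x - y‖ ^ α)
    (h3 : ∀ y, R ≤ ‖y‖ → ∀ x ∈ closedBall y (c * ‖y‖), |ldet (H x) - ldet (H y)| ≤ Γ * ‖y‖ ^ (-(α + ζ)) * ‖x - y‖ ^ α) :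
    ∃ A r0 D C, Sy A ∧ 1 ≤ r0 ∧ 0 < C ∧ (∀ r, r0 ≤ r → Ap (rs v 0 r) A (D / r)) ∧
      (∀ y, 1 ≤ ‖y‖ → ‖H y - A‖ ≤ C * ‖y‖ ^ (-(min 1 ζ))) ∧ ∀ x y, ‖H x - H y‖ ≤ C * ‖x - y‖ ^ α := by
  obtain ⟨ψ, Pψ, Gψ, hψ⟩ := FFmk hn hK h1
  obtain ⟨A, r0, D, hA, hr0, hD, hfar⟩ := FARA (by omega) hl hl1 hv hψ hK
  obtain ⟨ε, C, hε, hC, pw⟩ := PW (n := n) (by omega) hl hl1 hα hα1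
  have hH1 : ∀ y, ‖H y‖ ≤ 1 := fun y => (hv.ell y).norm_le hl.le zero_le_one
  set θ := min 1 ζ with hθ
  have hθ0 : 0 < θ := lt_min one_pos hζ
  set B := 2 * D / c ^ 2 + Γ with hB
  have hB0 : 0 < B := pp
  set R1 := max (max 1 R) r0
  have hR1 : 1 ≤ R1 := (le_max_left _ _).trans (le_max_left _ _)
  set m := min (ε / B) (R1 ^ (-θ)) with hm
  have hm0 : 0 < m := lt_min pp (Real.rpow_pos_of_pos (by linarith) _)
  have c1 : ∀ y, 1 ≤ ‖y‖ → ‖H y - A‖ ≤ (4 * ((1 + C) * B) + (1 + ‖A‖) / m) * ‖y‖ ^ (-θ) := by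
    intro y hy
    have hy0 : 0 < ‖y‖ := by linarith
    have hp : 0 < ‖y‖ ^ (-θ) := Real.rpow_pos_of_pos hy0 _
    have hA0 := norm_nonneg A
    rw [add_mul]
    by_cases hc' : m ≤ ‖y‖ ^ (-θ)
    · have : 1 + ‖A‖ ≤ (1 + ‖A‖) / m * ‖y‖ ^ (-θ) := by rw [div_mul_eq_mul_div, le_div_iff₀ hm0]; gcongr
      have h4 := (norm_sub_le (H y) A).trans (add_le_add_left (hH1 y) _)
      have : 0 ≤ 4 * ((1 + C) * B) * ‖y‖ ^ (-θ) := pp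
      linarith
    · push Not at hc'
      have a1 := hc'.trans_le (min_le_left _ _)
      have a2 := hc'.trans_le (min_le_right _ _)
      have a3 : R1 < ‖y‖ := (Real.rpow_lt_rpow_iff_of_neg hy0 (by linarith) (by linarith)).1 a2
      have hR : R ≤ ‖y‖ := ((le_max_right _ _).trans (le_max_left _ _)).trans a3.le
      have hr : r0 ≤ 2 * ‖y‖ := by linarith [(le_max_right (max 1 R) r0).trans a3.le]
      have b1 := (hfar _ hr).sub (z := (2 * ‖y‖)⁻¹ • y) (r := c / 2) pp (by
        rw [norm_smul, norm_inv, rnn pp]; rw [mul_inv, mul_assoc, inv_mul_cancel₀ hy0.ne']; linarith)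
      rw [rs_rsz, smul_smul, mul_inv_cancel₀ pp, one_smul, zero_add] at b1
      have e1 : 2 * ‖y‖ * (c / 2) = c * ‖y‖ := by ring
      rw [e1] at b1
      have q1 : ‖y‖⁻¹ ≤ ‖y‖ ^ (-θ) := by
        rw [← Real.rpow_neg_one]; exact Real.rpow_le_rpow_of_exponent_le hy (neg_le_neg (min_le_left _ _))
      have q2 : ‖y‖ ^ (-ζ) ≤ ‖y‖ ^ (-θ) := Real.rpow_le_rpow_of_exponent_le hy (neg_le_neg (min_le_right _ _))
      have e2 : ((c / 2) ^ 2)⁻¹ * (D / (2 * ‖y‖)) + Γ * ‖y‖ ^ (-ζ) ≤ B * ‖y‖ ^ (-θ) := by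
        have : ((c / 2) ^ 2)⁻¹ * (D / (2 * ‖y‖)) = 2 * D / c ^ 2 * ‖y‖⁻¹ := by field_simp
        rw [this, hB, add_mul]; gcongr
      have hcy : 0 < c * ‖y‖ := pp
      have b2 := pw _ _ _ (hv.rs y hcy) (Γ * ‖y‖ ^ (-ζ)) pp (fun x hx => by
        rw [mcz] at hx
        rw [smul_zero, add_zero]
        refine (h3 y hR _ ?_).trans ?_
        · rw [mem_closedBall, dist_eq_norm, add_sub_cancel_left, norm_smul, rnn hcy.le]; exact mul_le_of_le_one_right hcy.le hx
        · rw [add_sub_cancel_left, norm_smul, rnn hcy.le, mul_assoc Γ, mul_assoc Γ]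
          refine mll ?_ hΓ.le
          rw [mul_assoc, Real.mul_rpow hc.le pp, Real.mul_rpow hy0.le (norm_nonneg _), neg_add, add_comm, Real.rpow_add hy0]
          have u1 : c ^ α ≤ 1 := Real.rpow_le_one hc.le hc1 hα.le
          have u2 : ‖y‖ ^ (-α) * ‖y‖ ^ α = 1 := by rw [← Real.rpow_add hy0, neg_add_cancel, Real.rpow_zero]
          have u3 : 0 ≤ ‖y‖ ^ (-ζ) * ‖x‖ ^ α := pp
          calc _ = c ^ α * (‖y‖ ^ (-α) * ‖y‖ ^ α) * (‖y‖ ^ (-ζ) * ‖x‖ ^ α) := by ring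
            _ ≤ _ := by rw [u2, mul_one]; exact mul_le_of_le_one_left u3 u1) A _ b1
        (e2.trans (by rw [lt_div_iff₀ hB0] at a1; linarith)) 1 one_pos le_rfl
      rw [rs_one, Real.one_rpow, mul_one, smul_zero, add_zero] at b2
      have b3 := b2.diff b1
      have b4 := mll e2 hC.le
      have : 0 ≤ (1 + ‖A‖) / m * ‖y‖ ^ (-θ) := pp
      have : 0 ≤ Γ * ‖y‖ ^ (-ζ) := pp
      linarith
  have hlim : Tendsto H (cocompact _) (𝓝 A) := by
    rw [tendsto_iff_norm_sub_tendsto_zero]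
    have t1 := ((tendsto_rpow_neg_atTop hθ0).comp (tendsto_norm_cocompact_atTop (E := E n))).const_mul (4 * ((1 + C) * B) + (1 + ‖A‖) / m)
    rw [mul_zero] at t1
    refine squeeze_zero' (Eventually.of_forall fun _ => norm_nonneg _) ?_ t1
    exact ((tendsto_norm_cocompact_atTop (E := E n)).eventually_ge_atTop 1).mono fun y hy => c1 y hy
  have huc := hv.cont.uniformContinuous_of_tendsto_cocompact hlim
  obtain ⟨δ, hδ, hu⟩ := Metric.uniformContinuous_iff.1 huc (ε / 2) pp
  set r := min (min (δ / 2) 1) ((ε / (2 * Γ)) ^ α⁻¹) with hr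
  have hr0' : 0 < r := lt_min (lt_min pp one_pos) (Real.rpow_pos_of_pos pp _)
  have hra : Γ * r ^ α ≤ ε / 2 := by
    have := Real.rpow_le_rpow hr0'.le (min_le_right (min (δ / 2) 1) ((ε / (2 * Γ)) ^ α⁻¹)) hα.le
    rw [Real.rpow_inv_rpow pp hα.ne', le_div_iff₀ pp] at this
    linarith
  have hrd : r < δ := (min_le_left _ _).trans_lt ((min_le_left _ _).trans_lt (by linarith))
  have hr1 : r ≤ 1 := (min_le_left _ _).trans (min_le_right _ _)
  have hap : ∀ y t, 0 < t → t ≤ 1 → Ap (rs v y (r * t)) (H y) (C * ε * t ^ α) := fun y t ht ht1 => by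
    have b := pw _ _ _ (hv.rs y hr0') (Γ * r ^ α) pp (fun x hx => by
      rw [mcz] at hx
      have e : ‖y + r • x - (y + r • (0 : E n))‖ = r * ‖x‖ := by rw [smul_zero, add_zero, add_sub_cancel_left, norm_smul, rnn hr0'.le]
      refine (h2 _ _ ?_).trans_eq ?_
      · rw [e]; exact mul_le_one₀ hr1 (norm_nonneg _) hx
      · rw [e, Real.mul_rpow hr0'.le (norm_nonneg _)]; ring) (H y) (ε / 2) (HAp hv hr0' pp fun x hx => by
        rw [← dist_eq_norm]; exact (hu (lt_of_le_of_lt (mem_closedBall.1 hx) hrd)).le) (by linarith) t ht ht1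
    rw [rs_rs, smul_zero, add_zero] at b
    exact b.mono (by gcongr; linarith)
  set C2 := (20 * (C * ε) + 2) * (2 / r) ^ α
  have c2 : ∀ x y, ‖H x - H y‖ ≤ C2 * ‖x - y‖ ^ α := fun x y => by
    rcases eq_or_ne x y with rfl | hxy
    · rw [sub_self, norm_zero]; positivity
    set d := ‖x - y‖ with hd
    have hd0 : 0 < d := norm_pos_iff.2 (sub_ne_zero.2 hxy)
    have e1 : C2 * d ^ α = (20 * (C * ε) + 2) * (2 * d / r) ^ α := by
      rw [mul_div_right_comm, Real.mul_rpow pp hd0.le]; ring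
    rw [e1]
    by_cases h : 2 * d ≤ r
    · have a1 := hap x (2 * d / r) pp ((div_le_one hr0').2 h)
      have a2 := hap y (d / r) pp ((div_le_one hr0').2 (by linarith))
      rw [mul_div_cancel₀ _ hr0'.ne'] at a1 a2
      have a3 := a1.sub (z := (2 * d)⁻¹ • (y - x)) (r := 1 / 2) nm (by
        rw [norm_smul, norm_inv, rnn pp, norm_sub_rev, ← hd]; field_simp; norm_num)
      rw [rs_rsz, smul_smul, mul_inv_cancel₀ pp, one_smul, add_sub_cancel, mul_one_div, mul_div_cancel_left₀ _ nm] at a3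
      refine (a3.diff a2).trans ?_
      have : (d / r) ^ α ≤ (2 * d / r) ^ α := Real.rpow_le_rpow pp (by gcongr; linarith) hα.le
      have := mll this (pp : 0 ≤ C * ε)
      have : 0 ≤ (2 * d / r) ^ α := pp
      norm_num; linarith
    · have : 1 ≤ (2 * d / r) ^ α := Real.one_le_rpow ((one_le_div hr0').2 (by linarith)) hα.le
      have h4 := (norm_sub_le (H x) (H y)).trans (add_le_add (hH1 x) (hH1 y))
      have : 0 ≤ C * ε * (2 * d / r) ^ α := pp
      linarith
  have hC2 : 0 < C2 := pp
  have hA0 := norm_nonneg A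
  have hS : 0 < 4 * ((1 + C) * B) + (1 + ‖A‖) / m := pp
  refine ⟨A, r0, D, _, hA, hr0, add_pos hS hC2, hfar, fun y hy => (c1 y hy).trans ?_, fun x y => (c2 x y).trans ?_⟩
  · exact mlr (le_add_of_nonneg_right hC2.le) pp
  · gcongr; exact le_add_of_nonneg_left hS.le
theorem dg_lin (b : OrthonormalBasis (Fin n) ℝ (E n)) (c : Fin n → ℝ) (p q : ℝ) : p • (1 : L n) + q • dg b c = dg b fun i => p + q * c i :=
  ext_b b fun i => by simp [dg_b, add_smul, smul_smul]
theorem HX (hμ : 0 < μ) (h : Ell μ m X) (hd : lam ≤ (1 - μ • inv X).det) : Ell lam 1 (1 - μ • inv X) := by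
  obtain ⟨b, c, rfl, h1, -⟩ := h.exists_dg
  have h0 : ∀ i, 0 < c i := fun i => hμ.trans_le (h1 i)
  have e : 1 - μ • inv (dg b c) = dg b fun i => 1 + -μ * (c i)⁻¹ := by
    rw [dg_inv b fun i => (h0 i).ne', ← dg_lin, one_smul, neg_smul, sub_eq_add_neg]
  rw [e, dg_det] at hd
  rw [e]
  have a1 : ∀ i, 1 + -μ * (c i)⁻¹ ≤ 1 := fun i => by have := mul_pos hμ (inv_pos.2 (h0 i)); linarith
  have a0 : ∀ i, 0 ≤ 1 + -μ * (c i)⁻¹ := fun i => by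
    have : μ * (c i)⁻¹ ≤ 1 := by rw [← div_eq_mul_inv]; exact (div_le_one (h0 i)).2 (h1 i)
    linarith
  refine dg_ell b _ (fun i => hd.trans ?_) a1
  rw [← Finset.mul_prod_erase _ _ (Finset.mem_univ i)]
  exact mul_le_of_le_one_right (a0 i) (Finset.prod_le_one (fun j _ => a0 j) fun j _ => a1 j)
theorem LEG {Q G} (hw : C2 univ w Q G) {C1 : ℝ} (hμ : 0 < μ) (hlo : ∀ x h, μ * ‖h‖ ^ 2 ≤ ⟪G x h, h⟫) (hC1 : 0 < C1)
    (hgr : ∀ x, w x ≤ C1 * (1 + ‖x‖ ^ 2)) (hdet : ∀ x, lam ≤ (1 - μ • inv (G x)).det) :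
    ∃ (v : E n → ℝ) (X : E n → E n) (c K η : ℝ), 0 < c ∧ 0 < η ∧ Sol lam v (fun y => y - μ • X y) (fun y => 1 - μ • inv (G (X y))) ∧ (∀ x, X (Q x) = x) ∧ (∀ y, Q (X y) = y) ∧
      (∀ y z, ‖X y - X z‖ ≤ μ⁻¹ * ‖y - z‖) ∧ (∀ y, c * (1 + ‖y‖) ≤ 1 + ‖X y‖) ∧ ∀ y, v y ≤ (1 / 2 - η) * ‖y‖ ^ 2 + K := by
  have hE : ∀ x, Ell μ ‖G x‖ (G x) := fun x => ⟨fun y z => hw.sym isOpen_univ trivial y z, hlo x, fun h => (le_abs_self _).trans ((inner_le_mn le_rfl h h).trans_eq (by ring))⟩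
  have hcv : ∀ x h, w x + ⟪Q x, h⟫ + μ / 2 * ‖h‖ ^ 2 ≤ w (x + h) := fun x h => by
    have := tay (hw.sub (qd_C2 univ 0 0 (Sy.smul1 μ))) (x := x) (h := h) fun t _ => by
      have := hlo (x + t • h) h
      simp only [sub_apply, smul_apply, inner_sub_left, isl, one_apply_eq_self, rsq]; linarith
    simp only [qd, zero_add, smul_apply, inner_sub_left, inner_add_left, inner_add_right, inner_zero_left, isl, one_apply_eq_self, rsq, real_inner_comm x h] at this
    linarith
  have hmon : ∀ x y, μ * ‖x - y‖ ≤ ‖Q x - Q y‖ := fun x y => by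
    have h1 := hcv x (y - x)
    have h2 := hcv y (x - y)
    rw [add_sub_cancel] at h1 h2
    have h3 := real_inner_le_norm (Q x - Q y) (x - y)
    have e : ⟪Q x, y - x⟫ = - ⟪Q x, x - y⟫ := by rw [← inner_neg_right, neg_sub]
    rw [e, norm_sub_rev] at h1
    rw [inner_sub_left] at h3
    rcases (norm_nonneg (x - y)).eq_or_lt with h0 | h0
    · rw [← h0, mul_zero]; positivity
    · nlinarith
  have hsur : ∀ y, ∃ x, Q x = y := fun y => by
    have hc := hw.sub (qd_C2 univ 0 y (Sy.smul1 (n := n) 0))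
    have ht : Tendsto (fun x => w x - qd 0 y ((0:ℝ) • (1 : L n)) x) (cocompact _) atTop := by
      have t : Tendsto (fun x : E n => w 0 + ‖x‖ * (μ / 2 * ‖x‖ - ‖Q 0 - y‖)) (cocompact _) atTop :=
        tendsto_atTop_add_const_left _ _ ((tendsto_norm_cocompact_atTop (E := E n)).atTop_mul_atTop₀
          (tendsto_atTop_add_const_right _ _ ((tendsto_norm_cocompact_atTop (E := E n)).const_mul_atTop (pp : 0 < μ / 2))))
      refine tendsto_atTop_mono (fun x => ?_) t
      have h1 := hcv 0 x
      have h2 := abs_le.1 (abs_real_inner_le_norm (Q 0 - y) x)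
      simp only [qd, zero_smul, zero_apply, inner_zero_left, inner_sub_left, zero_add] at h1 h2 ⊢
      nlinarith [h2.1]
    obtain ⟨x, hx⟩ := hc.cw.exists_forall_le ht
    refine ⟨x, ?_⟩
    have := IsLocalMin.hasFDerivAt_eq_zero (f := fun x => w x - qd 0 y ((0:ℝ) • (1 : L n)) x) (Eventually.of_forall hx) (hc.d1 x trivial)
    have h2 := congrArg (fun f : E n →L[ℝ] ℝ => f (Q x - y)) this
    simp only [gr_apply, zero_smul, zero_apply, add_zero] at h2
    exact sub_eq_zero.1 (inner_self_eq_zero.1 h2)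
  choose X hX using hsur
  have hl : ∀ y z, ‖X y - X z‖ ≤ μ⁻¹ * ‖y - z‖ := fun y z => by
    have := hmon (X y) (X z)
    rw [hX, hX] at this; rwa [inv_mul_eq_div, le_div_iff₀ hμ, mul_comm]
  have hXQ : ∀ x, X (Q x) = x := fun x => by
    have := hmon (X (Q x)) x
    rw [hX, sub_self, norm_zero] at this
    exact sub_eq_zero.1 (norm_le_zero_iff.1 (by nlinarith [norm_nonneg (X (Q x) - x)]))
  have hXc : Continuous X := (LipschitzWith.of_dist_le_mul (K := ⟨μ⁻¹, pp⟩) fun y z => by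
    rw [dist_eq_norm, dist_eq_norm]; exact hl y z).continuous
  have hXd : ∀ y, HasFDerivAt X (inv (G (X y))) y := fun y => by
    obtain ⟨u, hu⟩ := (hE (X y)).isUnit hμ
    have h := HasFDerivAt.of_local_left_inverse (f := Q) (f' := ContinuousLinearEquiv.unitsEquiv ℝ (E n) u) (g := X) (a := y) hXc.continuousAt
      ((hw.d2 (X y) trivial).congr_fderiv hu.symm) (Eventually.of_forall hX)
    refine h.congr_fderiv ?_
    rw [← hu, inv, Ring.inverse_unit]; rfl
  have hic : Continuous fun x => inv (G x) := continuous_iff_continuousAt.2 fun x => (inv_contAt (hE x) hμ).comp hw.cG.continuousAt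
  set ws : E n → ℝ := fun y => ⟪y, X y⟫ - w (X y) with hws
  have hwd : ∀ y, HasFDerivAt ws (gr (X y)) y := fun y => by
    refine hfd (((hasFDerivAt_id y).inner ℝ (hXd y)).sub ((hw.d1 (X y) trivial).comp y (hXd y))) fun k => ?_
    simp [gr_apply, hX, real_inner_comm]
  have hq := qd_C2 univ (0:ℝ) (0 : E n) (Sy.smul1 1)
  have hcs : C2 univ ws X fun y => inv (G (X y)) := ⟨fun y _ => hwd y, fun y _ => hXd y, (hic.comp hXc).continuousOn⟩
  have hv := hq.sub (hcs.smul μ)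
  simp only [one_smul, one_apply_eq_self, zero_add] at hv
  have hdual : ∀ y x, ⟪y, x⟫ - w x ≤ ws y := fun y x => by
    have := hcv (X y) (x - X y)
    rw [hX, add_sub_cancel, inner_sub_right] at this
    have : 0 ≤ μ / 2 * ‖x - X y‖ ^ 2 := pp
    simp only [hws]; linarith
  have hbig : ∀ y, (4 * C1)⁻¹ * ‖y‖ ^ 2 - C1 ≤ ws y := fun y => by
    have h1 := hdual y ((2 * C1)⁻¹ • y)
    have h2 := hgr ((2 * C1)⁻¹ • y)
    rw [norm_smul, rnn pp, mul_pow] at h2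
    rw [inner_smul_right, rsq] at h1
    have : (2 * C1)⁻¹ * ‖y‖ ^ 2 - C1 * (1 + (2 * C1)⁻¹ ^ 2 * ‖y‖ ^ 2) = (4 * C1)⁻¹ * ‖y‖ ^ 2 - C1 := by field_simp; ring
    linarith
  set c0 := (4 * C1)⁻¹
  have hc0 : 0 < c0 := pp
  set D := C1 + |w 0| + ‖Q 0‖ ^ 2 / (2 * μ)
  have hD : 0 ≤ D := pp
  refine ⟨_, X, c0 / (1 + 2 * c0 + D), μ * C1, μ * c0, pp, pp, ⟨hv, fun y => HX hμ (hE _) (hdet _)⟩, hXQ, hX, hl, fun y => ?_, fun y => ?_⟩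
  · rw [div_mul_eq_mul_div, div_le_iff₀ pp]
    have hy := norm_nonneg y
    have hx := norm_nonneg (X y)
    rcases le_total ‖y‖ 1 with h | h
    · nlinarith
    · have h1 := hcv 0 (X y)
      rw [zero_add] at h1
      have h2 := (abs_le.1 (abs_real_inner_le_norm (Q 0) (X y))).1
      have h3 : -(‖Q 0‖ ^ 2 / (2 * μ)) ≤ -(‖Q 0‖ * ‖X y‖) + μ / 2 * ‖X y‖ ^ 2 := by
        have : -(‖Q 0‖ * ‖X y‖) + μ / 2 * ‖X y‖ ^ 2 = (‖Q 0‖ - μ * ‖X y‖) ^ 2 / (2 * μ) - ‖Q 0‖ ^ 2 / (2 * μ) := by field_simp; ring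
        rw [this]; have : 0 ≤ (‖Q 0‖ - μ * ‖X y‖) ^ 2 / (2 * μ) := pp
        linarith
      have h4 := hbig y
      have h5 := real_inner_le_norm y (X y)
      have h6 := neg_abs_le (w 0)
      have h7 : c0 * ‖y‖ ^ 2 ≤ ‖y‖ * ‖X y‖ + D := by simp only [hws] at h4; simp only [D]; linarith
      have h8 : c0 * ‖y‖ ≤ ‖X y‖ + D := by
        by_contra! hh
        have : (‖X y‖ + D) * ‖y‖ < c0 * ‖y‖ * ‖y‖ := by gcongr
        nlinarith only [this, h7, hD, h]
      nlinarith only [h8, hc0, hD, hx, mul_nonneg hc0.le hx, mul_nonneg hD hx]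
  · have := mll (hbig y) hμ.le
    simp only [qd, one_smul, one_apply_eq_self, rsq, inner_zero_left, zero_add] at this ⊢
    linarith
abbrev op (M : Matrix (Fin n) (Fin n) ℝ) : L n := Matrix.toEuclideanCLM (𝕜 := ℝ) M
theorem op_ij (M : Matrix (Fin n) (Fin n) ℝ) (i j : Fin n) : op M (EuclideanSpace.single j 1) i = M i j := by
  simp [op]
theorem op_le (M : Matrix (Fin n) (Fin n) ℝ) (i j : Fin n) : |M i j| ≤ ‖op M‖ := by
  rw [← op_ij M]
  refine (PiLp.norm_apply_le (p := 2) (op M (EuclideanSpace.single j 1)) i).trans (((op M).le_opNorm _).trans_eq ?_)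
  simp
theorem op_dg {M : Matrix (Fin n) (Fin n) ℝ} (hM : M.IsHermitian) : op M = dg hM.eigenvectorBasis hM.eigenvalues :=
  ext_b hM.eigenvectorBasis fun i => by
    rw [dg_b]
    exact congrArg (WithLp.toLp 2) (hM.mulVec_eigenvectorBasis i)
theorem op_pd {M : Matrix (Fin n) (Fin n) ℝ} (hM : M.IsHermitian) (t : ℝ) : (M - t • (1 : Matrix (Fin n) (Fin n) ℝ)).PosDef ↔ ∀ h ≠ 0, t * ‖h‖ ^ 2 < ⟪op M h, h⟫ := by
  have e : ∀ h : E n, star h.ofLp ⬝ᵥ ((M - t • (1 : Matrix (Fin n) (Fin n) ℝ)).mulVec h.ofLp) = ⟪op M h, h⟫ - t * ‖h‖ ^ 2 := fun h => by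
    rw [star_trivial, ← Matrix.inner_toEuclideanCLM, map_sub, map_smul, map_one, real_inner_comm]
    simp only [sub_apply, smul_apply, inner_sub_left, isl, one_apply_eq_self, rsq]
  rw [Matrix.posDef_iff_dotProduct_mulVec]
  refine ⟨fun h x hx => ?_, fun h => ⟨hM.sub ?_, fun x hx => ?_⟩⟩
  · have := h.2 (x := x.ofLp) (by simpa using hx)
    rw [e] at this; linarith
  · simp [Matrix.IsHermitian]
  · have := h (WithLp.toLp 2 x) (by simpa using hx)
    have e := e (WithLp.toLp 2 x)
    simp only at e; rw [e]; linarith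
theorem KEY {M : Matrix (Fin n) (Fin n) ℝ} (hM : M.IsHermitian) (hb : 0 < b) (h : ∀ h ≠ 0, (-a + b) * ‖h‖ ^ 2 < ⟪op M h, h⟫) :
    0 < (1 - (2 * b) • inv (op M + (a + b) • 1)).det ∧
    ldet (1 - (2 * b) • inv (op M + (a + b) • 1)) = ∑ i, Real.log ((hM.eigenvalues i + a - b) / (hM.eigenvalues i + a + b)) := by
  set B := hM.eigenvectorBasis
  set c := hM.eigenvalues with hc
  have h1 : ∀ i, 0 < c i + a - b := fun i => by
    have := h (B i) (B.orthonormal.ne_zero i)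
    rw [op_dg hM, ← dg_val] at this
    simp at this; linarith
  have h2 : ∀ i, 0 < c i + a + b := fun i => by linarith [h1 i]
  have e1 : op M + (a + b) • 1 = dg B fun i => a + b + 1 * c i := by rw [← dg_lin, one_smul, ← op_dg hM, add_comm]
  have e2 : 1 - (2 * b) • inv (op M + (a + b) • 1) = dg B fun i => (c i + a - b) / (c i + a + b) := by
    rw [e1, dg_inv B fun i => by linarith [h2 i], sub_eq_add_neg, ← neg_smul]
    have := dg_lin B (fun i => (a + b + 1 * c i)⁻¹) 1 (-(2 * b))
    rw [one_smul] at this; rw [this]; congr 1; ext i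
    have := h2 i
    rw [show a + b + 1 * c i = c i + a + b by ring]; field_simp; ring
  rw [ldet, e2, dg_det]
  exact ⟨Finset.prod_pos fun i _ => div_pos (h1 i) (h2 i), Real.log_prod fun i _ => (div_pos (h1 i) (h2 i)).ne'⟩
theorem hess_C2 {u : E n → ℝ} (hu : ContDiff ℝ 2 u) (hs : ∀ x, (hess u x).IsHermitian) : ∃ P, C2 univ u P fun x => op (hess u x) := by
  let e : Fin n → E n := fun i => EuclideanSpace.single i 1
  let Φ : (E n →L[ℝ] ℝ) →L[ℝ] E n := ∑ i, (ContinuousLinearMap.apply ℝ ℝ (e i)).smulRight (e i)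
  have hΦ : ∀ φ i, Φ φ i = φ (e i) := fun φ i => by simp [Φ, e, sum_apply, Pi.single_apply]
  have hgr : ∀ φ, gr (Φ φ) = φ := fun φ => by
    have : (gr (Φ φ) : E n →ₗ[ℝ] ℝ) = φ := (EuclideanSpace.basisFun (Fin n) ℝ).toBasis.ext fun i => by
      simpa [gr_apply, EuclideanSpace.inner_single_right] using hΦ φ i
    ext1 x; exact congrArg (fun f : E n →ₗ[ℝ] ℝ => f x) this
  have hd : ContDiff ℝ 1 (fderiv ℝ u) := hu.fderiv_right le_rfl
  have hG : ∀ x, Φ ∘L fderiv ℝ (fderiv ℝ u) x = op (hess u x) := fun x => ext_b (EuclideanSpace.basisFun (Fin n) ℝ) fun j => by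
    ext i
    rw [EuclideanSpace.basisFun_apply, op_ij, ← (hs x).apply i j]
    simp only [ContinuousLinearMap.comp_apply, hΦ, hess, Matrix.of_apply, iteratedFDeriv_two_apply]
    simp [e]
  refine ⟨fun x => Φ (fderiv ℝ u x), fun x _ => ?_, fun x _ => ?_, ?_⟩
  · rw [hgr]; exact (hu.differentiable nm).differentiableAt.hasFDerivAt
  · rw [← hG]; exact Φ.hasFDerivAt.comp x (hd.differentiable nm).differentiableAt.hasFDerivAt
  · simp only [← hG]
    exact (continuous_const.clm_comp (hd.continuous_fderiv nm)).continuousOn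
theorem GF {ζ' : ℝ} (hα : 0 < α) (hζ : 1 < ζ) (hζ' : 0 < ζ')
    (hh : ∀ K : Set (E n), IsCompact K → ∃ C : ℝ, ∀ x ∈ K, ∀ y ∈ K, |f x - f y| ≤ C * ‖x - y‖ ^ α)
    (hd : ∃ C R : ℝ, 0 < C ∧ 0 < R ∧ ∀ x : E n, R ≤ ‖x‖ → ‖x‖ ^ ζ * |f x - g0| ≤ C ∧
      ∀ y ∈ closedBall x (‖x‖ / 2), ∀ z ∈ closedBall x (‖x‖ / 2), ‖x‖ ^ (α + ζ') * |f y - f z| ≤ C * ‖y - z‖ ^ α) :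
    ∃ K Γ R : ℝ, 0 ≤ K ∧ 0 < Γ ∧ 0 < R ∧ (∀ x, |f x - g0| ≤ K / (1 + ‖x‖)) ∧ (∀ x y, |f x - f y| ≤ Γ * ‖x - y‖ ^ α) ∧
      ∀ y, R ≤ ‖y‖ → ∀ x ∈ closedBall y (‖y‖ / 2), |f x - f y| ≤ Γ * ‖y‖ ^ (-(α + ζ')) * ‖x - y‖ ^ α := by
  obtain ⟨C, R, hC, hR, hd⟩ := hd
  obtain ⟨C1, h1⟩ := hh (closedBall 0 (R + 3)) (icb _ _)
  set S := |C1| * (R + 3) ^ α + |f 0 - g0|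
  have hS : 0 ≤ S := pp
  set K := S * (1 + (R + 3)) + 2 * C
  have hK : 0 ≤ K := pp
  have hk : ∀ x, |f x - g0| ≤ K / (1 + ‖x‖) := fun x => by
    have hx := norm_nonneg x
    rw [le_div_iff₀ pp]
    rcases le_total ‖x‖ (R + 3) with h | h
    · have e := h1 x (by simpa using h) 0 (by simp; positivity)
      rw [sub_zero] at e
      have : |f x - g0| ≤ S := (abs_sub_le _ (f 0) _).trans (add_le_add_left (e.trans (by gcongr; exact le_abs_self _)) _)
      calc _ ≤ S * (1 + (R + 3)) := by gcongr
        _ ≤ K := by simp only [K]; linarith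
    · have e := (hd x (by linarith)).1
      have : ‖x‖ ≤ ‖x‖ ^ ζ := by simpa using Real.rpow_le_rpow_of_exponent_le (by linarith : 1 ≤ ‖x‖) hζ.le
      have e2 := mlr this (abs_nonneg (f x - g0))
      have : 0 ≤ (‖x‖ - 1) * |f x - g0| := mul_nonneg (by linarith) (abs_nonneg _)
      have : 0 ≤ S * (1 + (R + 3)) := pp
      simp only [K]; linarith
  have h3 : ∀ y, R ≤ ‖y‖ → ∀ x ∈ closedBall y (‖y‖ / 2), |f x - f y| ≤ C * ‖y‖ ^ (-(α + ζ')) * ‖x - y‖ ^ α := fun y hy x hx => by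
    have := (hd y hy).2 x hx y (by simp; positivity)
    rw [Real.rpow_neg (norm_nonneg _), mul_right_comm, ← div_eq_mul_inv, le_div_iff₀ (Real.rpow_pos_of_pos (hR.trans_le hy) _)]
    linarith
  refine ⟨K, 2 * K + |C1| + C, R, hK, pp, hR, hk, fun x y => ?_, fun y hy x hx => (h3 y hy x hx).trans ?_⟩
  · have hp : 0 ≤ ‖x - y‖ ^ α := pp
    have a1 : 0 ≤ K * ‖x - y‖ ^ α := pp
    have a2 : 0 ≤ |C1| * ‖x - y‖ ^ α := pp
    have a3 : 0 ≤ C * ‖x - y‖ ^ α := pp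
    rcases le_total 1 ‖x - y‖ with h | h
    · have k : ∀ z, |f z - g0| ≤ K := fun z => (hk z).trans (div_le_self hK (by linarith [norm_nonneg z]))
      have k2 := abs_sub_le (f x) g0 (f y)
      rw [abs_sub_comm g0] at k2
      have := mll (Real.one_le_rpow h hα.le) hK
      linarith [k x, k y]
    · rcases le_total ‖y‖ (R + 2) with h' | h'
      · have := h1 x (by
          have := norm_le_norm_add_norm_sub' x y
          simp; linarith) y (by simp; linarith)
        have b := mlr (le_abs_self C1) hp
        linarith
      · have := h3 y (by linarith) x (by rw [mem_closedBall, dist_eq_norm]; linarith)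
        have b : ‖y‖ ^ (-(α + ζ')) ≤ 1 := Real.rpow_le_one_of_one_le_of_nonpos (by linarith) (by linarith)
        have b2 := mll b a3
        linarith
  · gcongr; linarith [abs_nonneg C1]
theorem Ell.inv2 (h : Ell l m X) (hl : 0 < l) : MAx.inv (MAx.inv X) = X := inv_eq (h.inv_mul hl) (h.mul_inv hl)
theorem AHI {r0 K : ℝ} (hv : ∀ y, v y ≤ (1 / 2 - η) * ‖y‖ ^ 2 + K)
    (hA : ∀ r, r0 ≤ r → Ap (rs v 0 r) A (D / r)) (h : E n) : ⟪A h, h⟫ ≤ (1 - 2 * η) * ‖h‖ ^ 2 := by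
  have h1 : ∀ e : E n, ‖e‖ ≤ 1 → ⟪A e, e⟫ ≤ (1 - 2 * η) * ‖e‖ ^ 2 := fun e he => by
    have t : Tendsto (fun r : ℝ => (1 - 2 * η) * ‖e‖ ^ 2 + (2 * K - 2 * v 0) * (r⁻¹ * r⁻¹) + 4 * D * r⁻¹) atTop (𝓝 ((1 - 2 * η) * ‖e‖ ^ 2 + (2 * K - 2 * v 0) * (0 * 0) + 4 * D * 0)) :=
      (((tendsto_inv_atTop_zero.mul tendsto_inv_atTop_zero).const_mul _).const_add _).add (tendsto_inv_atTop_zero.const_mul _)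
    rw [mul_zero, mul_zero, mul_zero, add_zero, add_zero] at t
    refine ge_of_tendsto t ?_
    filter_upwards [eventually_ge_atTop r0, eventually_gt_atTop 0] with r hr hr0
    obtain ⟨-, c, p, ha⟩ := hA r hr
    have a1 := (abs_le.1 (ha e (by simpa using he))).1
    have a2 := (abs_le.1 (ha (-e) (by simpa using he))).1
    have a3 := (abs_le.1 (ha 0 (by simp))).2
    have e1 := mll (hv (r • e)) (pp : 0 ≤ (r ^ 2)⁻¹)
    have e2 := mll (hv (-(r • e))) (pp : 0 ≤ (r ^ 2)⁻¹)
    have e3 : (r ^ 2)⁻¹ * ((1 / 2 - η) * ‖r • e‖ ^ 2 + K) = (1 / 2 - η) * ‖e‖ ^ 2 + K * (r⁻¹ * r⁻¹) := by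
      rw [norm_smul, rnn hr0.le]; field_simp
    rw [norm_neg, e3] at e2
    rw [e3] at e1
    simp only [rs, qd, zero_add, smul_neg, map_neg, inner_neg_right, inner_neg_left, neg_neg, smul_zero, map_zero, inner_zero_right, mul_zero, add_zero] at a1 a2 a3
    have e4 : (r ^ 2)⁻¹ * v 0 = v 0 * (r⁻¹ * r⁻¹) := by field_simp
    rw [e4] at a3
    rw [div_eq_mul_inv] at a1 a2 a3
    linarith
  rcases eq_or_ne h 0 with rfl | hh
  · simp
  have hp := norm_pos_iff.2 hh
  have := h1 (‖h‖⁻¹ • h) (by rw [norm_smul]; simp [hp.ne'])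
  simp only [map_smul, isl, inner_smul_right, norm_smul, norm_inv, norm_norm, inv_mul_cancel₀ hp.ne'] at this
  rw [← mul_assoc, ← mul_inv, inv_mul_eq_div, div_le_iff₀ pp] at this
  linarith
theorem VV (hn : 2 ≤ n) {C1 : ℝ} (hα : 0 < α) (hα1 : α < 1) (hζ : 0 < ζ) {Q G} (hw : C2 univ w Q G) (hμ : 0 < μ)
    (hlo : ∀ x h, μ * ‖h‖ ^ 2 ≤ ⟪G x h, h⟫) (hC1 : 0 < C1) (hgr : ∀ x, w x ≤ C1 * (1 + ‖x‖ ^ 2))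
    (hp : ∀ x, 0 < (1 - μ • inv (G x)).det) (hg : ∀ x, ldet (1 - μ • inv (G x)) = g x)
    {K : ℝ} (hK : 0 ≤ K) (hΓ : 0 < Γ) (hR : 0 < R) (k1 : ∀ x, |g x - g0| ≤ K / (1 + ‖x‖)) (k2 : ∀ x y, |g x - g y| ≤ Γ * ‖x - y‖ ^ α)
    (k3 : ∀ y, R ≤ ‖y‖ → ∀ x ∈ closedBall y (‖y‖ / 2), |g x - g y| ≤ Γ * ‖y‖ ^ (-(α + ζ)) * ‖x - y‖ ^ α) :
    ∃ (X : E n → E n) (A : L n) (C η lam : ℝ), 0 < C ∧ 0 < η ∧ 0 < lam ∧ lam < 1 ∧ Continuous X ∧ Ell lam (1 - 2 * η) A ∧ ldet A = g0 ∧ (∀ x, X (Q x) = x) ∧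
      (∀ y z, ‖X y - X z‖ ≤ μ⁻¹ * ‖y - z‖) ∧ (∀ y, 1 ≤ ‖y‖ → ‖1 - μ • inv (G (X y)) - A‖ ≤ C * ‖y‖ ^ (-(min 1 ζ))) ∧
      Tendsto (fun y => 1 - μ • inv (G (X y))) (cocompact _) (𝓝 A) ∧ ∀ x y, ‖(1 - μ • inv (G (X x))) - (1 - μ • inv (G (X y)))‖ ≤ C * ‖x - y‖ ^ α := by
  set lam := min (1 / 2) (Real.exp (g0 - K))
  have hl : 0 < lam := lt_min nm (Real.exp_pos _)
  have hl1 : lam < 1 := (min_le_left _ _).trans_lt nm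
  have hdet : ∀ x, lam ≤ (1 - μ • inv (G x)).det := fun x => (min_le_right _ _).trans (by
    rw [← Real.le_log_iff_exp_le (hp x)]
    have := hg x; rw [ldet] at this
    rw [this]
    have := (abs_le.1 ((k1 x).trans (div_le_self hK (by linarith [norm_nonneg x])))).1
    linarith)
  obtain ⟨v, X, c, K', η, hc, hη, hv, hXQ, -, hX, hXc, hvg⟩ := LEG hw hμ hlo hC1 hgr hdet
  have hXcont : Continuous X := (LipschitzWith.of_dist_le_mul (K := ⟨μ⁻¹, pp⟩) fun y z => by
    rw [dist_eq_norm, dist_eq_norm]; exact hX y z).continuous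
  have q1 : ∀ x, |g (X x) - g0| ≤ (K / c) / (1 + ‖x‖) := fun x => (k1 _).trans (by rw [div_div]; gcongr; exact hXc x)
  have q2 : ∀ x y, Γ * ‖X x - X y‖ ^ α ≤ Γ * μ⁻¹ ^ α * ‖x - y‖ ^ α := fun x y => by
    rw [mul_assoc, ← Real.mul_rpow pp (norm_nonneg _)]; gcongr; exact hX x y
  set Γ' := Γ * μ⁻¹ ^ α * (1 + (c / 2) ^ (-(α + ζ)))
  have hc2 : 0 < (c / 2) ^ (-(α + ζ)) := pp
  have q3 : ∀ y, 2 * (R + 1) / c ≤ ‖y‖ → ∀ x ∈ closedBall y (min 1 (μ * c / 4) * ‖y‖), |g (X x) - g (X y)| ≤ Γ' * ‖y‖ ^ (-(α + ζ)) * ‖x - y‖ ^ α := fun y hy x hx => by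
    rw [div_le_iff₀ hc] at hy
    have hy0 : 0 < ‖y‖ := by by_contra! hh; nlinarith
    have h1 := hXc y
    have h2 : c / 2 * ‖y‖ ≤ ‖X y‖ := by linarith
    have h3 : ‖X x - X y‖ ≤ ‖X y‖ / 2 := (hX x y).trans (by
      rw [inv_mul_le_iff₀ hμ]
      rw [mem_closedBall, dist_eq_norm] at hx
      have : min 1 (μ * c / 4) * ‖y‖ ≤ μ * c / 4 * ‖y‖ := by gcongr; exact min_le_right _ _
      have := mll h2 hμ.le
      linarith)
    have h4 := k3 (X y) (by linarith) (X x) (by rwa [mem_closedBall, dist_eq_norm])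
    have h5 : ‖X y‖ ^ (-(α + ζ)) ≤ (c / 2) ^ (-(α + ζ)) * ‖y‖ ^ (-(α + ζ)) := by
      rw [← Real.mul_rpow pp hy0.le]
      exact Real.rpow_le_rpow_of_nonpos pp h2 (by linarith)
    calc _ ≤ _ := h4
      _ = ‖X y‖ ^ (-(α + ζ)) * (Γ * ‖X x - X y‖ ^ α) := by ring
      _ ≤ ((c / 2) ^ (-(α + ζ)) * ‖y‖ ^ (-(α + ζ))) * (Γ * μ⁻¹ ^ α * ‖x - y‖ ^ α) := mul_le_mul h5 (q2 x y) pp pp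
      _ ≤ ((1 + (c / 2) ^ (-(α + ζ))) * ‖y‖ ^ (-(α + ζ))) * (Γ * μ⁻¹ ^ α * ‖x - y‖ ^ α) := by gcongr; linarith
      _ = _ := by simp only [Γ']; ring
  simp only [← hg] at q1 q3
  obtain ⟨A, r0, D, C, hA, -, hC, hAp, hr, hH⟩ := MAINV hn hl hl1.le hα hα1 hζ hv (pp : 0 ≤ K / c) (pp : 0 < Γ') (pp : 0 < min 1 (μ * c / 4)) (min_le_left _ _) q1
    (fun x y _ => by
      rw [hg, hg]; refine (k2 _ _).trans ((q2 x y).trans ?_)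
      gcongr; exact le_mul_of_one_le_right pp (by linarith)) q3
  have : Nonempty (Fin n) := ⟨⟨0, by omega⟩⟩
  have : NoncompactSpace (E n) := NormedSpace.noncompactSpace ℝ _
  have ht : Tendsto (fun y => 1 - μ • inv (G (X y))) (cocompact _) (𝓝 A) := by
    rw [tendsto_iff_norm_sub_tendsto_zero]
    refine squeeze_zero' (Eventually.of_forall fun _ => norm_nonneg _) ?_
      (((tendsto_rpow_neg_atTop (pp : 0 < min 1 ζ)).comp (tendsto_norm_cocompact_atTop (E := E n))).const_mul C |>.trans (by rw [mul_zero]))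
    filter_upwards [tendsto_norm_cocompact_atTop.eventually_ge_atTop 1] with y hy using hr y hy
  have hE : Ell lam (1 - 2 * η) A := ⟨hA, fun h => ge_of_tendsto (((ContinuousLinearMap.apply ℝ (E n) h).continuous.tendsto A).comp ht |>.inner tendsto_const_nhds)
    (Eventually.of_forall fun y => (hv.ell y).lo h), AHI hvg hAp⟩
  have hd : Tendsto (fun y => ldet (1 - μ • inv (G (X y)))) (cocompact _) (𝓝 (ldet A)) :=
    ((ContinuousLinearMap.continuous_det.tendsto A).log (hE.det_pos hl).ne').comp ht
  have hd2 : Tendsto (fun y => ldet (1 - μ • inv (G (X y)))) (cocompact _) (𝓝 g0) := by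
    rw [tendsto_iff_norm_sub_tendsto_zero]
    exact squeeze_zero (fun _ => norm_nonneg _) q1 (tendsto_const_nhds.div_atTop (tendsto_atTop_add_const_left _ _ (tendsto_norm_cocompact_atTop (E := E n))))
  exact ⟨X, A, C, η, lam, hC, hη, hl, hl1, hXcont, hE, tendsto_nhds_unique hd hd2, hXQ, hX, hr, ht, hH⟩
theorem FIN (hα : 0 < α) (hε : 0 < ε) {Q G} (hw : C2 univ w Q G) (hμ : 0 < μ)
    (hlo : ∀ x h, μ * ‖h‖ ^ 2 ≤ ⟪G x h, h⟫) {X : E n → E n} (hC : 0 < C) (hη : 0 < η) (hl : 0 < lam) (hl1 : lam < 1) (hXc : Continuous X)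
    (hA : Ell lam (1 - 2 * η) A) (hg : ldet A = g0) (hXQ : ∀ x, X (Q x) = x) (hX : ∀ y z, ‖X y - X z‖ ≤ μ⁻¹ * ‖y - z‖)
    (hr : ∀ y, 1 ≤ ‖y‖ → ‖1 - μ • inv (G (X y)) - A‖ ≤ C * ‖y‖ ^ (-ε))
    (ht : Tendsto (fun y => 1 - μ • inv (G (X y))) (cocompact _) (𝓝 A)) (hH : ∀ x y, ‖(1 - μ • inv (G (X x))) - (1 - μ • inv (G (X y)))‖ ≤ C * ‖x - y‖ ^ α) :
    ∃ (Z : L n) (D : ℝ), Sy Z ∧ 0 < D ∧ (∀ h ≠ 0, μ * ‖h‖ ^ 2 < ⟪Z h, h⟫) ∧ ldet (1 - μ • inv Z) = g0 ∧ (∀ x, ‖G x‖ ≤ D) ∧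
      (∀ x y, ‖G x - G y‖ ≤ D * ‖x - y‖ ^ α) ∧ ∀ x, 1 ≤ ‖x‖ → ‖G x - Z‖ ≤ D * ‖x‖ ^ (-ε) := by
  have hE : ∀ x, Ell μ ‖G x‖ (G x) := fun x => ⟨fun y z => hw.sym isOpen_univ trivial y z, hlo x, fun h => (le_abs_self _).trans ((inner_le_mn le_rfl h h).trans_eq (by ring))⟩
  obtain ⟨B, hB0, hBη, hB⟩ : ∃ B, 0 < B ∧ μ / η ≤ B ∧ ∀ x, ‖G x‖ ≤ B := by
    obtain ⟨S, hS, hSs⟩ := mem_cocompact.1 (ht (ball_mem_nhds A hη))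
    obtain ⟨B, hB⟩ := hS.exists_bound_of_continuousOn (f := fun y => G (X y)) (hw.cG.comp hXc).continuousOn
    refine ⟨max B (μ / η), lt_max_of_lt_right pp, le_max_right _ _, fun x => ?_⟩
    by_cases hx : Q x ∈ S
    · rw [← hXQ x]; exact (hB _ hx).trans (le_max_left _ _)
    · have h1 := hSs hx
      rw [mem_preimage, mem_ball, dist_eq_norm, hXQ] at h1
      have h2 : Ell (η / μ) μ⁻¹ (inv (G x)) := ⟨((hE x).inv hμ).sym, fun h => by
        have a1 := le_of_abs_le (inner_le_mn h1.le h h)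
        have a2 := hA.hi h
        simp only [sub_apply, smul_apply, inner_sub_left, isl, one_apply_eq_self, rsq] at a1
        rw [div_mul_eq_mul_div, div_le_iff₀ hμ]; linarith, ((hE x).inv hμ).hi⟩
      have h3 := h2.inv pp
      rw [(hE x).inv2 hμ, inv_inv, inv_div] at h3
      exact (h3.norm_le hμ.le pp).trans (le_max_right _ _)
  have hEi : ∀ x, Ell B⁻¹ μ⁻¹ (inv (G x)) := fun x => (Ell.mono (hE x) le_rfl (hB x)).inv hμ
  set Y := μ⁻¹ • (1 - A) with hY
  have hY1 : Ell B⁻¹ ((1 - lam) / μ) Y := by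
    have e : ∀ h, ⟪Y h, h⟫ = (‖h‖ ^ 2 - ⟪A h, h⟫) / μ := fun h => by
      simp only [hY, sub_apply, smul_apply, inner_sub_left, isl, one_apply_eq_self, rsq]; ring
    refine ⟨(Sy.sub (by simpa using Sy.smul1 (n := n) 1) hA.sym).sm _, fun h => ?_, fun h => ?_⟩
    · rw [e, le_div_iff₀ hμ, mul_right_comm, mul_comm, mul_comm B⁻¹]
      have : μ * B⁻¹ ≤ η := by rw [← div_eq_mul_inv, div_le_iff₀ hB0]; rwa [div_le_iff₀' hη] at hBη
      have := mll this (sq_nonneg ‖h‖)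
      have := mul_nonneg (sq_nonneg ‖h‖) hη.le
      linarith [hA.hi h]
    · rw [e, div_mul_eq_mul_div]; gcongr; linarith [hA.lo h]
  have hlm : 0 < (1 - lam) / μ := div_pos (by linarith) hμ
  have hBi : 0 < B⁻¹ := inv_pos.2 hB0
  have hY2 : Ell B⁻¹ μ⁻¹ Y := Ell.mono hY1 le_rfl (by rw [← one_div]; gcongr; linarith)
  have hZ := hY1.inv hBi
  have hZ2 := hY2.inv hBi
  rw [inv_inv] at hZ hZ2
  rw [inv_inv] at hZ2
  have key : ∀ {U V : L n}, Ell B⁻¹ μ⁻¹ (inv U) → Ell B⁻¹ μ⁻¹ V → inv (inv U) = U → ‖U - inv V‖ ≤ B ^ 2 * μ⁻¹ * ‖1 - μ • inv U - (1 - μ • V)‖ := fun {U V} hU hV e => by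
    have := inv_lip hBi pp hV hU
    rw [e, inv_inv, show V - inv U = μ⁻¹ • (1 - μ • inv U - (1 - μ • V)) by
      rw [sub_sub_sub_cancel_left, ← smul_sub, smul_smul, inv_mul_cancel₀ hμ.ne', one_smul], norm_smul, rnn pp, ← mul_assoc] at this
    exact this
  have hYA : 1 - μ • Y = A := by rw [hY, smul_smul, mul_inv_cancel₀ hμ.ne', one_smul, sub_sub_cancel]
  have hQ : ∀ x y, ‖Q x - Q y‖ ≤ B * ‖x - y‖ := fun x y => convex_univ.norm_image_sub_le_of_norm_hasFDerivWithin_le (fun z _ => (hw.d2 z trivial).hasFDerivWithinAt) (fun z _ => hB z) trivial trivial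
  set ρ := 2 * (‖Q 0‖ + 1) / μ
  have hρ : 0 < ρ := pp
  set M := B ^ 2 * μ⁻¹ * C
  have hM : 0 < M := pp
  have p1 : 0 < M * B ^ α := pp
  have p2 : 0 < M * (μ / 2) ^ (-ε) := pp
  have p3 : 0 < 2 * B * ρ ^ ε := pp
  refine ⟨inv Y, B + M * B ^ α + M * (μ / 2) ^ (-ε) + 2 * B * ρ ^ ε, hZ.sym, pp, fun h hh => ?_, ?_, fun x => (hB x).trans (by linarith), fun x y => ?_, fun x hx => ?_⟩
  · refine lt_of_lt_of_le ?_ (hZ.lo h)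
    rw [inv_div]
    have := norm_pos_iff.2 hh
    gcongr
    rw [lt_div_iff₀ (by linarith)]; nlinarith
  · rw [hY2.inv2 hBi, hYA, hg]
  · have := key (hEi x) (hEi y) ((hE x).inv2 hμ)
    rw [(hE y).inv2 hμ] at this
    have h2 := hH (Q x) (Q y)
    rw [hXQ, hXQ] at h2
    calc _ ≤ _ := this
      _ ≤ B ^ 2 * μ⁻¹ * (C * (B * ‖x - y‖) ^ α) := by gcongr; exact h2.trans (by gcongr; exact hQ x y)
      _ = M * B ^ α * ‖x - y‖ ^ α := by rw [Real.mul_rpow hB0.le (norm_nonneg _)]; ring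
      _ ≤ _ := by gcongr; linarith
  · have hx0 : 0 < ‖x‖ := by linarith
    rcases le_total ‖x‖ ρ with h | h
    · calc _ ≤ ‖G x‖ + ‖inv Y‖ := norm_sub_le _ _
        _ ≤ 2 * B := by linarith [hB x, hZ2.norm_le hμ.le hB0.le]
        _ ≤ 2 * B * (ρ ^ ε * ‖x‖ ^ (-ε)) := by
          refine le_mul_of_one_le_right pp ?_
          rw [Real.rpow_neg hx0.le, ← div_eq_mul_inv, one_le_div pp]; gcongr
        _ = 2 * B * ρ ^ ε * ‖x‖ ^ (-ε) := by ring
        _ ≤ _ := by gcongr; linarith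
    · have h1 := hX (Q x) (Q 0)
      rw [hXQ, hXQ, sub_zero, inv_mul_eq_div, le_div_iff₀ hμ] at h1
      have h2 := norm_sub_le (Q x) (Q 0)
      rw [div_le_iff₀ hμ] at h
      have h3 : μ / 2 * ‖x‖ ≤ ‖Q x‖ := by linarith
      have h4 := hr (Q x) (by linarith [norm_nonneg (Q 0)])
      have := key (hEi x) hY2 ((hE x).inv2 hμ)
      rw [hXQ] at h4
      rw [hYA] at this
      calc _ ≤ _ := this
        _ ≤ B ^ 2 * μ⁻¹ * (C * (μ / 2 * ‖x‖) ^ (-ε)) := by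
          gcongr; refine h4.trans ?_
          gcongr ?_ * ?_
          exact Real.rpow_le_rpow_of_nonpos pp h3 (by linarith)
        _ = M * (μ / 2) ^ (-ε) * ‖x‖ ^ (-ε) := by rw [Real.mul_rpow pp (norm_nonneg _)]; ring
        _ ≤ _ := by gcongr; linarith

end

end MAx

/-- **Theorem 2.1, case τ ∈ (0, π/4)**: with `a = cot τ`, `b = √(a²-1)`, if `u ∈ C²(ℝⁿ)`
solves `(√(a²+1)/(2b)) Σᵢ ln((λᵢ(D²u)+a-b)/(λᵢ(D²u)+a+b)) = f` with `u ≤ C(1+|x|²)`,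
`D²u > (-a+b)I`, `n ≥ 3`, `f` locally `C^α`, and
`limsup_{|x|→∞}(|x|^ζ|f - f(∞)| + |x|^{α+ζ'}[f]_{C^α(B̄_{|x|/2}(x))}) < ∞` with `ζ > 1`,
`ζ' > 0`, then `D²u` is globally bounded in `C^α` and converges at a Hölder rate
`C'|x|^{-ε}` to a symmetric matrix `A` with `A > (-a+b)I` and `F_τ(λ(A)) = f(∞)`. -/
theorem hessian_convergence_tau_between_zero_pi_div_four
    (n : ℕ) (hn : 3 ≤ n) (α ζ ζ' : ℝ) (hα₀ : 0 < α) (hα₁ : α < 1)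
    (hζ : 1 < ζ) (hζ' : 0 < ζ')
    (τ : ℝ) (hτ₀ : 0 < τ) (hτ₁ : τ < Real.pi / 4)
    (a b : ℝ) (ha : a = Real.cos τ / Real.sin τ) (hb : b = Real.sqrt (a ^ 2 - 1))
    (f : EuclideanSpace ℝ (Fin n) → ℝ) (finf : ℝ)
    (hf_holder : ∀ K : Set (EuclideanSpace ℝ (Fin n)), IsCompact K →
      ∃ C : ℝ, ∀ x ∈ K, ∀ y ∈ K, |f x - f y| ≤ C * ‖x - y‖ ^ α)
    (hf_lim : Tendsto f (cocompact _) (nhds finf))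
    (hf_decay : ∃ C R : ℝ, 0 < C ∧ 0 < R ∧ ∀ x : EuclideanSpace ℝ (Fin n), R ≤ ‖x‖ →
      ‖x‖ ^ ζ * |f x - finf| ≤ C ∧
      ∀ y ∈ Metric.closedBall x (‖x‖ / 2), ∀ z ∈ Metric.closedBall x (‖x‖ / 2),
        ‖x‖ ^ (α + ζ') * |f y - f z| ≤ C * ‖y - z‖ ^ α)
    (u : EuclideanSpace ℝ (Fin n) → ℝ) (hu : ContDiff ℝ 2 u)
    (hsym : ∀ x, (hess u x).IsHermitian)
    (heq : ∀ x, (Real.sqrt (a ^ 2 + 1) / (2 * b)) *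
      ∑ i, Real.log (((hsym x).eigenvalues i + a - b) / ((hsym x).eigenvalues i + a + b))
        = f x)
    (hgrow : ∃ C : ℝ, ∀ x : EuclideanSpace ℝ (Fin n), u x ≤ C * (1 + ‖x‖ ^ 2))
    (hsemiconv : ∀ x, (hess u x - (-a + b) • (1 : Matrix (Fin n) (Fin n) ℝ)).PosDef) :
    ∃ (ε C' : ℝ) (A : Matrix (Fin n) (Fin n) ℝ) (hA : A.IsHermitian),
      0 < ε ∧ 0 < C' ∧
      (A - (-a + b) • (1 : Matrix (Fin n) (Fin n) ℝ)).PosDef ∧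
      ((Real.sqrt (a ^ 2 + 1) / (2 * b)) *
        ∑ i, Real.log ((hA.eigenvalues i + a - b) / (hA.eigenvalues i + a + b)) = finf) ∧
      (∀ (x : EuclideanSpace ℝ (Fin n)) (i j : Fin n), |hess u x i j| ≤ C') ∧
      (∀ (x y : EuclideanSpace ℝ (Fin n)) (i j : Fin n),
        |hess u x i j - hess u y i j| ≤ C' * ‖x - y‖ ^ α) ∧
      (∀ x : EuclideanSpace ℝ (Fin n), 1 ≤ ‖x‖ → ∀ i j : Fin n,
        |hess u x i j - A i j| ≤ C' * ‖x‖ ^ (-ε)) := by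
  have hs : 0 < Real.sin τ := Real.sin_pos_of_pos_of_lt_pi hτ₀ (by linarith [Real.pi_pos])
  have ha1 : 1 < a := by
    rw [ha, one_lt_div hs, ← Real.cos_pi_div_two_sub]
    exact Real.cos_lt_cos_of_nonneg_of_le_pi hτ₀.le (by linarith) (by linarith)
  have hb0 : 0 < b := by rw [hb]; exact Real.sqrt_pos.2 (by nlinarith)
  set κ := Real.sqrt (a ^ 2 + 1) / (2 * b)
  have hκ : 0 < κ := by positivity
  obtain ⟨K, Γ, R, hK, hΓ, hR, k1, k2, k3⟩ := MAx.GF hα₀ hζ hζ' hf_holder hf_decay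
  obtain ⟨Cu, hCu⟩ := hgrow
  obtain ⟨P, hP⟩ := MAx.hess_C2 hu hsym
  have hpd := fun x => (MAx.op_pd (hsym x) _).1 (hsemiconv x)
  have hw := hP.add (MAx.qd_C2 Set.univ 0 0 (MAx.Sy.smul1 (n := n) (a + b)))
  have hky := fun x => MAx.KEY (hsym x) hb0 (hpd x)
  have hμ : 0 < 2 * b := by positivity
  have hlo : ∀ x h, 2 * b * ‖h‖ ^ 2 ≤ inner ℝ ((MAx.op (hess u x) + (a + b) • 1) h) h := fun x h => by
    simp only [add_apply, smul_apply, inner_add_left, inner_smul_left, one_apply_eq_self, RCLike.conj_to_real, real_inner_self_eq_norm_sq]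
    rcases eq_or_ne h 0 with rfl | hh
    · simp
    · linarith [hpd x h hh]
  have sc : ∀ {s t B : ℝ}, |s - t| ≤ B → |κ⁻¹ * s - κ⁻¹ * t| ≤ κ⁻¹ * B := fun {s t B} h => by
    rw [← mul_sub, abs_mul, abs_of_pos (inv_pos.2 hκ)]; gcongr
  obtain ⟨X, A, C, η, lam, hC, hη, hl, hl1, hXc, hA, hg, hXQ, hX, hr, ht, hH⟩ := MAx.VV (by omega) (g0 := κ⁻¹ * finf) (g := fun x => κ⁻¹ * f x)
    (C1 := |Cu| + (a + b)) (K := κ⁻¹ * K) (Γ := κ⁻¹ * Γ) hα₀ hα₁ hζ' hw hμ hlo (by positivity)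
    (fun x => by
      have h1 := (hCu x).trans (mul_le_mul_of_nonneg_right (le_abs_self Cu) (by positivity))
      simp only [MAx.qd, smul_apply, inner_smul_left, one_apply_eq_self, RCLike.conj_to_real, real_inner_self_eq_norm_sq, inner_zero_left]
      have := mul_nonneg (by linarith : 0 ≤ a + b) (sq_nonneg ‖x‖)
      linarith) (fun x => (hky x).1) (fun x => by rw [(hky x).2, ← heq x, inv_mul_cancel_left₀ hκ.ne'])
    (by positivity) (by positivity) hR (fun x => by rw [mul_div_assoc]; exact sc (k1 x)) (fun x y => by rw [mul_assoc]; exact sc (k2 x y))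
    (fun y hy x hx => by rw [mul_assoc, mul_assoc, ← mul_assoc Γ]; exact sc (k3 y hy x hx))
  have hε : 0 < min 1 ζ' := lt_min one_pos hζ'
  obtain ⟨Z, D, hZ, hD, hZ1, hZ2, d1, d2, d3⟩ := MAx.FIN hα₀ hε hw hμ hlo hC hη hl hl1 hXc hA hg hXQ hX hr ht hH
  obtain ⟨M, hM⟩ : ∃ M, MAx.op M = Z - (a + b) • 1 := ⟨_, (Matrix.toEuclideanCLM (𝕜 := ℝ) (n := Fin n)).apply_symm_apply _⟩
  have hZM : Z = MAx.op M + (a + b) • 1 := by rw [hM, sub_add_cancel]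
  have hMH : M.IsHermitian := Matrix.IsHermitian.ext fun i j => by
    have := (hZ.sub (MAx.Sy.smul1 (a + b))) (EuclideanSpace.single i 1) (EuclideanSpace.single j 1)
    rw [← hM] at this
    simpa [EuclideanSpace.inner_single_right, EuclideanSpace.inner_single_left, MAx.op_ij] using this
  have hM1 : ∀ h ≠ 0, (-a + b) * ‖h‖ ^ 2 < inner ℝ (MAx.op M h) h := fun h hh => by
    have := hZ1 h hh
    rw [hZM] at this
    simp only [add_apply, smul_apply, inner_add_left, inner_smul_left, one_apply_eq_self, RCLike.conj_to_real, real_inner_self_eq_norm_sq] at this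
    linarith
  have hk := MAx.KEY hMH hb0 hM1
  rw [← hZM, hZ2] at hk
  have q : 0 ≤ |a + b| * ‖(1 : MAx.L n)‖ := by positivity
  refine ⟨min 1 ζ', D + |a + b| * ‖(1 : MAx.L n)‖, M, hMH, hε, by positivity, (MAx.op_pd hMH _).2 hM1, by rw [← hk.2, mul_inv_cancel_left₀ hκ.ne'], fun x i j => ?_, fun x y i j => ?_, fun x hx i j => ?_⟩
  · refine (MAx.op_le _ i j).trans ?_
    have := norm_sub_le (MAx.op (hess u x) + (a + b) • 1) ((a + b) • (1 : MAx.L n))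
    rw [add_sub_cancel_right, norm_smul, Real.norm_eq_abs] at this
    linarith [d1 x]
  · have := MAx.op_le (hess u x - hess u y) i j
    rw [MAx.op, map_sub] at this
    refine this.trans ?_
    have := d2 x y
    rw [add_sub_add_right_eq_sub] at this
    exact this.trans (by gcongr; linarith)
  · have := MAx.op_le (hess u x - M) i j
    rw [MAx.op, map_sub] at this
    refine this.trans ?_
    have := d3 x hx
    rw [hZM, add_sub_add_right_eq_sub] at this
    exact this.trans (by gcongr; linarith)
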